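/- arXiv:1705.04255 — 2 statements merged into one kernel-verified Lean document; each statement's English description precedes it below -/
import Mathlib

section
/- There exists a constant c > 0 such that for every prime p > 2, every finite sets A, X ⊆ F_p with |A - A|^2 · |X| ≤ p^2, the cardinality of the set {(b-a)^3 + a^3 + x : a,b ∈ A, x ∈ X} is at least c · min( |X|^(1/2)·|A|^4 / |A-A|^3 , |X|·|A|^5 / |A-A|^4 ). -/
open Finset Pointwise

set_option linter.unusedSimpArgs false
/-! Part 1: restriction of polynomials to lines -/

section LRays
open Polynomial

variable {K : Type*} [Field K]

/-- parametrisation of the light ray given by `(θ, u, w)` -/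
noncomputable def lrV (l : K × K × K) : Fin 3 → K[X] :=
  ![C l.2.1 + C l.1 * X, C (l.2.2 + l.1 * l.2.1) + C (l.1 ^ 2) * X, X]

/-- point of the light ray -/
def lrPt (l : K × K × K) (z : K) : Fin 3 → K :=
  ![l.2.1 + l.1 * z, l.2.2 + l.1 * l.2.1 + l.1 ^ 2 * z, z]

/-- restriction -/
noncomputable def lrRs (l : K × K × K) : MvPolynomial (Fin 3) K →ₐ[K] K[X] :=
  MvPolynomial.aeval (lrV l)

/-- partial derivative -/
noncomputable abbrev lrD (i : Fin 3) (f : MvPolynomial (Fin 3) K) : MvPolynomial (Fin 3) K :=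
  MvPolynomial.pderiv i f

lemma lrRs_eval (l : K × K × K) (f : MvPolynomial (Fin 3) K) (z : K) :
    (lrRs l f).eval z = MvPolynomial.eval (lrPt l z) f := by
  induction f using MvPolynomial.induction_on with
  | C a => simp [lrRs]
  | add p q hp hq => simp [hp, hq]
  | mul_X p i hp =>
    rw [map_mul, Polynomial.eval_mul, hp, map_mul]
    congr 1
    fin_cases i <;> simp [lrRs, lrV, lrPt]

lemma lrRs_deriv (l : K × K × K) (f : MvPolynomial (Fin 3) K) :
    derivative (lrRs l f) = C l.1 * lrRs l (lrD 0 f) + C (l.1 ^ 2) * lrRs l (lrD 1 f)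
      + lrRs l (lrD 2 f) := by
  induction f using MvPolynomial.induction_on with
  | C a => simp [lrRs, lrD]
  | add p q hp hq => simp only [map_add, hp, hq, lrD]; ring
  | mul_X p i hp =>
    rw [map_mul, derivative_mul, hp]
    simp only [lrD, Derivation.leibniz, smul_eq_mul, map_add, map_mul]
    have h0 : derivative (C l.1 ^ 2) = 0 := by rw [← C_pow, derivative_C]
    fin_cases i <;> simp [lrRs, lrV, MvPolynomial.pderiv_X, h0] <;> ring

lemma lrD_comm (i j : Fin 3) (f : MvPolynomial (Fin 3) K) :
    lrD i (lrD j f) = lrD j (lrD i f) := by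
  have : ⁅MvPolynomial.pderiv (R := K) i, MvPolynomial.pderiv (R := K) j⁆ = 0 := by
    apply MvPolynomial.derivation_ext
    intro k
    rw [Derivation.commutator_apply]
    simp [MvPolynomial.pderiv_X, Pi.single_apply]
    split_ifs <;> simp
  have h2 := congrArg (fun d => d f) this
  simp only [Derivation.commutator_apply, Derivation.coe_zero, Pi.zero_apply] at h2
  exact sub_eq_zero.mp h2

lemma lrD_degree (i : Fin 3) (f : MvPolynomial (Fin 3) K) (N : ℕ) (h : f.totalDegree ≤ N + 1) :
    (lrD i f).totalDegree ≤ N := by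
  rw [MvPolynomial.totalDegree]
  apply Finset.sup_le
  intro m hm
  have h1 : MvPolynomial.coeff (m + Finsupp.single i 1) f ≠ 0 := by
    intro h0
    rw [MvPolynomial.mem_support_iff, MvPolynomial.coeff_pderiv, h0] at hm
    simp at hm
  have h2 := MvPolynomial.le_totalDegree (MvPolynomial.mem_support_iff.mpr h1)
  rw [Finsupp.sum_add_index' (by simp) (by simp)] at h2
  simp at h2
  omega

lemma lrD_exists (p : ℕ) [CharP K p] (f : MvPolynomial (Fin 3) K) (hd : f.totalDegree < p)
    (h : ∀ i, lrD i f = 0) : ∃ a, f = MvPolynomial.C a := by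
  refine ⟨MvPolynomial.coeff 0 f, ?_⟩
  ext m
  rw [MvPolynomial.coeff_C]
  split_ifs with h0
  · rw [h0]
  · by_contra hne
    have : ∃ i, m i ≠ 0 := by
      by_contra hc
      push Not at hc
      exact h0 (Finsupp.ext (fun i => (hc i).symm))
    obtain ⟨i, hi⟩ := this
    have hle := MvPolynomial.le_totalDegree (MvPolynomial.mem_support_iff.mpr hne)
    have hmi : m i ≤ f.totalDegree := by
      refine le_trans ?_ hle
      rw [Finsupp.sum_fintype _ _ (by simp)]
      exact Finset.single_le_sum (f := fun i => m i) (fun _ _ => Nat.zero_le _) (Finset.mem_univ i)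
    have hk := congrArg (MvPolynomial.coeff (m - Finsupp.single i 1)) (h i)
    rw [MvPolynomial.coeff_pderiv, MvPolynomial.coeff_zero] at hk
    have hm : m - Finsupp.single i 1 + Finsupp.single i 1 = m := by
      apply tsub_add_cancel_of_le
      simp
      omega
    rw [hm] at hk
    have h2 : (((m - Finsupp.single i 1 : Fin 3 →₀ ℕ) i : ℕ) : K) + 1 = ((m i : ℕ) : K) := by
      have : (m - Finsupp.single i 1 : Fin 3 →₀ ℕ) i + 1 = m i := by simp; omega
      exact_mod_cast congrArg (Nat.cast (R := K)) this
    rw [h2] at hk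
    rcases mul_eq_zero.mp hk with h3 | h3
    · exact hne h3
    · rw [CharP.cast_eq_zero_iff K p] at h3
      have := Nat.le_of_dvd (by omega) h3
      omega

lemma lrRs_natDegree (l : K × K × K) (f : MvPolynomial (Fin 3) K) (N : ℕ)
    (h : f.totalDegree ≤ N) : (lrRs l f).natDegree ≤ N := by
  have := MvPolynomial.aeval_natDegree_le f h (lrV l) (n := 1) ?_
  · simpa [lrRs] using this
  · intro i
    fin_cases i
    · simp [lrV]; compute_degree
    · simp only [lrV]; simp; compute_degree
    · simp [lrV]

end LRays
section LJets
variable {K : Type*} [Field K]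

lemma jetP (θ t f0 f1 f2 f00 f01 f02 f11 f12 f22 : K) (ht : t ≠ 0)
    (h1 : θ * f0 + θ ^ 2 * f1 + f2 = 0)
    (h1' : (θ + t) * f0 + (θ + t) ^ 2 * f1 + f2 = 0)
    (h2 : θ ^ 2 * f00 + 2 * θ ^ 3 * f01 + 2 * θ * f02 + θ ^ 4 * f11 + 2 * θ ^ 2 * f12 + f22 = 0)
    (h2' : (θ + t) ^ 2 * f00 + 2 * (θ + t) ^ 3 * f01 + 2 * (θ + t) * f02 + (θ + t) ^ 4 * f11
      + 2 * (θ + t) ^ 2 * f12 + f22 = 0)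
    (α β α1 β1 a b c : K)
    (hα : α = f1) (hβ : β = f0 + 2 * θ * f1)
    (hα1 : α1 = θ * f01 + θ ^ 2 * f11 + f12)
    (hβ1 : β1 = θ * f00 + θ ^ 2 * f01 + f02 + 2 * θ * (θ * f01 + θ ^ 2 * f11 + f12))
    (ha : a = f00 + 4 * θ * f01 + 4 * θ ^ 2 * f11) (hb : b = f01 + 2 * θ * f11) (hc : c = f11) :
    β = - t * α ∧ 2 * β1 + t * (a + 2 * α1) + 2 * t ^ 2 * b + t ^ 3 * c = 0 ∧
    2 * β1 * α ^ 3 - β * (a + 2 * α1) * α ^ 2 + 2 * b * β ^ 2 * α - c * β ^ 3 = 0 := by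
  have e1 : β = - t * α := by
    apply mul_left_cancel₀ ht
    subst hα hβ
    linear_combination h1' - h1
  have e2 : 2 * β1 + t * (a + 2 * α1) + 2 * t ^ 2 * b + t ^ 3 * c = 0 := by
    apply mul_left_cancel₀ ht
    subst hα1 hβ1 ha hb hc
    linear_combination h2' - h2
  refine ⟨e1, e2, ?_⟩
  rw [e1]
  linear_combination α ^ 3 * e2

lemma jetW (θ t f0 f1 f2 f00 f01 f02 f11 f12 f22 f000 f001 f002 f011 f012 f022 f111 f112 f122 f222 : K)
    (ht : t ≠ 0) (hf1 : f1 ≠ 0)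
    (h1 : θ * f0 + θ ^ 2 * f1 + f2 = 0)
    (h1' : (θ + t) * f0 + (θ + t) ^ 2 * f1 + f2 = 0)
    (h2 : θ ^ 2 * f00 + 2 * θ ^ 3 * f01 + 2 * θ * f02 + θ ^ 4 * f11 + 2 * θ ^ 2 * f12 + f22 = 0)
    (h2' : (θ + t) ^ 2 * f00 + 2 * (θ + t) ^ 3 * f01 + 2 * (θ + t) * f02 + (θ + t) ^ 4 * f11
      + 2 * (θ + t) ^ 2 * f12 + f22 = 0)
    (h3 : θ ^ 3 * f000 + 3 * θ ^ 4 * f001 + 3 * θ ^ 2 * f002 + 3 * θ ^ 5 * f011 + 6 * θ ^ 3 * f012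
      + 3 * θ * f022 + θ ^ 6 * f111 + 3 * θ ^ 4 * f112 + 3 * θ ^ 2 * f122 + f222 = 0)
    (h3' : (θ + t) ^ 3 * f000 + 3 * (θ + t) ^ 4 * f001 + 3 * (θ + t) ^ 2 * f002
      + 3 * (θ + t) ^ 5 * f011 + 6 * (θ + t) ^ 3 * f012
      + 3 * (θ + t) * f022 + (θ + t) ^ 6 * f111 + 3 * (θ + t) ^ 4 * f112
      + 3 * (θ + t) ^ 2 * f122 + f222 = 0)
    (φ α β α1 β1 α2 β2 : K) (hφ : φ = θ + t)
    (hα : α = f1) (hβ : β = f0 + 2 * θ * f1)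
    (hα1 : α1 = θ * f01 + θ ^ 2 * f11 + f12)
    (hβ1 : β1 = θ * f00 + θ ^ 2 * f01 + f02 + 2 * θ * (θ * f01 + θ ^ 2 * f11 + f12))
    (hα2 : α2 = θ ^ 2 * f001 + 2 * θ ^ 3 * f011 + 2 * θ * f012 + θ ^ 4 * f111 + 2 * θ ^ 2 * f112
      + f122)
    (hβ2 : β2 = θ ^ 2 * f000 + 2 * θ ^ 3 * f001 + 2 * θ * f002 + θ ^ 4 * f011 + 2 * θ ^ 2 * f012
      + f022 + 2 * θ * (θ ^ 2 * f001 + 2 * θ ^ 3 * f011 + 2 * θ * f012 + θ ^ 4 * f111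
        + 2 * θ ^ 2 * f112 + f122))
    (A' a b c A1 B1 A2 B2 a1 b1 c1 : K)
    (hA' : A' = f0 + 2 * φ * f1)
    (hA1 : A1 = φ * f01 + φ ^ 2 * f11 + f12)
    (hB1 : B1 = φ * f00 + φ ^ 2 * f01 + f02 + 2 * φ * (φ * f01 + φ ^ 2 * f11 + f12))
    (hA2 : A2 = φ ^ 2 * f001 + 2 * φ ^ 3 * f011 + 2 * φ * f012 + φ ^ 4 * f111 + 2 * φ ^ 2 * f112
      + f122)
    (hB2 : B2 = φ ^ 2 * f000 + 2 * φ ^ 3 * f001 + 2 * φ * f002 + φ ^ 4 * f011 + 2 * φ ^ 2 * f012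
      + f022 + 2 * φ * (φ ^ 2 * f001 + 2 * φ ^ 3 * f011 + 2 * φ * f012 + φ ^ 4 * f111
        + 2 * φ ^ 2 * f112 + f122))
    (ha : a = f00 + 4 * φ * f01 + 4 * φ ^ 2 * f11) (hb : b = f01 + 2 * φ * f11) (hc : c = f11)
    (ha1 : a1 = φ * f000 + φ ^ 2 * f001 + f002 + 4 * φ * (φ * f001 + φ ^ 2 * f011 + f012)
      + 4 * φ ^ 2 * (φ * f011 + φ ^ 2 * f111 + f112))
    (hb1 : b1 = φ * f001 + φ ^ 2 * f011 + f012 + 2 * φ * (φ * f011 + φ ^ 2 * f111 + f112))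
    (hc1 : c1 = φ * f011 + φ ^ 2 * f111 + f112)
    (hP : 2 * B2 * α ^ 3 + 2 * B1 * (3 * α ^ 2 * A1) - B1 * (a + 2 * A1) * α ^ 2
      - A' * (a1 + 2 * A2) * α ^ 2 - A' * (a + 2 * A1) * (2 * α * A1)
      + 2 * b1 * A' ^ 2 * α + 2 * b * (2 * A' * B1) * α + 2 * b * A' ^ 2 * A1
      - c1 * A' ^ 3 - c * (3 * A' ^ 2 * B1) = 0) :
    β ^ 2 * α2 - α * β * β2 + 2 * β1 * (β1 * α - β * α1) = 0 := by
  have e1 : β = - t * α := by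
    apply mul_left_cancel₀ ht
    subst hα hβ
    linear_combination h1' - h1
  have e1' : A' = t * α := by
    rw [hA', hφ, hα]
    rw [hβ, hα] at e1
    linear_combination e1
  have hα0 : α ≠ 0 := by rw [hα]; exact hf1
  have key2 : 2 * B1 - t * (a + 2 * A1) + 2 * t ^ 2 * b - t ^ 3 * c = 0 := by
    apply mul_left_cancel₀ ht
    subst hA1 hB1 ha hb hc hφ
    linear_combination h2' - h2
  have third : 2 * B2 - t * (a1 + 2 * A2) + 2 * t ^ 2 * b1 - t ^ 3 * c1 = -(β2 + t * α2) := by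
    apply mul_left_cancel₀ ht
    subst hA2 hB2 ha1 hb1 hc1 hφ hα2 hβ2
    linear_combination h3' - h3
  have e3 : B1 - t * A1 = -(β1 + t * α1) := by
    apply mul_left_cancel₀ ht
    subst hA1 hB1 hφ hα1 hβ1
    linear_combination h2' - h2
  have eG : -t * ((a + 2 * A1) - 4 * t * b + 3 * t ^ 2 * c) = 2 * β1 := by
    subst hA1 hB1 ha hb hc hφ hβ1
    linear_combination -key2
  rw [e1'] at hP
  have hP' : α * (2 * B2 - t * (a1 + 2 * A2) + 2 * t ^ 2 * b1 - t ^ 3 * c1)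
      - ((a + 2 * A1) - 4 * t * b + 3 * t ^ 2 * c) * (B1 - t * A1) = 0 := by
    apply mul_left_cancel₀ (pow_ne_zero 2 hα0)
    linear_combination hP - 3 * α ^ 2 * A1 * key2
  rw [third, e3] at hP'
  rw [e1]
  linear_combination (-t * α) * hP' - (α * (β1 + t * α1)) * eG

end LJets
section LCross
open Polynomial
variable {K : Type*} [Field K]

/-- first coefficient -/
noncomputable def lrAl (l : K × K × K) (f : MvPolynomial (Fin 3) K) : K[X] := lrRs l (lrD 1 f)
/-- second coefficient -/
noncomputable def lrBe (l : K × K × K) (f : MvPolynomial (Fin 3) K) : K[X] :=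
  lrRs l (lrD 0 f) + C (2 * l.1) * lrRs l (lrD 1 f)
/-- second order coefficient -/
noncomputable def lrA (l : K × K × K) (f : MvPolynomial (Fin 3) K) : K[X] :=
  lrRs l (lrD 0 (lrD 0 f)) + C (4 * l.1) * lrRs l (lrD 0 (lrD 1 f))
    + C (4 * l.1 ^ 2) * lrRs l (lrD 1 (lrD 1 f))
/-- second order coefficient -/
noncomputable def lrB (l : K × K × K) (f : MvPolynomial (Fin 3) K) : K[X] :=
  lrRs l (lrD 0 (lrD 1 f)) + C (2 * l.1) * lrRs l (lrD 1 (lrD 1 f))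
/-- second order coefficient -/
noncomputable def lrC (l : K × K × K) (f : MvPolynomial (Fin 3) K) : K[X] :=
  lrRs l (lrD 1 (lrD 1 f))

/-- detects crossings -/
noncomputable def lrP (l : K × K × K) (f : MvPolynomial (Fin 3) K) : K[X] :=
  2 * derivative (lrBe l f) * lrAl l f ^ 3
    - lrBe l f * (lrA l f + 2 * derivative (lrAl l f)) * lrAl l f ^ 2
    + 2 * lrB l f * lrBe l f ^ 2 * lrAl l f - lrC l f * lrBe l f ^ 3

/-- detects crossings with rich lines -/
noncomputable def lrW (l : K × K × K) (f : MvPolynomial (Fin 3) K) : K[X] :=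
  lrBe l f ^ 2 * derivative (derivative (lrAl l f))
    - lrAl l f * lrBe l f * derivative (derivative (lrBe l f))
    + 2 * derivative (lrBe l f) * (derivative (lrBe l f) * lrAl l f
      - lrBe l f * derivative (lrAl l f))

lemma lrRs_deriv_eval (l : K × K × K) (f : MvPolynomial (Fin 3) K) (z : K) :
    (derivative (lrRs l f)).eval z = l.1 * MvPolynomial.eval (lrPt l z) (lrD 0 f)
      + l.1 ^ 2 * MvPolynomial.eval (lrPt l z) (lrD 1 f)
      + MvPolynomial.eval (lrPt l z) (lrD 2 f) := by
  rw [lrRs_deriv]; simp only [eval_add, eval_mul, eval_C, lrRs_eval]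

lemma lrRs_deriv2_eval (l : K × K × K) (f : MvPolynomial (Fin 3) K) (z : K) :
    (derivative (derivative (lrRs l f))).eval z =
      l.1 ^ 2 * MvPolynomial.eval (lrPt l z) (lrD 0 (lrD 0 f))
      + 2 * l.1 ^ 3 * MvPolynomial.eval (lrPt l z) (lrD 0 (lrD 1 f))
      + 2 * l.1 * MvPolynomial.eval (lrPt l z) (lrD 0 (lrD 2 f))
      + l.1 ^ 4 * MvPolynomial.eval (lrPt l z) (lrD 1 (lrD 1 f))
      + 2 * l.1 ^ 2 * MvPolynomial.eval (lrPt l z) (lrD 1 (lrD 2 f))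
      + MvPolynomial.eval (lrPt l z) (lrD 2 (lrD 2 f)) := by
  rw [lrRs_deriv]
  simp only [derivative_add, derivative_mul, derivative_C, zero_mul, zero_add, eval_add, eval_mul,
    eval_C, lrRs_deriv_eval]
  rw [lrD_comm 1 0, lrD_comm 2 0, lrD_comm 2 1]
  ring

lemma lrRs_deriv3_eval (l : K × K × K) (f : MvPolynomial (Fin 3) K) (z : K) :
    (derivative (derivative (derivative (lrRs l f)))).eval z =
      l.1 ^ 3 * MvPolynomial.eval (lrPt l z) (lrD 0 (lrD 0 (lrD 0 f)))
      + 3 * l.1 ^ 4 * MvPolynomial.eval (lrPt l z) (lrD 0 (lrD 0 (lrD 1 f)))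
      + 3 * l.1 ^ 2 * MvPolynomial.eval (lrPt l z) (lrD 0 (lrD 0 (lrD 2 f)))
      + 3 * l.1 ^ 5 * MvPolynomial.eval (lrPt l z) (lrD 0 (lrD 1 (lrD 1 f)))
      + 6 * l.1 ^ 3 * MvPolynomial.eval (lrPt l z) (lrD 0 (lrD 1 (lrD 2 f)))
      + 3 * l.1 * MvPolynomial.eval (lrPt l z) (lrD 0 (lrD 2 (lrD 2 f)))
      + l.1 ^ 6 * MvPolynomial.eval (lrPt l z) (lrD 1 (lrD 1 (lrD 1 f)))
      + 3 * l.1 ^ 4 * MvPolynomial.eval (lrPt l z) (lrD 1 (lrD 1 (lrD 2 f)))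
      + 3 * l.1 ^ 2 * MvPolynomial.eval (lrPt l z) (lrD 1 (lrD 2 (lrD 2 f)))
      + MvPolynomial.eval (lrPt l z) (lrD 2 (lrD 2 (lrD 2 f))) := by
  rw [lrRs_deriv]
  simp only [derivative_add, derivative_mul, derivative_C, zero_mul, zero_add, eval_add, eval_mul,
    eval_C, lrRs_deriv2_eval]
  simp only [lrD_comm 1 0, lrD_comm 2 0, lrD_comm 2 1]
  ring

lemma cross_basic {l m : K × K × K} {f : MvPolynomial (Fin 3) K} {z : K}
    (hl : lrRs l f = 0) (hm : lrRs m f = 0) (hlm : l.1 ≠ m.1) (hz : lrPt l z = lrPt m z) :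
    (lrBe l f).eval z = -(m.1 - l.1) * (lrAl l f).eval z ∧
    ((lrAl l f).eval z = 0 → ∀ i, (lrRs l (lrD i f)).eval z = 0) ∧
    (lrP l f).eval z = 0 := by
  have h1 := lrRs_deriv_eval l f z
  have h1' := lrRs_deriv_eval m f z
  have h2 := lrRs_deriv2_eval l f z
  have h2' := lrRs_deriv2_eval m f z
  rw [← hz] at h1' h2'
  simp only [hl, hm, derivative_zero, eval_zero] at h1 h1' h2 h2'
  have hm' : m.1 = l.1 + (m.1 - l.1) := by ring
  rw [hm'] at h1' h2'
  have ht : m.1 - l.1 ≠ 0 := sub_ne_zero.mpr hlm.symm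
  have := jetP l.1 (m.1 - l.1) _ _ _ _ _ _ _ _ _ ht h1.symm h1'.symm h2.symm h2'.symm
    ((lrAl l f).eval z) ((lrBe l f).eval z) ((derivative (lrAl l f)).eval z)
    ((derivative (lrBe l f)).eval z) ((lrA l f).eval z) ((lrB l f).eval z) ((lrC l f).eval z)
    (by simp only [lrAl, lrRs_eval])
    (by simp only [lrBe, lrRs_eval, eval_add, eval_mul, eval_C])
    (by simp only [lrAl, lrRs_deriv_eval]; rw [lrD_comm 2 1])
    (by simp only [lrBe, derivative_add, derivative_mul, derivative_C, zero_mul, zero_add,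
          eval_add, eval_mul, eval_C, lrRs_deriv_eval]
        rw [lrD_comm 1 0, lrD_comm 2 0, lrD_comm 2 1])
    (by simp only [lrA, lrRs_eval, eval_add, eval_mul, eval_C])
    (by simp only [lrB, lrRs_eval, eval_add, eval_mul, eval_C])
    (by simp only [lrC, lrRs_eval])
  obtain ⟨e1, -, e3⟩ := this
  refine ⟨e1, ?_, ?_⟩
  · intro h0
    rw [h0, mul_zero] at e1
    have h01 : MvPolynomial.eval (lrPt l z) (lrD 1 f) = 0 := by
      simpa only [lrAl, lrRs_eval] using h0
    have h00 : MvPolynomial.eval (lrPt l z) (lrD 0 f) = 0 := by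
      simp only [lrBe, lrRs_eval, eval_add, eval_mul, eval_C] at e1
      rw [h01] at e1; simpa using e1
    intro i
    rw [lrRs_eval]
    fin_cases i
    · exact h00
    · exact h01
    · change MvPolynomial.eval (lrPt l z) (lrD 2 f) = 0
      rw [h00, h01] at h1
      simpa using h1.symm
  · simp only [lrP, eval_sub, eval_add, eval_mul, eval_pow, eval_ofNat]
    exact e3

lemma cross_W {l m : K × K × K} {f : MvPolynomial (Fin 3) K} {z : K}
    (hl : lrRs l f = 0) (hm : lrRs m f = 0) (hlm : l.1 ≠ m.1) (hz : lrPt l z = lrPt m z)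
    (hP : lrP m f = 0) :
    (lrW l f).eval z = 0 := by
  by_cases h0 : (lrAl l f).eval z = 0
  · have := (cross_basic hl hm hlm hz).1
    rw [h0, mul_zero] at this
    simp only [lrW, eval_sub, eval_add, eval_mul, eval_pow, eval_ofNat, h0, this]
    ring
  have h1 := lrRs_deriv_eval l f z
  have h1' := lrRs_deriv_eval m f z
  have h2 := lrRs_deriv2_eval l f z
  have h2' := lrRs_deriv2_eval m f z
  have h3 := lrRs_deriv3_eval l f z
  have h3' := lrRs_deriv3_eval m f z
  rw [← hz] at h1' h2' h3'
  simp only [hl, hm, derivative_zero, eval_zero] at h1 h1' h2 h2' h3 h3'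
  have hm' : m.1 = l.1 + (m.1 - l.1) := by ring
  rw [hm'] at h1' h2' h3'
  have ht : m.1 - l.1 ≠ 0 := sub_ne_zero.mpr hlm.symm
  have hP1 : (derivative (lrP m f)).eval z = 0 := by rw [hP]; simp
  have := jetW l.1 (m.1 - l.1) _ _ _ _ _ _ _ _ _ _ _ _ _ _ _ _ _ _ _ ht
    (by simpa only [lrAl, lrRs_eval] using h0) h1.symm h1'.symm h2.symm h2'.symm
    h3.symm h3'.symm m.1
    ((lrAl l f).eval z) ((lrBe l f).eval z) ((derivative (lrAl l f)).eval z)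
    ((derivative (lrBe l f)).eval z) ((derivative (derivative (lrAl l f))).eval z)
    ((derivative (derivative (lrBe l f))).eval z) hm'
    (by simp only [lrAl, lrRs_eval])
    (by simp only [lrBe, lrRs_eval, eval_add, eval_mul, eval_C])
    (by simp only [lrAl, lrRs_deriv_eval]; rw [lrD_comm 2 1])
    (by simp only [lrBe, derivative_add, derivative_mul, derivative_C, zero_mul, zero_add,
          eval_add, eval_mul, eval_C, lrRs_deriv_eval]
        rw [lrD_comm 1 0, lrD_comm 2 0, lrD_comm 2 1])
    (by simp only [lrAl, lrRs_deriv2_eval]; rw [lrD_comm 2 1, lrD_comm 2 1 (lrD 2 f)])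
    (by simp only [lrBe, derivative_add, derivative_mul, derivative_C, zero_mul, zero_add,
          eval_add, eval_mul, eval_C, lrRs_deriv2_eval]
        simp only [lrD_comm 1 0, lrD_comm 2 0, lrD_comm 2 1])
    ((lrBe m f).eval z) ((lrA m f).eval z) ((lrB m f).eval z) ((lrC m f).eval z)
    ((derivative (lrAl m f)).eval z)
    ((derivative (lrBe m f)).eval z) ((derivative (derivative (lrAl m f))).eval z)
    ((derivative (derivative (lrBe m f))).eval z)
    ((derivative (lrA m f)).eval z) ((derivative (lrB m f)).eval z) ((derivative (lrC m f)).eval z)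
    (by simp only [lrBe, lrRs_eval, eval_add, eval_mul, eval_C, hz])
    (by simp only [lrAl, lrRs_deriv_eval, hz]; rw [lrD_comm 2 1])
    (by simp only [lrBe, derivative_add, derivative_mul, derivative_C, zero_mul, zero_add,
          eval_add, eval_mul, eval_C, lrRs_deriv_eval, hz]
        rw [lrD_comm 1 0, lrD_comm 2 0, lrD_comm 2 1])
    (by simp only [lrAl, lrRs_deriv2_eval, hz]; rw [lrD_comm 2 1, lrD_comm 2 1 (lrD 2 f)])
    (by simp only [lrBe, derivative_add, derivative_mul, derivative_C, zero_mul, zero_add,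
          eval_add, eval_mul, eval_C, lrRs_deriv2_eval, hz]
        simp only [lrD_comm 1 0, lrD_comm 2 0, lrD_comm 2 1])
    (by simp only [lrA, lrRs_eval, eval_add, eval_mul, eval_C, hz])
    (by simp only [lrB, lrRs_eval, eval_add, eval_mul, eval_C, hz])
    (by simp only [lrC, lrRs_eval, hz])
    (by simp only [lrA, derivative_add, derivative_mul, derivative_C, zero_mul, zero_add,
          eval_add, eval_mul, eval_C, lrRs_deriv_eval, hz]
        simp only [lrD_comm 1 0, lrD_comm 2 0, lrD_comm 2 1])
    (by simp only [lrB, derivative_add, derivative_mul, derivative_C, zero_mul, zero_add,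
          eval_add, eval_mul, eval_C, lrRs_deriv_eval, hz]
        simp only [lrD_comm 1 0, lrD_comm 2 0, lrD_comm 2 1])
    (by simp only [lrC, lrRs_deriv_eval, hz]
        simp only [lrD_comm 1 0, lrD_comm 2 0, lrD_comm 2 1])
    (by
      have hal : (lrAl l f).eval z = (lrAl m f).eval z := by simp only [lrAl, lrRs_eval, hz]
      rw [← hP1, hal, lrP]
      simp only [derivative_add, derivative_sub, derivative_mul, derivative_pow, derivative_ofNat,
        eval_sub, eval_add, eval_mul, eval_pow, eval_ofNat, eval_C, eval_zero]
      push_cast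
      ring)
  simp only [lrW, eval_sub, eval_add, eval_mul, eval_pow, eval_ofNat]
  exact this

end LCross
section LCount
open Polynomial
variable {K : Type*} [Field K]

lemma poly_const_of_deriv (p : ℕ) [CharP K p] (a : K[X]) (hd : a.natDegree < p)
    (h : derivative a = 0) : ∃ c, a = C c := by
  refine ⟨a.coeff 0, ?_⟩
  ext n
  rw [coeff_C]
  split_ifs with h0
  · rw [h0]
  · obtain ⟨m, rfl⟩ := Nat.exists_eq_succ_of_ne_zero h0
    by_contra hne
    have hk := congrArg (fun q => q.coeff m) h
    simp only [coeff_derivative, coeff_zero] at hk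
    have hle := le_natDegree_of_ne_zero hne
    rcases mul_eq_zero.mp hk with h3 | h3
    · exact hne h3
    · have h4 : ((m + 1 : ℕ) : K) = 0 := by exact_mod_cast h3
      rw [CharP.cast_eq_zero_iff K p] at h4
      have := Nat.le_of_dvd (by omega) h4
      omega

lemma prop_of_wronskian (p : ℕ) [CharP K p] (a b : K[X]) (hb : b ≠ 0) (ha : a.natDegree < p)
    (hbd : b.natDegree < p) (h : derivative a * b = a * derivative b) : ∃ c, a = C c * b := by
  classical
  by_cases ha0 : a = 0
  · exact ⟨0, by simp [ha0]⟩
  obtain ⟨a1, ha1⟩ := EuclideanDomain.gcd_dvd_left a b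
  obtain ⟨b1, hb1⟩ := EuclideanDomain.gcd_dvd_right a b
  set g := EuclideanDomain.gcd a b with hg
  have hg0 : g ≠ 0 := by
    intro h0
    rw [h0, zero_mul] at hb1
    exact hb hb1
  have ha10 : a1 ≠ 0 := by rintro rfl; simp at ha1; exact ha0 ha1
  have hb10 : b1 ≠ 0 := by rintro rfl; simp at hb1; exact hb hb1
  have hcop : IsCoprime a1 b1 := by
    have := EuclideanDomain.gcd_eq_gcd_ab a b
    rw [← hg] at this
    refine ⟨EuclideanDomain.gcdA a b, EuclideanDomain.gcdB a b, ?_⟩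
    apply mul_left_cancel₀ hg0
    linear_combination -this + (-EuclideanDomain.gcdA a b) * ha1 - EuclideanDomain.gcdB a b * hb1
  have hw : wronskian a1 b1 = 0 := by
    apply mul_left_cancel₀ (pow_ne_zero 2 hg0)
    rw [mul_zero, wronskian]
    rw [ha1, hb1] at h
    simp only [derivative_mul] at h
    linear_combination -h
  obtain ⟨h1, h2⟩ := hcop.wronskian_eq_zero_iff.mp hw
  have hda : a1.natDegree ≤ a.natDegree := by
    rw [ha1, natDegree_mul hg0 ha10]; omega
  have hdb : b1.natDegree ≤ b.natDegree := by
    rw [hb1, natDegree_mul hg0 hb10]; omega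
  obtain ⟨c1, hc1⟩ := poly_const_of_deriv p a1 (by omega) h1
  obtain ⟨c2, hc2⟩ := poly_const_of_deriv p b1 (by omega) h2
  have hc20 : c2 ≠ 0 := by rintro rfl; simp at hc2; exact hb10 hc2
  refine ⟨c1 / c2, ?_⟩
  rw [ha1, hb1, hc1, hc2]
  have : C c1 = C (c1 / c2) * C c2 := by rw [← C_mul, div_mul_cancel₀ _ hc20]
  rw [this]; ring

lemma affine_of_W (p e : ℕ) [CharP K p] (he : 1 ≤ e) (hp : 2 * e < p) (a b : K[X]) (hb : b ≠ 0)
    (ha : a.natDegree ≤ e) (hbd : b.natDegree ≤ e)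
    (h : b ^ 2 * derivative (derivative a) - a * b * derivative (derivative b)
      + 2 * derivative b * (derivative b * a - b * derivative a) = 0) :
    ∃ κ c, a = (C κ * X + C c) * b := by
  have hda := natDegree_derivative_le a
  have hdb := natDegree_derivative_le b
  obtain ⟨κ, hκ⟩ := prop_of_wronskian p (derivative a * b - a * derivative b) (b ^ 2)
    (pow_ne_zero 2 hb)
    (by
      refine lt_of_le_of_lt (natDegree_sub_le _ _) ?_
      rw [max_lt_iff]
      constructor
      · exact lt_of_le_of_lt (natDegree_mul_le) (by omega)
      · exact lt_of_le_of_lt (natDegree_mul_le) (by omega))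
    (by rw [natDegree_pow]; omega)
    (by simp only [derivative_sub, derivative_mul, derivative_pow]
        push_cast
        simp only [map_ofNat]
        linear_combination b * h)
  obtain ⟨c, hc⟩ := prop_of_wronskian p (a - C κ * X * b) b hb
    (by
      refine lt_of_le_of_lt (natDegree_sub_le _ _) ?_
      rw [max_lt_iff]
      constructor
      · omega
      · refine lt_of_le_of_lt (natDegree_mul_le) ?_
        have h1 := natDegree_C_mul_le κ (X : K[X])
        have h2 : (X : K[X]).natDegree ≤ 1 := natDegree_X_le
        omega)
    (by omega)
    (by simp only [derivative_sub, derivative_mul, derivative_C, derivative_X]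
        linear_combination hκ)
  exact ⟨κ, c, by linear_combination hc⟩

/-- symplectic form -/
def lrOm (l m : K × K × K) : K := l.2.1 * m.1 - m.2.1 * l.1 - l.2.2 + m.2.2

/-- crossing parameter -/
def lrZ (l m : K × K × K) : K := -(l.2.1 - m.2.1) / (l.1 - m.1)

lemma lrOm_symm (l m : K × K × K) (h : lrOm l m = 0) : lrOm m l = 0 := by
  unfold lrOm at *; linear_combination -h

lemma lrZ_mul {l m : K × K × K} (h : l.1 ≠ m.1) : lrZ l m * (m.1 - l.1) = l.2.1 - m.2.1 := by
  have : l.1 - m.1 ≠ 0 := sub_ne_zero.mpr h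
  unfold lrZ; field_simp; ring

lemma lrPt_cross {l m : K × K × K} (h : l.1 ≠ m.1) (h0 : lrOm l m = 0) :
    lrPt l (lrZ l m) = lrPt m (lrZ l m) := by
  have hz := lrZ_mul h
  set z := lrZ l m
  unfold lrOm at h0
  ext i
  fin_cases i
  · simp [lrPt]; linear_combination -hz
  · simp [lrPt]; linear_combination (-m.1 - l.1) * hz - h0
  · simp [lrPt]

lemma lrOm_of_pt {l m : K × K × K} {z : K} (h : lrPt l z = lrPt m z) : lrOm l m = 0 := by
  have h0 := congrFun h 0
  have h1 := congrFun h 1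
  simp [lrPt] at h0 h1
  unfold lrOm
  linear_combination (l.1+m.1) * h0 - h1

lemma count_roots (l : K × K × K) (T : Finset (K × K × K)) (Q : K[X]) (hQ : Q ≠ 0) (d : ℕ)
    (hd : Q.natDegree ≤ d) (hskew : ∀ m ∈ T, ∀ m' ∈ T, lrOm m m' = 0 → m = m')
    (hdir : ∀ m ∈ T, l.1 ≠ m.1) (hcr : ∀ m ∈ T, lrOm l m = 0)
    (hroot : ∀ m ∈ T, Q.eval (lrZ l m) = 0) : T.card ≤ d := by
  classical
  calc T.card ≤ Q.roots.toFinset.card := by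
        apply Finset.card_le_card_of_injOn (fun m => lrZ l m)
        · intro m hm
          simp only [Finset.mem_coe, Multiset.mem_toFinset]
          rw [mem_roots hQ]
          exact hroot m hm
        · intro m hm m' hm' hz
          apply hskew m hm m' hm'
          have h1 := lrPt_cross (hdir m hm) (hcr m hm)
          have h2 := lrPt_cross (hdir m' hm') (hcr m' hm')
          simp only at hz
          rw [← hz] at h2
          exact lrOm_of_pt (h1.symm.trans h2)
    _ ≤ Multiset.card Q.roots := Multiset.toFinset_card_le _
    _ ≤ Q.natDegree := card_roots' Q
    _ ≤ d := hd

end LCount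
section LMain
open Polynomial
variable {K : Type*} [Field K]

lemma lrD_degree' (i : Fin 3) (f : MvPolynomial (Fin 3) K) (N : ℕ) (h : f.totalDegree ≤ N) :
    (lrD i f).totalDegree ≤ N := lrD_degree i f N (by omega)

lemma lrAl_deg (l : K × K × K) (f : MvPolynomial (Fin 3) K) (N : ℕ) (h : f.totalDegree ≤ N) :
    (lrAl l f).natDegree ≤ N := lrRs_natDegree _ _ _ (lrD_degree' _ _ _ h)

lemma natDegree_C_mul_le' (a : K) (q : K[X]) (N : ℕ) (h : q.natDegree ≤ N) :
    (C a * q).natDegree ≤ N := (natDegree_C_mul_le a q).trans h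

lemma lrBe_deg (l : K × K × K) (f : MvPolynomial (Fin 3) K) (N : ℕ) (h : f.totalDegree ≤ N) :
    (lrBe l f).natDegree ≤ N := by
  unfold lrBe
  apply natDegree_add_le_of_degree_le
  · exact lrRs_natDegree _ _ _ (lrD_degree' _ _ _ h)
  · exact natDegree_C_mul_le' _ _ _ (lrRs_natDegree _ _ _ (lrD_degree' _ _ _ h))

lemma lrC_deg (l : K × K × K) (f : MvPolynomial (Fin 3) K) (N : ℕ) (h : f.totalDegree ≤ N) :
    (lrC l f).natDegree ≤ N := lrRs_natDegree _ _ _ (lrD_degree' _ _ _ (lrD_degree' _ _ _ h))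

lemma lrB_deg (l : K × K × K) (f : MvPolynomial (Fin 3) K) (N : ℕ) (h : f.totalDegree ≤ N) :
    (lrB l f).natDegree ≤ N := by
  unfold lrB
  apply natDegree_add_le_of_degree_le
  · exact lrRs_natDegree _ _ _ (lrD_degree' _ _ _ (lrD_degree' _ _ _ h))
  · exact natDegree_C_mul_le' _ _ _ (lrRs_natDegree _ _ _ (lrD_degree' _ _ _ (lrD_degree' _ _ _ h)))

lemma lrA_deg (l : K × K × K) (f : MvPolynomial (Fin 3) K) (N : ℕ) (h : f.totalDegree ≤ N) :
    (lrA l f).natDegree ≤ N := by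
  unfold lrA
  apply natDegree_add_le_of_degree_le
  · apply natDegree_add_le_of_degree_le
    · exact lrRs_natDegree _ _ _ (lrD_degree' _ _ _ (lrD_degree' _ _ _ h))
    · exact natDegree_C_mul_le' _ _ _ (lrRs_natDegree _ _ _ (lrD_degree' _ _ _ (lrD_degree' _ _ _ h)))
  · exact natDegree_C_mul_le' _ _ _ (lrRs_natDegree _ _ _ (lrD_degree' _ _ _ (lrD_degree' _ _ _ h)))

lemma natDegree_two_mul_le (q : K[X]) (N : ℕ) (h : q.natDegree ≤ N) :
    (2 * q).natDegree ≤ N := by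
  have : (2 : K[X]) = C 2 := (map_ofNat C 2).symm
  rw [this]; exact natDegree_C_mul_le' _ _ _ h

lemma natDegree_der_le (q : K[X]) (N : ℕ) (h : q.natDegree ≤ N) :
    (derivative q).natDegree ≤ N := (natDegree_derivative_le q).trans (by omega)

lemma natDegree_mul_le'' {a b : K[X]} {m n N : ℕ} (ha : a.natDegree ≤ m) (hb : b.natDegree ≤ n)
    (h : m + n ≤ N) : (a * b).natDegree ≤ N := natDegree_mul_le.trans (by omega)

lemma natDegree_pow_le'' {a : K[X]} {m : ℕ} (k : ℕ) (ha : a.natDegree ≤ m) :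
    (a ^ k).natDegree ≤ k * m := natDegree_pow_le.trans (Nat.mul_le_mul_left k ha)

lemma lrP_deg (l : K × K × K) (f : MvPolynomial (Fin 3) K) (N : ℕ) (h : f.totalDegree ≤ N) :
    (lrP l f).natDegree ≤ 4 * N := by
  have a := lrAl_deg l f N h
  have b := lrBe_deg l f N h
  have a' := natDegree_der_le _ _ a
  have b' := natDegree_der_le _ _ b
  have A := lrA_deg l f N h
  have B := lrB_deg l f N h
  have C := lrC_deg l f N h
  unfold lrP
  have t1 : (2 * derivative (lrBe l f) * lrAl l f ^ 3).natDegree ≤ 4 * N :=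
    natDegree_mul_le'' (natDegree_two_mul_le _ _ b') (natDegree_pow_le'' 3 a) (by omega)
  have t2 : (lrBe l f * (lrA l f + 2 * derivative (lrAl l f)) * lrAl l f ^ 2).natDegree ≤ 4 * N :=
    natDegree_mul_le'' (natDegree_mul_le'' b (natDegree_add_le_of_degree_le A
      (natDegree_two_mul_le _ _ a')) le_rfl) (natDegree_pow_le'' 2 a) (by omega)
  have t3 : (2 * lrB l f * lrBe l f ^ 2 * lrAl l f).natDegree ≤ 4 * N :=
    natDegree_mul_le'' (natDegree_mul_le'' (natDegree_two_mul_le _ _ B)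
      (natDegree_pow_le'' 2 b) le_rfl) a (by omega)
  have t4 : (lrC l f * lrBe l f ^ 3).natDegree ≤ 4 * N :=
    natDegree_mul_le'' C (natDegree_pow_le'' 3 b) (by omega)
  have t12 := natDegree_sub_le_of_le t1 t2
  rw [max_self] at t12
  have t123 := natDegree_add_le_of_degree_le t12 t3
  have t := natDegree_sub_le_of_le t123 t4
  rwa [max_self] at t

lemma lrW_deg (l : K × K × K) (f : MvPolynomial (Fin 3) K) (N : ℕ) (h : f.totalDegree ≤ N) :
    (lrW l f).natDegree ≤ 3 * N := by
  have a := lrAl_deg l f N h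
  have b := lrBe_deg l f N h
  have a' := natDegree_der_le _ _ a
  have b' := natDegree_der_le _ _ b
  have a'' := natDegree_der_le _ _ a'
  have b'' := natDegree_der_le _ _ b'
  unfold lrW
  apply natDegree_add_le_of_degree_le
  · refine (natDegree_sub_le_of_le (m := 3 * N) (n := 3 * N) ?_ ?_).trans
      (le_of_eq (max_self (3 * N)))
    · exact natDegree_mul_le'' (natDegree_pow_le'' 2 b) a'' (by omega)
    · exact natDegree_mul_le'' (natDegree_mul_le'' a b le_rfl) b'' (by omega)
  · refine natDegree_mul_le'' (natDegree_two_mul_le _ _ b') (n := 2 * N) ?_ (by omega)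
    refine (natDegree_sub_le_of_le (m := 2 * N) (n := 2 * N) ?_ ?_).trans
      (le_of_eq (max_self (2 * N)))
    · exact natDegree_mul_le'' b' a (by omega)
    · exact natDegree_mul_le'' b a' (by omega)

lemma card_filter_prod_le {α β : Type*} (s : Finset α) (t : Finset β) (P : α → β → Prop)
    [∀ a b, Decidable (P a b)] (n : ℕ) (h : ∀ a ∈ s, (t.filter (P a)).card ≤ n) :
    ((s ×ˢ t).filter (fun q => P q.1 q.2)).card ≤ s.card * n := by
  rw [Finset.card_filter, Finset.sum_product]
  calc _ = ∑ a ∈ s, (t.filter (P a)).card := by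
        apply Finset.sum_congr rfl; intro a _; rw [Finset.card_filter]
    _ ≤ _ := by
        rw [← smul_eq_mul]; exact Finset.sum_le_card_nsmul _ _ _ h

lemma card_filter_prod_le' {α β : Type*} (s : Finset α) (t : Finset β) (P : α → β → Prop)
    [∀ a b, Decidable (P a b)] (n : ℕ) (h : ∀ b ∈ t, (s.filter (fun a => P a b)).card ≤ n) :
    ((s ×ˢ t).filter (fun q => P q.1 q.2)).card ≤ t.card * n := by
  rw [Finset.card_filter, Finset.sum_product_right]
  calc _ = ∑ b ∈ t, (s.filter (fun a => P a b)).card := by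
        apply Finset.sum_congr rfl; intro a _; rw [Finset.card_filter]
    _ ≤ _ := by
        rw [← smul_eq_mul]; exact Finset.sum_le_card_nsmul _ _ _ h

open Classical in
/-- bound for rich crossings at nonsingular points -/
lemma rich_count (p e k : ℕ) [CharP K p] (he : 1 ≤ e) (hp : 2 * e < p)
    (f : MvPolynomial (Fin 3) K) (hd : f.totalDegree ≤ e) (l : K × K × K) (hl : lrRs l f = 0)
    (L : Finset (K × K × K)) (hL : ∀ m ∈ L, lrRs m f = 0)
    (hskew : ∀ m ∈ L, ∀ m' ∈ L, lrOm m m' = 0 → m = m') (hdir : ∀ m ∈ L, l.1 ≠ m.1)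
    (hk : ∀ (l0 : K × K × K) (c κ r : K), (c ≠ 0 ∨ κ ≠ 0) →
      (L.filter (fun m => lrOm l0 m = 0 ∧ c * m.1 + κ * m.2.1 = r)).card ≤ k) :
    (L.filter (fun m => lrOm l m = 0 ∧ lrP m f = 0 ∧ (lrAl l f).eval (lrZ l m) ≠ 0)).card
      ≤ 3 * e + k := by
  set T := L.filter (fun m => lrOm l m = 0 ∧ lrP m f = 0 ∧ (lrAl l f).eval (lrZ l m) ≠ 0) with hT
  have hTm : ∀ m ∈ T, m ∈ L ∧ lrOm l m = 0 ∧ lrP m f = 0 ∧ (lrAl l f).eval (lrZ l m) ≠ 0 := by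
    intro m hm; simpa [hT] using hm
  by_cases hW : lrW l f = 0
  · by_cases hne : T = ∅
    · rw [hne]; simp
    obtain ⟨m0, hm0⟩ := Finset.nonempty_iff_ne_empty.mpr hne
    have hb0 : lrBe l f ≠ 0 := by
      obtain ⟨h1, h2, h3, h4⟩ := hTm m0 hm0
      have := (cross_basic hl (hL m0 h1) (hdir m0 h1) (lrPt_cross (hdir m0 h1) h2)).1
      intro h0
      rw [h0] at this
      simp only [eval_zero] at this
      have h5 : m0.1 - l.1 ≠ 0 := sub_ne_zero.mpr (hdir m0 h1).symm
      have h6 := mul_ne_zero (neg_ne_zero.mpr h5) h4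
      exact h6 this.symm
    obtain ⟨κ, c, hκ⟩ := affine_of_W p e he hp _ _ hb0 (lrAl_deg l f e hd) (lrBe_deg l f e hd) hW
    have hrel : ∀ m ∈ T, c * m.1 + (-κ) * m.2.1 = -1 + c * l.1 - κ * l.2.1 := by
      intro m hm
      obtain ⟨h1, h2, h3, h4⟩ := hTm m hm
      have h5 := (cross_basic hl (hL m h1) (hdir m h1) (lrPt_cross (hdir m h1) h2)).1
      have h6 := congrArg (Polynomial.eval (lrZ l m)) hκ
      simp only [eval_mul, eval_add, eval_C, eval_X] at h6
      rw [h5] at h6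
      have h7 := lrZ_mul (hdir m h1)
      apply mul_left_cancel₀ h4
      linear_combination h6 - (eval (lrZ l m) (lrAl l f)) * κ * h7
    have hnt : c ≠ 0 ∨ -κ ≠ 0 := by
      by_contra hcon
      push Not at hcon
      have := hrel m0 hm0
      have hκ0 : κ = 0 := by simpa using hcon.2
      rw [hcon.1, hκ0] at this
      simp at this
    refine le_trans (Finset.card_le_card ?_) ((hk l c (-κ) (-1 + c * l.1 - κ * l.2.1) hnt).trans
      (by omega))
    intro m hm
    obtain ⟨h1, h2, h3, h4⟩ := hTm m hm
    rw [Finset.mem_filter]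
    exact ⟨h1, h2, hrel m hm⟩
  · refine le_trans (count_roots l T (lrW l f) hW (3 * e) (lrW_deg l f e hd) ?_ ?_ ?_ ?_) (by omega)
    · intro m hm m' hm'
      exact hskew m (hTm m hm).1 m' (hTm m' hm').1
    · intro m hm; exact hdir m (hTm m hm).1
    · intro m hm; exact (hTm m hm).2.1
    · intro m hm
      obtain ⟨h1, h2, h3, h4⟩ := hTm m hm
      exact cross_W hl (hL m h1) (hdir m h1) (lrPt_cross (hdir m h1) h2) h3

open Classical in
lemma lr_main (p e k : ℕ) [CharP K p] (he : 1 ≤ e) (hp : 2 * e < p) (N : ℕ) :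
    N ≤ e → ∀ f : MvPolynomial (Fin 3) K, f ≠ 0 → f.totalDegree ≤ N →
    ∀ L1 L2 : Finset (K × K × K),
    (∀ l ∈ L1, lrRs l f = 0) → (∀ l ∈ L2, lrRs l f = 0) →
    (∀ m ∈ L1, ∀ m' ∈ L1, lrOm m m' = 0 → m = m') →
    (∀ m ∈ L2, ∀ m' ∈ L2, lrOm m m' = 0 → m = m') →
    (∀ l ∈ L1, ∀ m ∈ L2, l.1 ≠ m.1) →
    (∀ (l0 : K × K × K) (c κ r : K), (c ≠ 0 ∨ κ ≠ 0) →
      (L2.filter (fun m => lrOm l0 m = 0 ∧ c * m.1 + κ * m.2.1 = r)).card ≤ k) →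
    ((L1 ×ˢ L2).filter (fun q => lrOm q.1 q.2 = 0)).card ≤ (4 * e + k) * (L1.card + L2.card) := by
  induction N with
  | zero =>
    intro _ f hf hd L1 L2 h1 _ _ _ _ _
    have hfc : f.totalDegree = 0 := by omega
    rw [MvPolynomial.totalDegree_eq_zero_iff_eq_C] at hfc
    have : L1 = ∅ := by
      by_contra hne
      obtain ⟨l, hl⟩ := Finset.nonempty_iff_ne_empty.mpr hne
      have := h1 l hl
      rw [hfc] at this hf
      simp [lrRs] at this hf
      exact hf this
    simp [this]
  | succ N ih =>
    intro hNe f hf hd L1 L2 h1 h2 hs1 hs2 hdir hk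
    by_cases hconst : ∀ i, lrD i f = 0
    · obtain ⟨a, ha⟩ := lrD_exists p f (by omega) hconst
      have : L1 = ∅ := by
        by_contra hne
        obtain ⟨l, hl⟩ := Finset.nonempty_iff_ne_empty.mpr hne
        have := h1 l hl
        rw [ha] at this hf
        simp [lrRs] at this hf
        exact hf this
      simp [this]
    push Not at hconst
    obtain ⟨j, hj⟩ := hconst
    have hde : f.totalDegree ≤ e := by omega
    set S1 := L1.filter (fun l => ∀ i, lrRs l (lrD i f) = 0) with hS1
    set S2 := L2.filter (fun l => ∀ i, lrRs l (lrD i f) = 0) with hS2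
    set N1 := L1.filter (fun l => ¬ ∀ i, lrRs l (lrD i f) = 0) with hN1
    set N2 := L2.filter (fun l => ¬ ∀ i, lrRs l (lrD i f) = 0) with hN2
    have hc1 : S1.card + N1.card = L1.card := Finset.card_filter_add_card_filter_not _
    have hc2 : S2.card + N2.card = L2.card := Finset.card_filter_add_card_filter_not _
    have hIH := ih (by omega) (lrD j f) hj (lrD_degree j f N hd) S1 S2
      (fun l hl => (Finset.mem_filter.mp hl).2 j) (fun l hl => (Finset.mem_filter.mp hl).2 j)
      (fun m hm m' hm' => hs1 m (Finset.mem_filter.mp hm).1 m' (Finset.mem_filter.mp hm').1)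
      (fun m hm m' hm' => hs2 m (Finset.mem_filter.mp hm).1 m' (Finset.mem_filter.mp hm').1)
      (fun m hm m' hm' => hdir m (Finset.mem_filter.mp hm).1 m' (Finset.mem_filter.mp hm').1)
      (fun l0 c κ r h => (Finset.card_le_card
        (Finset.filter_subset_filter _ (Finset.filter_subset _ _))).trans (hk l0 c κ r h))
    -- crossings of `N1`
    have hE1 : ((N1 ×ˢ L2).filter (fun q => (fun l m => lrOm l m = 0 ∧
        (lrP l f ≠ 0 ∨ m ∈ S2 ∨ lrP m f = 0)) q.1 q.2)).card ≤ N1.card * (4 * e + k) := by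
      refine card_filter_prod_le N1 L2 (fun l m => lrOm l m = 0 ∧
        (lrP l f ≠ 0 ∨ m ∈ S2 ∨ lrP m f = 0)) (4 * e + k) ?_
      intro l hl
      obtain ⟨hl1, hl2⟩ := Finset.mem_filter.mp hl
      have hlf := h1 l hl1
      by_cases hP : lrP l f = 0
      · push Not at hl2
        obtain ⟨i, hi⟩ := hl2
        have hsub : L2.filter (fun m => lrOm l m = 0 ∧ (lrP l f ≠ 0 ∨ m ∈ S2 ∨ lrP m f = 0)) ⊆
            L2.filter (fun m => lrOm l m = 0 ∧ (lrRs l (lrD i f)).eval (lrZ l m) = 0) ∪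
            L2.filter (fun m => lrOm l m = 0 ∧ lrP m f = 0 ∧ (lrAl l f).eval (lrZ l m) ≠ 0) := by
          intro m hm
          obtain ⟨hm1, hm2, hm3⟩ := Finset.mem_filter.mp hm
          have hpt := lrPt_cross (hdir l hl1 m hm1) hm2
          rw [Finset.mem_union, Finset.mem_filter, Finset.mem_filter]
          rcases hm3 with h | h | h
          · exact absurd hP h
          · left
            refine ⟨hm1, hm2, ?_⟩
            have := (Finset.mem_filter.mp h).2 i
            rw [lrRs_eval, hpt, ← lrRs_eval, this, eval_zero]
          · by_cases h0 : (lrAl l f).eval (lrZ l m) = 0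
            · left
              exact ⟨hm1, hm2, (cross_basic hlf (h2 m hm1) (hdir l hl1 m hm1) hpt).2.1 h0 i⟩
            · right
              exact ⟨hm1, hm2, h, h0⟩
        refine (Finset.card_le_card hsub).trans ((Finset.card_union_le _ _).trans ?_)
        have hA : (L2.filter (fun m => lrOm l m = 0 ∧
            (lrRs l (lrD i f)).eval (lrZ l m) = 0)).card ≤ e := by
          apply count_roots l _ _ hi e (lrRs_natDegree _ _ _ (lrD_degree' _ _ _ hde))
          · intro m hm m' hm'
            exact hs2 m (Finset.mem_filter.mp hm).1 m' (Finset.mem_filter.mp hm').1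
          · intro m hm; exact hdir l hl1 m (Finset.mem_filter.mp hm).1
          · intro m hm; exact (Finset.mem_filter.mp hm).2.1
          · intro m hm; exact (Finset.mem_filter.mp hm).2.2
        have hB := rich_count p e k he hp f hde l hlf L2 h2 hs2 (hdir l hl1) hk
        omega
      · refine le_trans (count_roots l _ _ hP (4 * e) (lrP_deg l f e hde) ?_ ?_ ?_ ?_) (by omega)
        · intro m hm m' hm'
          exact hs2 m (Finset.mem_filter.mp hm).1 m' (Finset.mem_filter.mp hm').1
        · intro m hm; exact hdir l hl1 m (Finset.mem_filter.mp hm).1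
        · intro m hm; exact (Finset.mem_filter.mp hm).2.1
        · intro m hm
          obtain ⟨hm1, hm2, hm3⟩ := Finset.mem_filter.mp hm
          exact (cross_basic hlf (h2 m hm1) (hdir l hl1 m hm1)
            (lrPt_cross (hdir l hl1 m hm1) hm2)).2.2
    have hE2 : ((L1 ×ˢ N2).filter (fun q => (fun l m => lrOm l m = 0 ∧
        (lrP m f ≠ 0 ∨ l ∈ S1)) q.1 q.2)).card ≤ N2.card * (4 * e + k) := by
      refine card_filter_prod_le' L1 N2 (fun l m => lrOm l m = 0 ∧
        (lrP m f ≠ 0 ∨ l ∈ S1)) (4 * e + k) ?_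
      intro m hm
      obtain ⟨hm1, hm2⟩ := Finset.mem_filter.mp hm
      have hmf := h2 m hm1
      by_cases hP : lrP m f = 0
      · push Not at hm2
        obtain ⟨i, hi⟩ := hm2
        refine le_trans (count_roots m _ _ hi e
          (lrRs_natDegree _ _ _ (lrD_degree' _ _ _ hde)) ?_ ?_ ?_ ?_) (by omega)
        · intro l hl l' hl'
          exact hs1 l (Finset.mem_filter.mp hl).1 l' (Finset.mem_filter.mp hl').1
        · intro l hl; exact (hdir l (Finset.mem_filter.mp hl).1 m hm1).symm
        · intro l hl; exact lrOm_symm _ _ (Finset.mem_filter.mp hl).2.1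
        · intro l hl
          obtain ⟨hl1, hl2, hl3⟩ := Finset.mem_filter.mp hl
          rcases hl3 with h | h
          · exact absurd hP h
          · have := (Finset.mem_filter.mp h).2 i
            rw [lrRs_eval, lrPt_cross (hdir l hl1 m hm1).symm (lrOm_symm _ _ hl2), ← lrRs_eval,
              this, eval_zero]
      · refine le_trans (count_roots m _ _ hP (4 * e) (lrP_deg m f e hde) ?_ ?_ ?_ ?_) (by omega)
        · intro l hl l' hl'
          exact hs1 l (Finset.mem_filter.mp hl).1 l' (Finset.mem_filter.mp hl').1
        · intro l hl; exact (hdir l (Finset.mem_filter.mp hl).1 m hm1).symm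
        · intro l hl; exact lrOm_symm _ _ (Finset.mem_filter.mp hl).2.1
        · intro l hl
          obtain ⟨hl1, hl2, hl3⟩ := Finset.mem_filter.mp hl
          exact (cross_basic hmf (h1 l hl1) (hdir l hl1 m hm1).symm
            (lrPt_cross (hdir l hl1 m hm1).symm (lrOm_symm _ _ hl2))).2.2
    have hsub : (L1 ×ˢ L2).filter (fun q => lrOm q.1 q.2 = 0) ⊆
        ((S1 ×ˢ S2).filter (fun q => lrOm q.1 q.2 = 0) ∪
        ((N1 ×ˢ L2).filter (fun q => (fun l m => lrOm l m = 0 ∧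
        (lrP l f ≠ 0 ∨ m ∈ S2 ∨ lrP m f = 0)) q.1 q.2))) ∪
        ((L1 ×ˢ N2).filter (fun q => (fun l m => lrOm l m = 0 ∧
        (lrP m f ≠ 0 ∨ l ∈ S1)) q.1 q.2)) := by
      rintro ⟨l, m⟩ hq
      rw [Finset.mem_filter, Finset.mem_product] at hq
      obtain ⟨⟨hl, hm⟩, h0⟩ := hq
      by_cases hb : m ∈ S2
      · apply Finset.mem_union_left
        by_cases ha : l ∈ S1
        · exact Finset.mem_union_left _ (Finset.mem_filter.mpr ⟨Finset.mk_mem_product ha hb, h0⟩)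
        · have ha' : l ∈ N1 :=
            Finset.mem_filter.mpr ⟨hl, fun h => ha (Finset.mem_filter.mpr ⟨hl, h⟩)⟩
          exact Finset.mem_union_right _ (Finset.mem_filter.mpr
            ⟨Finset.mk_mem_product ha' hm, h0, Or.inr (Or.inl hb)⟩)
      · have hb' : m ∈ N2 :=
          Finset.mem_filter.mpr ⟨hm, fun h => hb (Finset.mem_filter.mpr ⟨hm, h⟩)⟩
        by_cases ha : l ∈ S1
        · exact Finset.mem_union_right _ (Finset.mem_filter.mpr
            ⟨Finset.mk_mem_product hl hb', h0, Or.inr ha⟩)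
        · have ha' : l ∈ N1 :=
            Finset.mem_filter.mpr ⟨hl, fun h => ha (Finset.mem_filter.mpr ⟨hl, h⟩)⟩
          by_cases hP : lrP m f = 0
          · exact Finset.mem_union_left _ (Finset.mem_union_right _ (Finset.mem_filter.mpr
              ⟨Finset.mk_mem_product ha' hm, h0, Or.inr (Or.inr hP)⟩))
          · exact Finset.mem_union_right _ (Finset.mem_filter.mpr
              ⟨Finset.mk_mem_product hl hb', h0, Or.inl hP⟩)
    refine (Finset.card_le_card hsub).trans ((Finset.card_union_le _ _).trans
      ((Nat.add_le_add_right (Finset.card_union_le _ _) _).trans ?_))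
    rw [← hc1, ← hc2]
    nlinarith [hIH, hE1, hE2]

end LMain
section LExist
open Polynomial
variable {K : Type*} [Field K]

/-- exponent vector -/
noncomputable def lrExp {s : ℕ} (v : Fin 3 → Fin s) : Fin 3 →₀ ℕ :=
  Finsupp.equivFunOnFinite.symm (fun i => (v i : ℕ))

lemma lrExp_inj {s : ℕ} : Function.Injective (lrExp (s := s)) := by
  intro v w h
  have := Finsupp.equivFunOnFinite.symm.injective h
  funext i
  exact Fin.ext (congrFun this i)

/-- polynomial with given coefficients -/
noncomputable def lrPoly (K : Type*) [Field K] (s : ℕ) :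
    ((Fin 3 → Fin s) → K) →ₗ[K] MvPolynomial (Fin 3) K :=
  ∑ v, (MvPolynomial.monomial (lrExp v)).comp (LinearMap.proj v)

lemma lrPoly_apply (s : ℕ) (c : (Fin 3 → Fin s) → K) :
    lrPoly K s c = ∑ v, MvPolynomial.monomial (lrExp v) (c v) := by
  simp [lrPoly]

lemma lrPoly_coeff (s : ℕ) (c : (Fin 3 → Fin s) → K) (v : Fin 3 → Fin s) :
    MvPolynomial.coeff (lrExp v) (lrPoly K s c) = c v := by
  classical
  rw [lrPoly_apply, MvPolynomial.coeff_sum]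
  simp only [MvPolynomial.coeff_monomial, lrExp_inj.eq_iff]
  simp

lemma lrPoly_deg (s : ℕ) (c : (Fin 3 → Fin s) → K) :
    (lrPoly K s c).totalDegree ≤ 3 * (s - 1) := by
  rw [lrPoly_apply]
  apply MvPolynomial.totalDegree_finsetSum_le
  intro v _
  refine (MvPolynomial.totalDegree_monomial_le _ _).trans ?_
  rw [Finsupp.sum_fintype _ _ (by simp), Fin.sum_univ_three]
  have h0 := (v 0).2
  have h1 := (v 1).2
  have h2 := (v 2).2
  simp only [lrExp, Finsupp.coe_equivFunOnFinite_symm, id]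
  omega

lemma lr_exists (s : ℕ) (L : Finset (K × K × K)) (h : 3 * L.card < s ^ 2) :
    ∃ f : MvPolynomial (Fin 3) K, f ≠ 0 ∧ f.totalDegree ≤ 3 * s ∧ ∀ l ∈ L, lrRs l f = 0 := by
  classical
  have hs : 0 < s := by
    rcases Nat.eq_zero_or_pos s with h0 | h0
    · rw [h0] at h; simp at h
    · exact h0
  let Φ : ((Fin 3 → Fin s) → K) →ₗ[K] (L × Fin (3 * s) → K) :=
    LinearMap.pi (fun q => (Polynomial.lcoeff K (q.2 : ℕ)).comp
      (((lrRs (q.1 : K × K × K)).toLinearMap).comp (lrPoly K s)))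
  have hlt : Module.finrank K (L × Fin (3 * s) → K) < Module.finrank K ((Fin 3 → Fin s) → K) := by
    simp only [Module.finrank_fintype_fun_eq_card, Fintype.card_prod, Fintype.card_fin,
      Fintype.card_coe, Fintype.card_fun]
    calc L.card * (3 * s) = (3 * L.card) * s := by ring
      _ < s ^ 2 * s := Nat.mul_lt_mul_of_pos_right h hs
      _ = s ^ 3 := by ring
  have hker := LinearMap.ker_ne_bot_of_finrank_lt (f := Φ) hlt
  obtain ⟨c, hc, hc0⟩ := Submodule.exists_mem_ne_zero_of_ne_bot hker
  refine ⟨lrPoly K s c, ?_, (lrPoly_deg s c).trans (by omega), ?_⟩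
  · intro h0
    apply hc0
    funext v
    rw [← lrPoly_coeff s c v, h0]; simp
  · intro l hl
    ext j
    by_cases hj : j < 3 * s
    · have := congrFun (LinearMap.mem_ker.mp hc) (⟨l, hl⟩, ⟨j, hj⟩)
      simpa [Φ] using this
    · rw [coeff_zero]
      apply coeff_eq_zero_of_natDegree_lt
      refine lt_of_le_of_lt (lrRs_natDegree l _ _ (lrPoly_deg s c)) (by omega)

open Classical in
lemma lr_incidence (p s k : ℕ) [CharP K p] (hp : 6 * s < p) 
    (L1 L2 : Finset (K × K × K)) (h : 3 * L1.card < s ^ 2)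
    (hs1 : ∀ m ∈ L1, ∀ m' ∈ L1, lrOm m m' = 0 → m = m')
    (hs2 : ∀ m ∈ L2, ∀ m' ∈ L2, lrOm m m' = 0 → m = m')
    (hdir : ∀ l ∈ L1, ∀ m ∈ L2, l.1 ≠ m.1)
    (hk : ∀ (l0 : K × K × K) (c κ r : K), (c ≠ 0 ∨ κ ≠ 0) →
      (L2.filter (fun m => lrOm l0 m = 0 ∧ c * m.1 + κ * m.2.1 = r)).card ≤ k) :
    ((L1 ×ˢ L2).filter (fun q => lrOm q.1 q.2 = 0)).card ≤
      (15 * s + k) * (L1.card + L2.card) := by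
  have hs : 0 < s := by
    rcases Nat.eq_zero_or_pos s with h0 | h0
    · rw [h0] at h; simp at h
    · exact h0
  obtain ⟨f, hf, hd, hv⟩ := lr_exists s L1 h
  set M := L2.filter (fun m => lrRs m f = 0) with hM
  set R := L2.filter (fun m => ¬ lrRs m f = 0) with hR
  have hc : M.card + R.card = L2.card := Finset.card_filter_add_card_filter_not _
  have hmain := lr_main p (3 * s) k (by omega) (by omega) (3 * s) le_rfl f hf hd L1 M hv
    (fun l hl => (Finset.mem_filter.mp hl).2) hs1
    (fun m hm m' hm' => hs2 m (Finset.mem_filter.mp hm).1 m' (Finset.mem_filter.mp hm').1)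
    (fun m hm m' hm' => hdir m hm m' (Finset.mem_filter.mp hm').1)
    (fun l0 c κ r h => (Finset.card_le_card
        (Finset.filter_subset_filter _ (Finset.filter_subset _ _))).trans (hk l0 c κ r h))
  have hrest : ((L1 ×ˢ R).filter (fun q => (fun l m => lrOm l m = 0) q.1 q.2)).card
      ≤ R.card * (3 * s) := by
    refine card_filter_prod_le' L1 R (fun l m => lrOm l m = 0) (3 * s) ?_
    intro m hm
    obtain ⟨hm1, hm2⟩ := Finset.mem_filter.mp hm
    apply count_roots m _ _ hm2 (3 * s) (lrRs_natDegree _ _ _ hd)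
    · intro l hl l' hl'
      exact hs1 l (Finset.mem_filter.mp hl).1 l' (Finset.mem_filter.mp hl').1
    · intro l hl; exact (hdir l (Finset.mem_filter.mp hl).1 m hm1).symm
    · intro l hl; exact lrOm_symm _ _ (Finset.mem_filter.mp hl).2
    · intro l hl
      obtain ⟨hl1, hl2⟩ := Finset.mem_filter.mp hl
      rw [lrRs_eval, lrPt_cross (hdir l hl1 m hm1).symm (lrOm_symm _ _ hl2), ← lrRs_eval,
        hv l hl1, eval_zero]
  have hsub : (L1 ×ˢ L2).filter (fun q => lrOm q.1 q.2 = 0) ⊆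
      (L1 ×ˢ M).filter (fun q => lrOm q.1 q.2 = 0) ∪
      (L1 ×ˢ R).filter (fun q => (fun l m => lrOm l m = 0) q.1 q.2) := by
    rintro ⟨l, m⟩ hq
    rw [Finset.mem_filter, Finset.mem_product] at hq
    obtain ⟨⟨hl, hm⟩, h0⟩ := hq
    by_cases hb : lrRs m f = 0
    · exact Finset.mem_union_left _ (Finset.mem_filter.mpr
        ⟨Finset.mk_mem_product hl (Finset.mem_filter.mpr ⟨hm, hb⟩), h0⟩)
    · exact Finset.mem_union_right _ (Finset.mem_filter.mpr
        ⟨Finset.mk_mem_product hl (Finset.mem_filter.mpr ⟨hm, hb⟩), h0⟩)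
  refine (Finset.card_le_card hsub).trans ((Finset.card_union_le _ _).trans ?_)
  rw [← hc]
  nlinarith [hmain, hrest, Nat.zero_le (s * L1.card), Nat.zero_le (s * R.card), Nat.zero_le (s * M.card), Nat.zero_le (k * R.card)]

end LExist
section LInst
variable {F K : Type*} [Field F] [Field K]

/-- first family -/
def lrOne (ι : F →+* K) (lam : K) (t : F × F × F) : K × K × K :=
  (lam * ι t.1, ι t.1 * ι t.2.1 + lam, - ι t.2.2)

/-- second family -/
noncomputable def lrTwo (ι : F →+* K) (lam : K) (t : F × F × F) : K × K × K :=
  (3 * ι t.1, - (3 * ι t.1 * ι (2 * t.2.1 - t.1)) / lam, - ι t.2.2 - 3 * lam * ι t.1)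

variable (ι : F →+* K) (lam : K)

lemma lam_ne
    (hind : ∀ a b c : F, ι a + ι b * lam + ι c * lam ^ 2 = 0 → a = 0 ∧ b = 0 ∧ c = 0)
    : lam ≠ 0 := by
  intro h
  have := (hind 0 1 0 (by simp [h])).2.1
  exact one_ne_zero this

lemma lrOne_skew
    (hind : ∀ a b c : F, ι a + ι b * lam + ι c * lam ^ 2 = 0 → a = 0 ∧ b = 0 ∧ c = 0)
    (t t' : F × F × F) (h : t.1 ≠ 0) (h' : t'.1 ≠ 0)
    (h0 : lrOm (lrOne ι lam t) (lrOne ι lam t') = 0) : t = t' := by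
  obtain ⟨d, s, x⟩ := t
  obtain ⟨d', s', x'⟩ := t'
  simp only [lrOm, lrOne] at *
  obtain ⟨e1, e2, e3⟩ := hind (x - x') (d * d' * (s - s')) (d' - d) (by
    simp only [map_sub, map_mul]; linear_combination h0)
  have := mul_ne_zero h h'
  have e2' := (mul_eq_zero.mp e2).resolve_left this
  rw [Prod.mk.injEq, Prod.mk.injEq]
  exact ⟨(sub_eq_zero.mp e3).symm, sub_eq_zero.mp e2', sub_eq_zero.mp e1⟩

lemma lrTwo_skew
    (hind : ∀ a b c : F, ι a + ι b * lam + ι c * lam ^ 2 = 0 → a = 0 ∧ b = 0 ∧ c = 0)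
    (h2 : (2 : F) ≠ 0) (h3 : (3 : F) ≠ 0) (t t' : F × F × F) (h : t.1 ≠ 0)
    (h' : t'.1 ≠ 0) (h0 : lrOm (lrTwo ι lam t) (lrTwo ι lam t') = 0) : t = t' := by
  have hl := lam_ne ι lam hind
  obtain ⟨b, c, x⟩ := t
  obtain ⟨b', c', x'⟩ := t'
  simp only [lrOm, lrTwo] at *
  have h4 : ι (9 * b * b' * ((2 * c' - b') - (2 * c - b))) + ι (x - x') * lam
      + ι (3 * (b - b')) * lam ^ 2 = 0 := by
    field_simp at h0
    simp only [map_sub, map_mul, map_ofNat] at h0 ⊢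
    linear_combination h0
  obtain ⟨e1, e2, e3⟩ := hind _ _ _ h4
  have hb : b = b' := sub_eq_zero.mp ((mul_eq_zero.mp e3).resolve_left h3)
  have h9 : (9 : F) ≠ 0 := by
    have : (9 : F) = 3 * 3 := by norm_num
    rw [this]; exact mul_ne_zero h3 h3
  have e1' := (mul_eq_zero.mp e1).resolve_left (mul_ne_zero (mul_ne_zero h9 h) h')
  have hc : c = c' := by
    have : 2 * (c' - c) = 0 := by rw [hb] at e1'; linear_combination e1'
    exact (sub_eq_zero.mp ((mul_eq_zero.mp this).resolve_left h2)).symm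
  rw [Prod.mk.injEq, Prod.mk.injEq]
  exact ⟨hb, hc, sub_eq_zero.mp e2⟩

lemma lr_cross_iff
    (hind : ∀ a b c : F, ι a + ι b * lam + ι c * lam ^ 2 = 0 → a = 0 ∧ b = 0 ∧ c = 0)
    (t t' : F × F × F) :
    lrOm (lrOne ι lam t) (lrTwo ι lam t') = 0 ↔
      3 * t'.1 * t.1 * ((2 * t'.2.1 - t'.1) + t.2.1) = t'.2.2 - t.2.2 := by
  have hl := lam_ne ι lam hind
  rw [← ι.injective.eq_iff]
  simp only [lrOm, lrOne, lrTwo]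
  have : - (3 * ι t'.1 * ι (2 * t'.2.1 - t'.1)) / lam * (lam * ι t.1) =
    - (3 * ι t'.1 * ι (2 * t'.2.1 - t'.1)) * ι t.1 := by field_simp
  rw [this]
  simp only [map_sub, map_mul, map_add, map_ofNat]
  constructor
  · intro h; linear_combination h
  · intro h; linear_combination h

lemma lr_dir_ne
    (hind : ∀ a b c : F, ι a + ι b * lam + ι c * lam ^ 2 = 0 → a = 0 ∧ b = 0 ∧ c = 0)
    (t t' : F × F × F) (h : t.1 ≠ 0) :
    (lrOne ι lam t).1 ≠ (lrTwo ι lam t').1 := by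
  intro h0
  simp only [lrOne, lrTwo] at h0
  have := (hind (-3 * t'.1) t.1 0 (by
    simp only [map_mul, map_neg, map_ofNat, map_zero]; linear_combination h0)).2.1
  exact h this

open Classical in
lemma lrTwo_k
    (hind : ∀ a b c : F, ι a + ι b * lam + ι c * lam ^ 2 = 0 → a = 0 ∧ b = 0 ∧ c = 0)
    (h2 : (2 : F) ≠ 0) (h3 : (3 : F) ≠ 0) (A X : Finset F) (l0 : K × K × K)
    (c κ r : K) (hcκ : c ≠ 0 ∨ κ ≠ 0) :
    ((((A.erase 0) ×ˢ (A ×ˢ X)).image (lrTwo ι lam)).filter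
      (fun m => lrOm l0 m = 0 ∧ c * m.1 + κ * m.2.1 = r)).card ≤ A.card := by
  have hl := lam_ne ι lam hind
  rw [Finset.filter_image]
  refine Finset.card_image_le.trans ?_
  have h3K : (3 : K) ≠ 0 := by
    have := (map_ne_zero ι).mpr h3
    rwa [map_ofNat] at this
  have hw : ∀ t t' : F × F × F, t.1 = t'.1 → t.2.1 = t'.2.1 → lrOm l0 (lrTwo ι lam t) = 0 →
      lrOm l0 (lrTwo ι lam t') = 0 → t = t' := by
    rintro ⟨b, e, x⟩ ⟨b', e', x'⟩ hb he h1 h2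
    simp only at hb he
    subst hb he
    simp only [lrOm, lrTwo] at h1 h2
    have : ι x = ι x' := by linear_combination h2 - h1
    rw [ι.injective this]
  by_cases hκ : κ = 0
  · have hc : c ≠ 0 := by tauto
    apply Finset.card_le_card_of_injOn (fun t => t.2.1)
    · intro t ht
      simp only [Finset.coe_filter, Finset.mem_product, Set.mem_ofPred_eq] at ht
      exact ht.1.2.1
    · intro t ht t' ht' h
      simp only [Finset.coe_filter, Finset.mem_product, Set.mem_ofPred_eq] at ht ht'
      apply hw t t' _ h ht.2.1 ht'.2.1
      have e1 := ht.2.2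
      have e2 := ht'.2.2
      rw [hκ] at e1 e2
      simp only [lrTwo] at e1 e2
      apply ι.injective
      apply mul_left_cancel₀ (mul_ne_zero hc h3K)
      linear_combination e1 - e2
  · apply Finset.card_le_card_of_injOn (fun t => t.1)
    · intro t ht
      simp only [Finset.coe_filter, Finset.mem_product, Set.mem_ofPred_eq] at ht
      exact Finset.mem_of_mem_erase ht.1.1
    · intro t ht t' ht' h
      simp only [Finset.coe_filter, Finset.mem_product, Set.mem_ofPred_eq] at ht ht'
      apply hw t t' h _ ht.2.1 ht'.2.1
      have e1 := ht.2.2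
      have e2 := ht'.2.2
      have hb := Finset.ne_of_mem_erase ht.1.1
      simp only at h
      simp only [lrTwo] at e1 e2
      rw [← h] at e2
      have e3 : κ * (- (3 * ι t.1 * ι (2 * t.2.1 - t.1)) / lam) =
        κ * (- (3 * ι t.1 * ι (2 * t'.2.1 - t.1)) / lam) := by linear_combination e1 - e2
      have e4 := mul_left_cancel₀ hκ e3
      rw [div_left_inj' hl] at e4
      have e5 := mul_left_cancel₀ (mul_ne_zero h3K ((map_ne_zero ι).mpr hb)) (neg_injective e4)
      have e6 := ι.injective e5
      apply mul_left_cancel₀ h2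
      linear_combination e6

end LInst

section LField
open Polynomial

lemma exists_field (p : ℕ) [Fact p.Prime] : ∃ (K : Type) (_ : Field K) (_ : CharP K p)
    (ι : ZMod p →+* K) (lam : K),
    ∀ a b c : ZMod p, ι a + ι b * lam + ι c * lam ^ 2 = 0 → a = 0 ∧ b = 0 ∧ c = 0 := by
  let j := algebraMap (ZMod p)[X] (FractionRing (ZMod p)[X])
  have hj : Function.Injective j := IsFractionRing.injective _ _
  refine ⟨FractionRing (ZMod p)[X], inferInstance, ?_, j.comp C, j X, ?_⟩
  · exact charP_of_injective_ringHom (f := j.comp C) (RingHom.injective _) p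
  · intro a b c h
    have : C a + C b * X + C c * X ^ 2 = (0 : (ZMod p)[X]) := by
      apply hj
      simpa using h
    refine ⟨?_, ?_, ?_⟩
    · simpa using congrArg (fun q => q.coeff 0) this
    · simpa [coeff_X, coeff_C, coeff_X_pow] using congrArg (fun q => q.coeff 1) this
    · simpa [coeff_X, coeff_C] using congrArg (fun q => q.coeff 2) this

/-- incidence bound over the prime field -/
lemma field_incidence (p : ℕ) [Fact p.Prime] (hp3 : 3 < p) (s : ℕ) (hs : 6 * s < p)
    (A X : Finset (ZMod p)) (T : Finset (ZMod p × ZMod p × ZMod p)) (hT : ∀ t ∈ T, t.1 ≠ 0)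
    (hTs : 3 * T.card < s ^ 2) :
    ((T ×ˢ ((A.erase 0) ×ˢ (A ×ˢ X))).filter (fun q =>
      3 * q.2.1 * q.1.1 * ((2 * q.2.2.1 - q.2.1) + q.1.2.1) = q.2.2.2 - q.1.2.2)).card ≤
      (15 * s + A.card) * (T.card + A.card * (A.card * X.card)) := by
  classical
  obtain ⟨K, _, _, ι, lam, hind⟩ := exists_field p
  have h2 : (2 : ZMod p) ≠ 0 := by
    intro h
    have : ((2 : ℕ) : ZMod p) = 0 := by exact_mod_cast h
    rw [ZMod.natCast_eq_zero_iff] at this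
    have := Nat.le_of_dvd (by omega) this
    omega
  have h3 : (3 : ZMod p) ≠ 0 := by
    intro h
    have : ((3 : ℕ) : ZMod p) = 0 := by exact_mod_cast h
    rw [ZMod.natCast_eq_zero_iff] at this
    have := Nat.le_of_dvd (by omega) this
    omega
  set U := (A.erase 0) ×ˢ (A ×ˢ X) with hU
  have hU0 : ∀ t ∈ U, t.1 ≠ 0 := by
    intro t ht
    exact Finset.ne_of_mem_erase (Finset.mem_product.mp ht).1
  have hom : ∀ l : K × K × K, lrOm l l = 0 := by intro l; unfold lrOm; ring
  have hc1 : (T.image (lrOne ι lam)).card = T.card := by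
    apply Finset.card_image_of_injOn
    intro t ht t' ht' h
    apply lrOne_skew ι lam hind t t' (hT t ht) (hT t' ht')
    rw [h]; exact hom _
  have hc2 : (U.image (lrTwo ι lam)).card ≤ A.card * (A.card * X.card) := by
    refine Finset.card_image_le.trans ?_
    rw [hU, Finset.card_product, Finset.card_product]
    exact Nat.mul_le_mul_right _ (Finset.card_le_card (Finset.erase_subset _ _))
  have hinc := lr_incidence p s A.card hs (T.image (lrOne ι lam)) (U.image (lrTwo ι lam))
    (by rw [hc1]; exact hTs)
    (by
      intro m hm m' hm' h
      obtain ⟨t, ht, rfl⟩ := Finset.mem_image.mp hm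
      obtain ⟨t', ht', rfl⟩ := Finset.mem_image.mp hm'
      rw [lrOne_skew ι lam hind t t' (hT t ht) (hT t' ht') h])
    (by
      intro m hm m' hm' h
      obtain ⟨t, ht, rfl⟩ := Finset.mem_image.mp hm
      obtain ⟨t', ht', rfl⟩ := Finset.mem_image.mp hm'
      rw [lrTwo_skew ι lam hind h2 h3 t t' (hU0 t ht) (hU0 t' ht') h])
    (by
      intro m hm m' hm'
      obtain ⟨t, ht, rfl⟩ := Finset.mem_image.mp hm
      obtain ⟨t', ht', rfl⟩ := Finset.mem_image.mp hm'
      exact lr_dir_ne ι lam hind t t' (hT t ht))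
    (fun l0 c κ r h => by convert lrTwo_k ι lam hind h2 h3 A X l0 c κ r h)
  rw [hc1] at hinc
  refine le_trans ?_ (hinc.trans (Nat.mul_le_mul_left _ (Nat.add_le_add_left hc2 _)))
  apply Finset.card_le_card_of_injOn (fun q => (lrOne ι lam q.1, lrTwo ι lam q.2))
  · rintro ⟨t, u⟩ hq
    simp only [Finset.coe_filter, Finset.mem_product, Set.mem_ofPred_eq] at hq ⊢
    refine ⟨⟨Finset.mem_image_of_mem _ hq.1.1, Finset.mem_image_of_mem _ ?_⟩, ?_⟩
    · exact hq.1.2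
    · exact (lr_cross_iff ι lam hind t u).mpr hq.2
  · rintro ⟨t, u⟩ hq ⟨t', u'⟩ hq' h
    have hq1 := Finset.mem_product.mp (Finset.mem_filter.mp (Finset.mem_coe.mp hq)).1
    have hq1' := Finset.mem_product.mp (Finset.mem_filter.mp (Finset.mem_coe.mp hq')).1
    simp only [Prod.mk.injEq] at h
    rw [Prod.mk.injEq]
    constructor
    · apply lrOne_skew ι lam hind t t' (hT t hq1.1) (hT t' hq1'.1)
      rw [h.1]; exact hom _
    · apply lrTwo_skew ι lam hind h2 h3 u u' (hU0 u hq1.2) (hU0 u' hq1'.2)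
      rw [h.2]; exact hom _

end LField
section LEnergy

lemma cs_fiber {α β : Type*} [DecidableEq β] (T : Finset α) (B : Finset β) (φ : α → β)
    (h : ∀ t ∈ T, φ t ∈ B) :
    T.card ^ 2 ≤ B.card * ((T ×ˢ T).filter (fun q => φ q.1 = φ q.2)).card := by
  classical
  have h1 : T.card = ∑ y ∈ B, (T.filter (fun t => φ t = y)).card :=
    Finset.card_eq_sum_card_fiberwise h
  have h2 : ((T ×ˢ T).filter (fun q => φ q.1 = φ q.2)).card
      = ∑ y ∈ B, (T.filter (fun t => φ t = y)).card ^ 2 := by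
    rw [Finset.card_eq_sum_card_fiberwise (f := fun q => φ q.1) (t := B)]
    · apply Finset.sum_congr rfl
      intro y _
      rw [sq, ← Finset.card_product]
      congr 1
      ext ⟨a, b⟩
      simp only [Finset.mem_filter, Finset.mem_product]
      constructor
      · rintro ⟨⟨⟨ha, hb⟩, hab⟩, hy⟩
        exact ⟨⟨ha, hy⟩, hb, hab ▸ hy⟩
      · rintro ⟨⟨ha, hy⟩, hb, hy'⟩
        exact ⟨⟨⟨ha, hb⟩, hy.trans hy'.symm⟩, hy⟩
    · intro q hq
      have := Finset.mem_product.mp (Finset.mem_filter.mp (Finset.mem_coe.mp hq)).1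
      exact h _ this.1
  rw [h2]
  conv_lhs => rw [h1]
  exact sq_sum_le_card_mul_sum_sq

/-- the image set -/
def lrS {p : ℕ} (A X : Finset (ZMod p)) : Finset (ZMod p) :=
  ((A ×ˢ A) ×ˢ X).image (fun q => (q.1.2 - q.1.1) ^ 3 + q.1.1 ^ 3 + q.2)

lemma energy_nat (p : ℕ) [Fact p.Prime] (hp3 : 3 < p) (s : ℕ) (hs : 6 * s < p)
    (A X : Finset (ZMod p)) (hms : 3 * ((A - A).card ^ 2 * X.card) < s ^ 2) :
    A.card * ((A.erase 0).card * (A.card * X.card)) ^ 2 ≤ A.card * (lrS A X).card *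
      (A.card * (A.card * (A.card * X.card)) +
        (15 * s + A.card) * ((A - A).card ^ 2 * X.card + A.card * (A.card * X.card))) := by
  classical
  have h2 : (2 : ZMod p) ≠ 0 := by
    intro h
    have : ((2 : ℕ) : ZMod p) = 0 := by exact_mod_cast h
    rw [ZMod.natCast_eq_zero_iff] at this
    have := Nat.le_of_dvd (by omega) this
    omega
  set U := (A.erase 0) ×ˢ (A ×ˢ X) with hU
  have hUc : U.card = (A.erase 0).card * (A.card * X.card) := by
    rw [hU, Finset.card_product, Finset.card_product]
  have hUle : U.card ≤ A.card * (A.card * X.card) := by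
    rw [hUc]; exact Nat.mul_le_mul_right _ (Finset.card_le_card (Finset.erase_subset _ _))
  let φ : ZMod p × ZMod p × ZMod p → ZMod p × ZMod p :=
    fun t => (t.1, (t.1 - t.2.1) ^ 3 + t.2.1 ^ 3 + t.2.2)
  have hcs := cs_fiber U (A ×ˢ lrS A X) φ (by
    rintro ⟨b, a, x⟩ ht
    simp only [hU, Finset.mem_product, Finset.mem_erase] at ht
    rw [Finset.mem_product]
    refine ⟨ht.1.2, ?_⟩
    unfold lrS
    rw [Finset.mem_image]
    exact ⟨((a, b), x), by simp [ht.1.2, ht.2.1, ht.2.2], rfl⟩)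
  rw [hUc, Finset.card_product A (lrS A X)] at hcs
  set E := (U ×ˢ U).filter (fun q => φ q.1 = φ q.2) with hE
  set Eo := E.filter (fun q => ¬ q.1.2.1 = q.2.2.1) with hEo
  have hEsplit : (E.filter (fun q => q.1.2.1 = q.2.2.1)).card + Eo.card = E.card :=
    Finset.card_filter_add_card_filter_not _
  have hdiag : (E.filter (fun q => q.1.2.1 = q.2.2.1)).card ≤ U.card := by
    apply Finset.card_le_card_of_injOn (fun q => q.1)
    · intro q hq
      exact (Finset.mem_product.mp (Finset.mem_filter.mp (Finset.mem_filter.mp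
        (Finset.mem_coe.mp hq)).1).1).1
    · rintro ⟨⟨b, a, x⟩, ⟨b1, a1, x1⟩⟩ hq ⟨⟨b', a', x'⟩, ⟨b1', a1', x1'⟩⟩ hq' h
      have e1 := (Finset.mem_filter.mp (Finset.mem_coe.mp hq)).2
      have e2 := (Finset.mem_filter.mp (Finset.mem_filter.mp (Finset.mem_coe.mp hq)).1).2
      have e1' := (Finset.mem_filter.mp (Finset.mem_coe.mp hq')).2
      have e2' := (Finset.mem_filter.mp (Finset.mem_filter.mp (Finset.mem_coe.mp hq')).1).2
      simp only [φ, Prod.mk.injEq] at e1 e2 e1' e2' h ⊢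
      obtain ⟨rfl, rfl, rfl⟩ := h
      obtain ⟨rfl, e2⟩ := e2
      obtain ⟨rfl, e2'⟩ := e2'
      subst e1
      subst e1'
      refine ⟨⟨rfl, rfl, rfl⟩, rfl, rfl, ?_⟩
      linear_combination e2' - e2
  set T := ((((A - A) ×ˢ (A - A)) ×ˢ X).image
    (fun q => (q.1.1 - q.1.2, q.1.1 + q.1.2, q.2))).filter (fun t => t.1 ≠ 0) with hT
  have hTc : T.card ≤ (A - A).card ^ 2 * X.card := by
    refine (Finset.card_filter_le _ _).trans (Finset.card_image_le.trans ?_)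
    rw [Finset.card_product, Finset.card_product, sq]
  have hinc := field_incidence p hp3 s hs A X T (fun t ht => (Finset.mem_filter.mp ht).2)
    (by omega)
  have hoff : A.card * Eo.card ≤ (15 * s + A.card) * (T.card + A.card * (A.card * X.card)) := by
    refine le_trans ?_ hinc
    rw [← Finset.card_product]
    apply Finset.card_le_card_of_injOn (fun q => ((q.2.1.2.1 - q.2.2.2.1,
      q.2.1.2.1 + q.2.2.2.1 - 2 * q.1, q.2.1.2.2), (q.2.1.1, q.1, q.2.2.2.2)))
    · rintro ⟨c, ⟨b, a, x⟩, ⟨b', a', x'⟩⟩ hq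
      obtain ⟨hc, hq⟩ := Finset.mem_product.mp (Finset.mem_coe.mp hq)
      obtain ⟨hq, hne⟩ := Finset.mem_filter.mp hq
      obtain ⟨hq, heq⟩ := Finset.mem_filter.mp hq
      simp only [hU, Finset.mem_product] at hq
      obtain ⟨⟨hb, ha, hx⟩, ⟨hb', ha', hx'⟩⟩ := hq
      simp only [φ, Prod.mk.injEq] at heq hne hc
      obtain ⟨rfl, heq⟩ := heq
      rw [Finset.mem_coe, Finset.mem_filter, Finset.mem_product]
      refine ⟨⟨?_, ?_⟩, ?_⟩
      · rw [hT, Finset.mem_filter, Finset.mem_image]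
        refine ⟨⟨((a - c, a' - c), x), ?_, ?_⟩, ?_⟩
        · simp only [Finset.mem_product]
          exact ⟨⟨Finset.sub_mem_sub ha hc, Finset.sub_mem_sub ha' hc⟩, hx⟩
        · simp only [Prod.mk.injEq]
          exact ⟨by ring, by ring, trivial⟩
        · exact sub_ne_zero.mpr hne
      · simp only [Finset.mem_product]
        exact ⟨hb, hc, hx'⟩
      · simp only
        linear_combination heq
    · rintro ⟨c, ⟨b, a, x⟩, ⟨b1, a1, x1⟩⟩ hq ⟨c', ⟨b', a', x'⟩, ⟨b1', a1', x1'⟩⟩ hq' h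
      have e2 := (Finset.mem_filter.mp (Finset.mem_filter.mp (Finset.mem_product.mp
        (Finset.mem_coe.mp hq)).2).1).2
      have e2' := (Finset.mem_filter.mp (Finset.mem_filter.mp (Finset.mem_product.mp
        (Finset.mem_coe.mp hq')).2).1).2
      simp only [φ, Prod.mk.injEq] at e2 e2' h ⊢
      obtain ⟨⟨h1, h3, rfl⟩, rfl, rfl, rfl⟩ := h
      obtain ⟨rfl, -⟩ := e2
      obtain ⟨rfl, -⟩ := e2'
      have ha : a = a' := by
        apply mul_left_cancel₀ h2
        linear_combination h1 + h3
      subst ha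
      have ha1 : a1 = a1' := by linear_combination -h1
      subst ha1
      simp
  have hfin : A.card * E.card ≤ A.card * (A.card * (A.card * X.card)) +
        (15 * s + A.card) * ((A - A).card ^ 2 * X.card + A.card * (A.card * X.card)) := by
    rw [← hEsplit, Nat.mul_add]
    refine Nat.add_le_add (Nat.mul_le_mul_left _ (hdiag.trans hUle)) (hoff.trans ?_)
    exact Nat.mul_le_mul_left _ (Nat.add_le_add_right hTc _)
  calc A.card * ((A.erase 0).card * (A.card * X.card)) ^ 2
      ≤ A.card * (A.card * (lrS A X).card * E.card) := Nat.mul_le_mul_left _ hcs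
    _ = A.card * (lrS A X).card * (A.card * E.card) := by ring
    _ ≤ _ := Nat.mul_le_mul_left _ hfin

end LEnergy

lemma card_le_sub {p : ℕ} (A : Finset (ZMod p)) : A.card ≤ (A - A).card := by
  rcases A.eq_empty_or_nonempty with rfl | ⟨a, ha⟩
  · simp
  · apply Finset.card_le_card_of_injOn (fun b => b - a)
    · intro b hb
      exact Finset.sub_mem_sub hb ha
    · intro b _ c _ h
      simpa using h

lemma real_arith (n e D M S s : ℝ) (hn : 2 ≤ n) (he : n / 2 ≤ e) (hnD : n ≤ D) (hM : 1 ≤ M)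
    (hS : 0 ≤ S) (_hs0 : 0 ≤ s) (hs : s ^ 2 ≤ 12 * (D ^ 2 * M))
    (h : n * (e * (n * M)) ^ 2 ≤ n * S * (n * (n * (n * M)) +
      (15 * s + n) * (D ^ 2 * M + n * (n * M)))) :
    n ^ 4 * √M ≤ 492 * (D ^ 3 * S) := by
  set r := √M with hr
  have hrM : M = r ^ 2 := (Real.sq_sqrt (by linarith)).symm
  have hr1 : 1 ≤ r := Real.one_le_sqrt.mpr hM
  rw [hrM] at h hs
  have hD : 2 ≤ D := hn.trans hnD
  have hDr : D ≤ D * r := le_mul_of_one_le_right (by linarith) hr1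
  have hs4 : s ≤ 4 * (D * r) := by
    apply le_of_sq_le_sq _ (by positivity)
    calc s ^ 2 ≤ _ := hs
      _ ≤ (4 * (D * r)) ^ 2 := by
        have : 0 ≤ (D * r) ^ 2 := sq_nonneg _
        nlinarith
  have h1 : 15 * s + n ≤ 61 * (D * r) := by linarith
  have h2 : n * (n * r ^ 2) ≤ D ^ 2 * r ^ 2 := by
    calc n * (n * r ^ 2) ≤ D * (D * r ^ 2) := by gcongr
      _ = _ := by ring
  have h3 : n * (n * (n * r ^ 2)) ≤ D ^ 3 * r ^ 3 := by
    calc n * (n * (n * r ^ 2)) ≤ D * (D ^ 2 * r ^ 2) := by gcongr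
      _ = D ^ 3 * r ^ 2 * 1 := by ring
      _ ≤ D ^ 3 * r ^ 2 * r := by gcongr
      _ = _ := by ring
  have h4 : n * (n * (n * r ^ 2)) + (15 * s + n) * (D ^ 2 * r ^ 2 + n * (n * r ^ 2))
      ≤ 123 * (D ^ 3 * r ^ 3) := by
    calc _ ≤ D ^ 3 * r ^ 3 + 61 * (D * r) * (D ^ 2 * r ^ 2 + D ^ 2 * r ^ 2) := by gcongr
      _ = _ := by ring
  have h5 : n * (n / 2 * (n * r ^ 2)) ^ 2 ≤ n * S * (123 * (D ^ 3 * r ^ 3)) := by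
    calc _ ≤ n * (e * (n * r ^ 2)) ^ 2 := by gcongr
      _ ≤ _ := h
      _ ≤ _ := by gcongr
  have h6 : (n * r ^ 3 / 4) * (n ^ 4 * r) ≤ (n * r ^ 3 / 4) * (492 * (D ^ 3 * S)) := by
    calc _ = n * (n / 2 * (n * r ^ 2)) ^ 2 := by ring
      _ ≤ _ := h5
      _ = _ := by ring
  exact le_of_mul_le_mul_left h6 (by positivity)

lemma main_real (p : ℕ) [Fact p.Prime] (hp3 : 3 < p) (A X : Finset (ZMod p))
    (hn : 2 ≤ A.card) (hM : 1 ≤ X.card) (hp : 432 * ((A - A).card ^ 2 * X.card) < p ^ 2) :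
    (A.card : ℝ) ^ 4 * √(X.card : ℝ) ≤ 492 * (((A - A).card : ℝ) ^ 3 * ((lrS A X).card : ℝ)) := by
  have hnD := card_le_sub A
  set m := (A - A).card ^ 2 * X.card with hm
  have hm1 : 1 ≤ m := by
    have : 0 < (A - A).card := by omega
    have : 0 < m := by positivity
    omega
  have hq1 : 1 ≤ Nat.sqrt (3 * m) := Nat.le_sqrt.mpr (by omega)
  have hq2 := Nat.sqrt_le' (3 * m)
  have hq3 := Nat.lt_succ_sqrt' (3 * m)
  set q := Nat.sqrt (3 * m)
  have hs12 : (q + 1) ^ 2 ≤ 12 * m := by nlinarith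
  have h6 : 6 * (q + 1) < p := by
    apply lt_of_pow_lt_pow_left₀ 2 (Nat.zero_le _)
    calc (6 * (q + 1)) ^ 2 = 36 * (q + 1) ^ 2 := by ring
      _ ≤ 36 * (12 * m) := by gcongr
      _ < _ := by omega
  have hE := energy_nat p hp3 (q + 1) h6 A X hq3
  have he : A.card - 1 ≤ (A.erase 0).card := Finset.pred_card_le_card_erase
  have he2 : A.card ≤ 2 * (A.erase 0).card := by omega
  apply real_arith (A.card : ℝ) ((A.erase 0).card : ℝ) _ _ _ ((q + 1 : ℕ) : ℝ)
  · exact_mod_cast hn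
  · have : (A.card : ℝ) ≤ 2 * ((A.erase 0).card : ℝ) := by exact_mod_cast he2
    linarith
  · exact_mod_cast hnD
  · exact_mod_cast hM
  · positivity
  · positivity
  · exact_mod_cast hs12
  · exact_mod_cast hE

lemma card_lrS_ge_X {p : ℕ} (A X : Finset (ZMod p)) (hA : A.Nonempty) :
    X.card ≤ (lrS A X).card := by
  obtain ⟨a, ha⟩ := hA
  apply Finset.card_le_card_of_injOn (fun x => (a - a) ^ 3 + a ^ 3 + x)
  · intro x hx
    exact Finset.mem_image.mpr ⟨((a, a), x), by simpa [ha] using hx, rfl⟩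
  · intro b _ c _ h
    simpa using h

lemma card_lrS_ge_A (p : ℕ) [Fact p.Prime] (A X : Finset (ZMod p)) (hX : X.Nonempty) :
    A.card ≤ 3 * (lrS A X).card := by
  classical
  rcases A.eq_empty_or_nonempty with rfl | ⟨a, ha⟩
  · simp
  obtain ⟨x, hx⟩ := hX
  apply Finset.card_le_mul_card_image_of_maps_to (f := fun b => (b - a) ^ 3 + a ^ 3 + x)
  · intro b hb
    exact Finset.mem_image.mpr ⟨((a, b), x), by simp [ha, hb, hx], rfl⟩
  · intro y _
    refine le_trans ?_ (Polynomial.card_nthRoots 3 (y - a ^ 3 - x))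
    refine le_trans ?_ (Multiset.toFinset_card_le _)
    apply Finset.card_le_card_of_injOn (fun b => b - a)
    · intro b hb
      have hb2 := (Finset.mem_filter.mp (Finset.mem_coe.mp hb)).2
      rw [Finset.mem_coe, Multiset.mem_toFinset, Polynomial.mem_nthRoots (by norm_num)]
      linear_combination hb2
    · intro b _ c _ h
      simpa using h

lemma lrS_mono {p : ℕ} (A : Finset (ZMod p)) {X Y : Finset (ZMod p)} (h : X ⊆ Y) :
    lrS A X ⊆ lrS A Y :=
  Finset.image_subset_image (Finset.product_subset_product_right h)

lemma main_first (p : ℕ) [Fact p.Prime] (A X : Finset (ZMod p))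
    (h : ((A - A).card : ℝ) ^ 2 * (X.card : ℝ) ≤ (p : ℝ) ^ 2)
    (hA : A.Nonempty) (hX : X.Nonempty) :
    (A.card : ℝ) ^ 4 * √(X.card : ℝ) ≤
      100000 * (((A - A).card : ℝ) ^ 3 * ((lrS A X).card : ℝ)) := by
  have hnD := card_le_sub A
  have hn1 : 1 ≤ A.card := hA.card_pos
  have hM1 : 1 ≤ X.card := hX.card_pos
  have hnDr : (A.card : ℝ) ≤ ((A - A).card : ℝ) := by exact_mod_cast hnD
  have hn1r : (1 : ℝ) ≤ A.card := by exact_mod_cast hn1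
  have hM1r : (1 : ℝ) ≤ X.card := by exact_mod_cast hM1
  have hn3 : (A.card : ℝ) ^ 3 ≤ ((A - A).card : ℝ) ^ 3 := by gcongr
  by_cases hsm : X.card < 1000
  · have hA3 : (A.card : ℝ) ≤ 3 * ((lrS A X).card : ℝ) := by
      exact_mod_cast card_lrS_ge_A p A X hX
    have hr : √(X.card : ℝ) ≤ 1000 := by
      rw [Real.sqrt_le_left (by norm_num)]
      have : (X.card : ℝ) < 1000 := by exact_mod_cast hsm
      linarith
    calc (A.card : ℝ) ^ 4 * √(X.card : ℝ) = (A.card : ℝ) ^ 3 * (A.card : ℝ) * √(X.card : ℝ) := by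
          ring
      _ ≤ ((A - A).card : ℝ) ^ 3 * (3 * ((lrS A X).card : ℝ)) * 1000 := by gcongr
      _ = 3000 * (((A - A).card : ℝ) ^ 3 * ((lrS A X).card : ℝ)) := by ring
      _ ≤ _ := by gcongr; norm_num
  by_cases hn : A.card = 1
  · have hX3 : (X.card : ℝ) ≤ ((lrS A X).card : ℝ) := by
      exact_mod_cast card_lrS_ge_X A X hA
    have hr : √(X.card : ℝ) ≤ X.card := by
      rw [Real.sqrt_le_left (by linarith)]
      nlinarith
    calc (A.card : ℝ) ^ 4 * √(X.card : ℝ) = (A.card : ℝ) ^ 3 * √(X.card : ℝ) := by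
          rw [hn]; norm_num
      _ ≤ ((A - A).card : ℝ) ^ 3 * ((lrS A X).card : ℝ) := by
          gcongr; exact hr.trans hX3
      _ ≤ _ := le_mul_of_one_le_left (by positivity) (by norm_num)
  obtain ⟨Y, hYX, hYc⟩ := Finset.exists_subset_card_eq (s := X) (n := X.card / 1000)
    (Nat.div_le_self _ _)
  have hnat : (A - A).card ^ 2 * X.card ≤ p ^ 2 := by exact_mod_cast h
  have hY1 : 1 ≤ Y.card := by omega
  have hY2 : 1000 * Y.card ≤ X.card := by omega
  have hY3 : X.card ≤ 2000 * Y.card := by omega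
  have hDpos : 0 < (A - A).card := by omega
  have hpos : 0 < (A - A).card ^ 2 * Y.card := by positivity
  have hY4 : 1000 * ((A - A).card ^ 2 * Y.card) ≤ p ^ 2 := by
    calc 1000 * ((A - A).card ^ 2 * Y.card) = (A - A).card ^ 2 * (1000 * Y.card) := by ring
      _ ≤ (A - A).card ^ 2 * X.card := by gcongr
      _ ≤ _ := hnat
  have hp3 : 3 < p := by
    by_contra hcon
    have : p ≤ 3 := by omega
    have : p ^ 2 ≤ 3 ^ 2 := by gcongr
    omega
  have hm := main_real p hp3 A Y (by omega) hY1 (by omega)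
  have hS : ((lrS A Y).card : ℝ) ≤ ((lrS A X).card : ℝ) := by
    exact_mod_cast Finset.card_le_card (lrS_mono A hYX)
  have hr : √(X.card : ℝ) ≤ 45 * √(Y.card : ℝ) := by
    rw [Real.sqrt_le_left (by positivity), mul_pow, Real.sq_sqrt (by positivity)]
    have : (X.card : ℝ) ≤ 2000 * Y.card := by exact_mod_cast hY3
    have : (0 : ℝ) ≤ Y.card := by positivity
    linarith
  calc (A.card : ℝ) ^ 4 * √(X.card : ℝ) ≤ (A.card : ℝ) ^ 4 * (45 * √(Y.card : ℝ)) := by gcongr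
    _ = 45 * ((A.card : ℝ) ^ 4 * √(Y.card : ℝ)) := by ring
    _ ≤ 45 * (492 * (((A - A).card : ℝ) ^ 3 * ((lrS A Y).card : ℝ))) := by gcongr
    _ ≤ 45 * (492 * (((A - A).card : ℝ) ^ 3 * ((lrS A X).card : ℝ))) := by gcongr
    _ = 22140 * (((A - A).card : ℝ) ^ 3 * ((lrS A X).card : ℝ)) := by ring
    _ ≤ _ := by gcongr; norm_num

theorem stmt_8 :
    ∃ c : ℝ, 0 < c ∧ ∀ (p : ℕ), p.Prime → 2 < p →
      ∀ A X : Finset (ZMod p), ((A - A).card : ℝ) ^ 2 * (X.card : ℝ) ≤ (p : ℝ) ^ 2 →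
      c * min ((X.card : ℝ) ^ ((1 : ℝ) / 2) * (A.card : ℝ) ^ 4 / ((A - A).card : ℝ) ^ 3)
              ((X.card : ℝ) * (A.card : ℝ) ^ 5 / ((A - A).card : ℝ) ^ 4) ≤
        ((((A ×ˢ A) ×ˢ X).image
          (fun q => (q.1.2 - q.1.1) ^ 3 + q.1.1 ^ 3 + q.2)).card : ℝ) := by
  refine ⟨1 / 100000, by norm_num, ?_⟩
  intro p hp _ A X h
  have : Fact p.Prime := ⟨hp⟩
  refine (mul_le_mul_of_nonneg_left (min_le_left _ _) (by norm_num)).trans ?_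
  change _ ≤ ((lrS A X).card : ℝ)
  rw [← Real.sqrt_eq_rpow]
  rcases A.eq_empty_or_nonempty with rfl | hA
  · simp
  rcases X.eq_empty_or_nonempty with rfl | hX
  · simp
  have hm := main_first p A X h hA hX
  have hD : (0 : ℝ) < ((A - A).card : ℝ) := by
    have := hA.card_pos
    have := card_le_sub A
    exact_mod_cast (by omega : 0 < (A - A).card)
  rw [← mul_div_assoc, div_le_iff₀ (by positivity)]
  linarith
end

section
/- There exists a constant c > 0 such that for every prime p > 2, every quadratic polynomial g(x,y) ∈ F_p[x,y] with nonzero xy-coefficient, and every finite sets A, X ⊆ F_p with |A| ≤ |X|, the sumset g(A,A) + X = {g(a,b) + x : a,b ∈ A, x ∈ X} has cardinality at least c · min( |A|·|X|^(1/2), p ). -/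
open Finset

namespace QG

open MvPolynomial in
lemma finrank_rtd (K : Type*) [Field K] (m : ℕ) :
    Module.finrank K (restrictTotalDegree (Fin 3) K m) = (m + 3).choose 3 := by
  classical
  have h1 : Module.finrank K (restrictTotalDegree (Fin 3) K m)
      = Nat.card {n : Fin 3 →₀ ℕ | (n.sum fun _ e => e) ≤ m} :=
    Module.finrank_eq_nat_card_basis (basisRestrictSupport K _)
  rw [h1]
  have h2 : {n : Fin 3 →₀ ℕ | (n.sum fun _ e => e) ≤ m}
      = (((Finset.range (m+1)).biUnion fun j => (Finset.univ : Finset (Fin 3)).finsuppAntidiag j :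
        Finset (Fin 3 →₀ ℕ)) : Set (Fin 3 →₀ ℕ)) := by
    ext n
    simp [Finsupp.sum_fintype]
  rw [h2, Nat.card_eq_card_toFinset, Finset.toFinset_coe, Finset.card_biUnion]
  · simp only [Finset.card_finsuppAntidiag_nat_eq_choose, Finset.card_univ, Fintype.card_fin]
    have h3 : ∀ j, (3 + j - 1).choose j = (j + 2).choose 2 := by
      intro j
      rw [show 3 + j - 1 = j + 2 by omega]
      exact Nat.choose_symm_add
    simp only [h3]
    clear h1 h2
    induction m with
    | zero => simp
    | succ k ih =>
      rw [Finset.sum_range_succ, ih, show k + 1 + 3 = (k+3) + 1 by ring, Nat.choose_succ_succ (k+3) 2,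
        add_comm]
  · intro i _ j _ hij
    rw [Function.onFun, Finset.disjoint_left]
    intro n hn hn'
    rw [Finset.mem_finsuppAntidiag] at hn hn'
    exact hij (hn.1.symm.trans hn'.1)

lemma choose3 (n : ℕ) : ((n + 3).choose 3 : ℤ) * 6 = (n+1)*(n+2)*(n+3) := by
  have h := Nat.descFactorial_eq_factorial_mul_choose (n+3) 3
  have h2 : (n+3).descFactorial 3 = (n+1)*(n+2)*(n+3) := by
    simp [Nat.descFactorial]
    ring
  rw [h2] at h
  have h4 : Nat.factorial 3 = 6 := rfl
  rw [h4] at h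
  have : ((n+1)*(n+2)*(n+3) : ℤ) = 6 * ((n+3).choose 3 : ℕ) := by exact_mod_cast h
  linarith

section lines
variable {K : Type*} [Field K]

/-- restriction of a polynomial to the line `(m, a - b m, x - a b + b^2 m)`, `q = (a,b,x)` -/
noncomputable def ev (q : K × K × K) : MvPolynomial (Fin 3) K →ₐ[K] Polynomial K :=
  MvPolynomial.aeval ![Polynomial.X, Polynomial.C q.1 - Polynomial.C q.2.1 * Polynomial.X,
    Polynomial.C (q.2.2 - q.1 * q.2.1) + Polynomial.C (q.2.1 ^ 2) * Polynomial.X]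

/-- derivative in the direction `(1,-b,b^2)` -/
noncomputable def dd (b : K) (F : MvPolynomial (Fin 3) K) : MvPolynomial (Fin 3) K :=
  MvPolynomial.pderiv 0 F - MvPolynomial.C b * MvPolynomial.pderiv 1 F
    + MvPolynomial.C (b^2) * MvPolynomial.pderiv 2 F

lemma ev_natDegree (q : K × K × K) (F : MvPolynomial (Fin 3) K) :
    (ev q F).natDegree ≤ F.totalDegree := by
  have := MvPolynomial.aeval_natDegree_le (m := F.totalDegree) (n := 1) F le_rfl
    ![Polynomial.X, Polynomial.C q.1 - Polynomial.C q.2.1 * Polynomial.X,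
    Polynomial.C (q.2.2 - q.1 * q.2.1) + Polynomial.C (q.2.1 ^ 2) * Polynomial.X] (by
      intro i
      fin_cases i
      · simp
      · simp only [Fin.mk_one, Matrix.cons_val_one, Matrix.cons_val_zero]
        compute_degree
      · simp only [Fin.reduceFinMk, Matrix.cons_val]
        compute_degree)
  simpa [ev] using this

lemma ev_C (q : K × K × K) (c : K) : ev q (MvPolynomial.C c) = Polynomial.C c := by
  simp [ev]

lemma ev_dd (q : K × K × K) (F : MvPolynomial (Fin 3) K) :
    Polynomial.derivative (ev q F) = ev q (dd q.2.1 F) := by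
  induction F using MvPolynomial.induction_on with
  | C a => simp [ev, dd]
  | add p q hp hq => simp only [map_add, hp, hq, dd, mul_add]; simp; ring
  | mul_X p i h =>
    rw [map_mul, Polynomial.derivative_mul, h]
    simp only [dd, map_add, map_sub, map_mul, MvPolynomial.pderiv_mul, ev_C]
    have key : Polynomial.derivative (ev q (MvPolynomial.X i))
       = ev q (MvPolynomial.pderiv 0 (MvPolynomial.X i)) - Polynomial.C q.2.1 * ev q (MvPolynomial.pderiv 1 (MvPolynomial.X i))
        + Polynomial.C (q.2.1^2) * ev q (MvPolynomial.pderiv 2 (MvPolynomial.X i)) := by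
      fin_cases i <;> simp [ev, MvPolynomial.pderiv_X, Pi.single_apply, Polynomial.derivative_pow]
    rw [key]
    ring

lemma pderiv_comm (i j : Fin 3) (F : MvPolynomial (Fin 3) K) :
    MvPolynomial.pderiv i (MvPolynomial.pderiv j F) = MvPolynomial.pderiv j (MvPolynomial.pderiv i F) := by
  induction F using MvPolynomial.induction_on with
  | C a => simp
  | add p q hp hq => simp only [map_add, hp, hq]
  | mul_X p k h =>
    simp only [MvPolynomial.pderiv_mul, map_add, h, MvPolynomial.pderiv_X, Pi.single_apply]
    split_ifs <;> simp <;> ring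

lemma pderiv_totalDegree (i : Fin 3) (F : MvPolynomial (Fin 3) K) :
    (MvPolynomial.pderiv i F).totalDegree ≤ F.totalDegree - 1 := by
  classical
  rw [MvPolynomial.totalDegree, Finset.sup_le_iff]
  intro m hm
  rw [MvPolynomial.mem_support_iff, MvPolynomial.coeff_pderiv] at hm
  have h1 : m + Finsupp.single i 1 ∈ F.support := by
    rw [MvPolynomial.mem_support_iff]
    exact left_ne_zero_of_mul hm
  have h2 := MvPolynomial.le_totalDegree h1
  rw [Finsupp.sum_add_index' (by simp) (by simp)] at h2
  simp at h2
  omega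

/-- a polynomial of degree `< p` with vanishing partial derivatives is constant -/
lemma pderiv_all_zero (p : ℕ) [CharP K p] (F : MvPolynomial (Fin 3) K)
    (hd : F.totalDegree < p) (h : ∀ i, MvPolynomial.pderiv i F = 0) :
    F.totalDegree = 0 := by
  classical
  by_contra hne
  obtain ⟨m, hm, hmd⟩ : ∃ m ∈ F.support, (m.sum fun _ e => e) ≠ 0 := by
    by_contra hcon
    push Not at hcon
    apply hne
    rw [← Nat.le_zero, MvPolynomial.totalDegree, Finset.sup_le_iff]
    intro m hm
    exact (hcon m hm).le
  obtain ⟨i, hi⟩ : ∃ i, m i ≠ 0 := by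
    by_contra hcon
    push Not at hcon
    apply hmd
    simp [Finsupp.sum, hcon]
  have h1 := MvPolynomial.coeff_pderiv (i := i) F (m - Finsupp.single i 1)
  have h2 : m - Finsupp.single i 1 + Finsupp.single i 1 = m := by
    ext j
    by_cases hj : j = i
    · subst hj; simp; omega
    · simp [Finsupp.single_apply, Ne.symm hj]
  rw [h i, h2] at h1
  simp only [MvPolynomial.coeff_zero] at h1
  have h3 : ((m i : ℕ) : K) = 0 := by
    have h4 := (mul_eq_zero.mp h1.symm).resolve_left (MvPolynomial.mem_support_iff.mp hm)
    have h5 : ((m - Finsupp.single i 1 : Fin 3 →₀ ℕ) i) + 1 = m i := by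
      simp; omega
    rw [← h5]; push_cast; exact_mod_cast h4
  rw [CharP.cast_eq_zero_iff K p] at h3
  have h4 := Nat.le_of_dvd (Nat.pos_of_ne_zero hi) h3
  have h5 := MvPolynomial.le_totalDegree hm
  have h6 : m i ≤ m.sum fun _ e => e := by
    rw [Finsupp.sum_fintype _ _ (by simp)]
    exact Finset.single_le_sum (f := fun j => m j) (by simp) (Finset.mem_univ i)
  omega

end lines

section bezout
variable {K : Type*} [Field K]

lemma exists_sep (q' q : K × K × K) (h : q' ≠ q) :
    ∃ P : MvPolynomial (Fin 3) K, P.totalDegree ≤ 1 ∧ ev q' P = 0 ∧ ev q P ≠ 0 := by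
  obtain ⟨a', b', x'⟩ := q'
  obtain ⟨a, b, x⟩ := q
  have hdeg : ∀ i j : Fin 3, ∀ c d : K, (MvPolynomial.X i + MvPolynomial.C c * MvPolynomial.X j
      - MvPolynomial.C d : MvPolynomial (Fin 3) K).totalDegree ≤ 1 := by
    intro i j c d
    refine (MvPolynomial.totalDegree_sub _ _).trans (max_le ?_ (by simp))
    refine (MvPolynomial.totalDegree_add _ _).trans (max_le (by simp) ?_)
    refine (MvPolynomial.totalDegree_mul _ _).trans (by simp)
  by_cases hab : a = a' ∧ b = b'
  · obtain ⟨rfl, rfl⟩ := hab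
    refine ⟨MvPolynomial.X 2 + MvPolynomial.C b * MvPolynomial.X 1 - MvPolynomial.C x', hdeg _ _ _ _, ?_, ?_⟩
    · simp [ev]; ring
    · have : ev (a, b, x) (MvPolynomial.X 2 + MvPolynomial.C b * MvPolynomial.X 1 - MvPolynomial.C x')
        = Polynomial.C (x - x') := by simp [ev]; ring
      rw [this]
      rw [Ne, Polynomial.C_eq_zero, sub_eq_zero]
      rintro rfl
      exact h rfl
  · refine ⟨MvPolynomial.X 1 + MvPolynomial.C b' * MvPolynomial.X 0 - MvPolynomial.C a', hdeg _ _ _ _, ?_, ?_⟩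
    · simp [ev]
    · have : ev (a, b, x) (MvPolynomial.X 1 + MvPolynomial.C b' * MvPolynomial.X 0 - MvPolynomial.C a')
        = Polynomial.C (b' - b) * Polynomial.X + Polynomial.C (a - a') := by simp [ev]; ring
      rw [this]
      intro h0
      have h1 := congrArg (Polynomial.coeff · 1) h0
      have h2 := congrArg (Polynomial.coeff · 0) h0
      simp [Polynomial.coeff_C] at h1 h2
      exact hab ⟨sub_eq_zero.mp h2, (sub_eq_zero.mp h1).symm⟩

lemma exists_pi [DecidableEq K] (T : Finset (K × K × K)) (q : K × K × K) :
    ∃ P : MvPolynomial (Fin 3) K, P.totalDegree ≤ #T ∧ (∀ q' ∈ T, q' ≠ q → ev q' P = 0) ∧ ev q P ≠ 0 := by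
  classical
  have h : ∀ q', ∃ P : MvPolynomial (Fin 3) K, q' ≠ q → P.totalDegree ≤ 1 ∧ ev q' P = 0 ∧ ev q P ≠ 0 := by
    intro q'
    by_cases h : q' = q
    · exact ⟨0, fun h' => absurd h h'⟩
    · obtain ⟨P, hP⟩ := exists_sep q' q h
      exact ⟨P, fun _ => hP⟩
  choose P hP using h
  refine ⟨∏ q' ∈ T.erase q, P q', ?_, ?_, ?_⟩
  · refine (MvPolynomial.totalDegree_finsetProd _ _).trans ?_
    refine (Finset.sum_le_sum (g := fun _ => 1) ?_).trans ?_
    · intro i hi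
      exact (hP i (Finset.ne_of_mem_erase hi)).1
    · simp [Finset.card_erase_le]
  · intro q' hq' hne
    rw [map_prod]
    exact Finset.prod_eq_zero (Finset.mem_erase.mpr ⟨hne, hq'⟩) (hP q' hne).2.1
  · rw [map_prod, Finset.prod_ne_zero_iff]
    intro i hi
    exact (hP i (Finset.ne_of_mem_erase hi)).2.2

open MvPolynomial in
lemma bezout_aux (f G : MvPolynomial (Fin 3) K) (hf : Irreducible f) (hG : ¬ f ∣ G)
    (T : Finset (K × K × K)) (hT : ∀ q ∈ T, ev q f = 0 ∧ ev q G = 0) (n : ℕ) :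
    #T * n + (n + #T + G.totalDegree + 3).choose 3 + (n + #T + f.totalDegree + 3).choose 3
    ≤ (n + #T + f.totalDegree + G.totalDegree + 3).choose 3 + (n + #T + 3).choose 3 := by
  classical
  set d := f.totalDegree with hd
  set e := G.totalDegree with he
  set E := n + #T with hE
  have hf0 : f ≠ 0 := hf.ne_zero
  have hfp : Prime f := hf.prime
  choose π hπ1 hπ2 hπ3 using fun q => exists_pi T q
  let P1 := restrictTotalDegree (Fin 3) K (E + e)
  let P2 := restrictTotalDegree (Fin 3) K (E + d)
  let Φ : (P1 × P2 × (T × Fin n → K)) →ₗ[K] MvPolynomial (Fin 3) K :=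
    LinearMap.coprod (LinearMap.mulRight K f ∘ₗ P1.subtype)
      (LinearMap.coprod (LinearMap.mulRight K G ∘ₗ P2.subtype)
        (Fintype.linearCombination K (fun qi : T × Fin n => π qi.1 * X 0 ^ (qi.2 : ℕ))))
  have hΦ : ∀ v, Φ v = v.1 * f + (v.2.1 * G + ∑ qi : T × Fin n, v.2.2 qi • (π qi.1 * X 0 ^ (qi.2 : ℕ))) := by
    intro v
    simp [Φ, Fintype.linearCombination_apply]
  have hrank := LinearMap.finrank_range_add_finrank_ker Φ
  have hV : Module.finrank K (P1 × P2 × (T × Fin n → K))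
      = (E + e + 3).choose 3 + ((E + d + 3).choose 3 + #T * n) := by
    rw [Module.finrank_prod, Module.finrank_prod, finrank_rtd, finrank_rtd, Module.finrank_fintype_fun_eq_card]
    simp
  have hrange : Module.finrank K (LinearMap.range Φ) ≤ (E + d + e + 3).choose 3 := by
    rw [← finrank_rtd K]
    apply Submodule.finrank_mono
    rintro _ ⟨v, rfl⟩
    rw [hΦ]
    refine Submodule.add_mem _ ?_ (Submodule.add_mem _ ?_ (Submodule.sum_mem _ ?_))
    · rw [mem_restrictTotalDegree]
      have h1 := (mem_restrictTotalDegree _ _ _).mp v.1.2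
      have := totalDegree_mul (v.1 : MvPolynomial (Fin 3) K) f
      omega
    · rw [mem_restrictTotalDegree]
      have h1 := (mem_restrictTotalDegree _ _ _).mp v.2.1.2
      have := totalDegree_mul (v.2.1 : MvPolynomial (Fin 3) K) G
      omega
    · intro qi _
      apply Submodule.smul_mem
      rw [mem_restrictTotalDegree]
      have h1 := hπ1 qi.1
      have h2 := totalDegree_mul (π qi.1) (X 0 ^ (qi.2 : ℕ))
      have h3 : (X 0 ^ (qi.2 : ℕ) : MvPolynomial (Fin 3) K).totalDegree = qi.2 := totalDegree_X_pow _ _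
      have h4 := qi.2.2
      omega
  have hkey : ∀ v ∈ LinearMap.ker Φ, v.2.2 = 0 ∧ (v.1 * f + v.2.1 * G : MvPolynomial (Fin 3) K) = 0 := by
    intro v hv
    rw [LinearMap.mem_ker, hΦ] at hv
    have hc : v.2.2 = 0 := by
      funext ⟨q, i⟩
      have h1 := congrArg (ev (q : K × K × K)) hv
      rw [map_add, map_add, map_mul, map_mul, (hT q q.2).1, (hT q q.2).2, mul_zero, mul_zero, zero_add, zero_add,
        map_zero, map_sum, Fintype.sum_prod_type, Finset.sum_eq_single q] at h1
      · have h2 : ev (q : K × K × K) (π q) * ∑ j : Fin n, Polynomial.C (v.2.2 (q, j)) * Polynomial.X ^ (j : ℕ) = 0 := by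
          rw [← h1, Finset.mul_sum]
          refine Finset.sum_congr rfl fun j _ => ?_
          rw [map_smul, map_mul, map_pow, Polynomial.smul_eq_C_mul]
          have : ev (q : K × K × K) (X 0) = Polynomial.X := by simp [ev]
          rw [this]; ring
        have h3 := (mul_eq_zero.mp h2).resolve_left (hπ3 q)
        have h4 := congrArg (Polynomial.coeff · (i : ℕ)) h3
        simp only [Polynomial.finsetSum_coeff, Polynomial.coeff_C_mul, Polynomial.coeff_X_pow, Polynomial.coeff_zero] at h4
        rw [Finset.sum_eq_single i] at h4
        · simpa using h4
        · intro j _ hj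
          rw [if_neg, mul_zero]
          intro h; exact hj (Fin.ext h.symm)
        · simp
      · intro q' _ hne
        apply Finset.sum_eq_zero
        intro j _
        rw [map_smul, map_mul, hπ2 q' q q.2 (fun h => hne (Subtype.ext h.symm)), zero_mul, smul_zero]
      · simp
    refine ⟨hc, ?_⟩
    rw [hc] at hv
    simpa using hv
  have hker : Module.finrank K (LinearMap.ker Φ) ≤ (E + 3).choose 3 := by
    let j : LinearMap.ker Φ →ₗ[K] MvPolynomial (Fin 3) K :=
      P2.subtype ∘ₗ LinearMap.fst K P2 _ ∘ₗ LinearMap.snd K P1 _ ∘ₗ (LinearMap.ker Φ).subtype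
    have hj : ∀ v, j v = (v : P1 × P2 × (T × Fin n → K)).2.1 := fun v => rfl
    have hinj : Function.Injective j := by
      intro v w hvw
      rw [hj, hj] at hvw
      obtain ⟨h1, h2⟩ := hkey v v.2
      obtain ⟨h1', h2'⟩ := hkey w w.2
      rw [← hvw] at h2'
      have h3 := mul_right_cancel₀ hf0 (add_right_cancel (h2.trans h2'.symm))
      apply Subtype.ext
      exact Prod.ext (Subtype.ext h3) (Prod.ext (Subtype.ext hvw) (h1.trans h1'.symm))
    rw [← LinearMap.finrank_range_of_inj hinj]
    rw [← finrank_rtd K]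
    refine le_trans (Submodule.finrank_mono (t := (restrictTotalDegree (Fin 3) K E).map (LinearMap.mulLeft K f)) ?_)
      (Submodule.finrank_map_le _ _)
    rintro _ ⟨v, rfl⟩
    rw [hj]
    obtain ⟨h1, h2⟩ := hkey v v.2
    have h3 : f ∣ (v : P1 × P2 × (T × Fin n → K)).2.1 * G := by
      rw [add_eq_zero_iff_eq_neg'] at h2
      rw [h2]
      exact Dvd.intro_left _ (by rw [neg_mul])
    obtain ⟨C, hC⟩ := (hfp.dvd_or_dvd h3).resolve_right hG
    refine ⟨C, ?_, hC.symm⟩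
    have h4 := (mem_restrictTotalDegree _ _ _).mp (v : P1 × P2 × (T × Fin n → K)).2.1.2
    rw [hC] at h4
    rw [SetLike.mem_coe, mem_restrictTotalDegree]
    by_cases hC0 : C = 0
    · simp [hC0]
    · rw [totalDegree_mul_of_isDomain hf0 hC0] at h4
      omega
  omega

/-- Bezout for lines -/
lemma bezout (f G : MvPolynomial (Fin 3) K) (hf : Irreducible f) (hG : ¬ f ∣ G)
    (T : Finset (K × K × K)) (hT : ∀ q ∈ T, ev q f = 0 ∧ ev q G = 0) :
    #T ≤ f.totalDegree * G.totalDegree := by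
  by_contra hcon
  push Not at hcon
  set d := f.totalDegree
  set e := G.totalDegree
  set N := #T
  set n := d * e * (2 * N + d + e + 4) + 1 with hn
  have h := bezout_aux f G hf hG T hT n
  have c1 := choose3 (n + N + e)
  have c2 := choose3 (n + N + d)
  have c3 := choose3 (n + N + d + e)
  have c4 := choose3 (n + N)
  have h' : ((N * n + (n + N + e + 3).choose 3 + (n + N + d + 3).choose 3 : ℕ) : ℤ)
    ≤ ((n + N + d + e + 3).choose 3 + (n + N + 3).choose 3 : ℕ) := by exact_mod_cast h
  push_cast at h' c1 c2 c3 c4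
  have h2 : 6 * ((N : ℤ) * n) ≤ 3 * (d * e * (2 * n + 2 * N + d + e + 4)) := by
    linear_combination 6 * h' - c1 - c2 + c3 + c4
  have h3 : (n : ℤ) = d * e * (2 * N + d + e + 4) + 1 := by rw [hn]; push_cast; ring
  have h4 : (d : ℤ) * e + 1 ≤ N := by exact_mod_cast hcon
  have h5 : (0 : ℤ) ≤ n := by positivity
  have h6 : (d : ℤ) * e * (2 * N + d + e + 4) = n - 1 := by linarith
  nlinarith

end bezout

section single
variable {K : Type*} [Field K]

/-- the symplectic-type form deciding whether two lines meet -/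
def om (u w : K × K × K) : K := u.2.2 - w.2.2 + u.1 * w.2.1 - u.2.1 * w.1

/-- parameter of the meeting point -/
def tau (u w : K × K × K) : K := (u.1 - w.1) / (u.2.1 - w.2.1)

lemma eval_tau (u w : K × K × K) (hb : u.2.1 ≠ w.2.1) (h : om u w = 0) (G : MvPolynomial (Fin 3) K) :
    (ev u G).eval (tau u w) = (ev w G).eval (tau u w) := by
  have hne : u.2.1 - w.2.1 ≠ 0 := sub_ne_zero.mpr hb
  have ht : tau u w * (u.2.1 - w.2.1) = u.1 - w.1 := by
    rw [tau]; field_simp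
  unfold om at h
  induction G using MvPolynomial.induction_on with
  | C a => simp [ev]
  | add p q hp hq => simp only [map_add, Polynomial.eval_add, hp, hq]
  | mul_X p i hp =>
    rw [map_mul, map_mul, Polynomial.eval_mul, Polynomial.eval_mul, hp]
    congr 1
    fin_cases i
    · simp [ev]
    · simp [ev]; linear_combination -ht
    · simp [ev]; linear_combination (u.2.1 + w.2.1) * ht + h

lemma tau_inj (u u' w : K × K × K) (hb : u.2.1 ≠ w.2.1) (h : om u w = 0)
    (hb' : u'.2.1 ≠ w.2.1) (h' : om u' w = 0) (ht : tau u w = tau u' w) : om u u' = 0 := by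
  have e1 := eval_tau u w hb h (MvPolynomial.X 1)
  have e2 := eval_tau u w hb h (MvPolynomial.X 2)
  have e1' := eval_tau u' w hb' h' (MvPolynomial.X 1)
  have e2' := eval_tau u' w hb' h' (MvPolynomial.X 2)
  rw [← ht] at e1' e2'
  simp [ev] at e1 e2 e1' e2'
  unfold om
  linear_combination e2 - e2' + (u.2.1 + u'.2.1) * (e1 - e1')

lemma natDegree_eq_of_prop (p : ℕ) [CharP K p] (P Q : Polynomial K) (hP : P ≠ 0) (hQ : Q ≠ 0)
    (hd : P.natDegree + Q.natDegree < p)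
    (h : Polynomial.derivative P * Q = P * Polynomial.derivative Q) : P.natDegree = Q.natDegree := by
  have hx : ∀ R : Polynomial K, (Polynomial.X * Polynomial.derivative R).natDegree ≤ R.natDegree ∧
      (Polynomial.X * Polynomial.derivative R).coeff R.natDegree = R.natDegree * R.leadingCoeff := by
    intro R
    rcases Nat.eq_zero_or_pos R.natDegree with h0 | h0
    · rw [Polynomial.eq_C_of_natDegree_eq_zero h0]
      simp
    · constructor
      · refine Polynomial.natDegree_mul_le.trans ?_
        have := Polynomial.natDegree_derivative_le R
        simp only [Polynomial.natDegree_X]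
        omega
      · obtain ⟨k, hk⟩ : ∃ k, R.natDegree = k + 1 := ⟨R.natDegree - 1, by omega⟩
        rw [hk, Polynomial.coeff_X_mul, Polynomial.coeff_derivative, Polynomial.leadingCoeff, hk]
        push_cast; ring
  have h1 : (Polynomial.X * Polynomial.derivative P) * Q = P * (Polynomial.X * Polynomial.derivative Q) := by
    linear_combination Polynomial.X * h
  have h2 := congrArg (Polynomial.coeff · (P.natDegree + Q.natDegree)) h1
  rw [Polynomial.coeff_mul_add_eq_of_natDegree_le (hx P).1 le_rfl,
    Polynomial.coeff_mul_add_eq_of_natDegree_le le_rfl (hx Q).1, (hx P).2, (hx Q).2] at h2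
  have hP' : P.leadingCoeff ≠ 0 := by simpa using hP
  have hQ' : Q.leadingCoeff ≠ 0 := by simpa using hQ
  have h3 : ((P.natDegree : ℕ) : K) = (Q.natDegree : ℕ) := by
    have : P.leadingCoeff * Q.leadingCoeff * ((P.natDegree : K) - Q.natDegree) = 0 := by
      simp only [Polynomial.leadingCoeff] at *
      linear_combination h2
    have := (mul_eq_zero.mp this).resolve_left (mul_ne_zero hP' hQ')
    exact sub_eq_zero.mp this
  rw [CharP.natCast_eq_natCast (R := K) (p := p)] at h3
  have h4 := h3
  unfold Nat.ModEq at h4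
  rwa [Nat.mod_eq_of_lt (by omega), Nat.mod_eq_of_lt (by omega)] at h4

lemma proportional (p : ℕ) [CharP K p] (P Q : Polynomial K) (hQ : Q ≠ 0)
    (hd : P.natDegree + Q.natDegree < p)
    (h : Polynomial.derivative P * Q = P * Polynomial.derivative Q) : ∃ κ : K, P = Polynomial.C κ * Q := by
  by_cases hP : P = 0
  · exact ⟨0, by simp [hP]⟩
  have hdeg := natDegree_eq_of_prop p P Q hP hQ hd h
  refine ⟨P.leadingCoeff / Q.leadingCoeff, ?_⟩
  have hQ' : Q.leadingCoeff ≠ 0 := by simpa using hQ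
  set κ := P.leadingCoeff / Q.leadingCoeff
  have hκ : κ * Q.leadingCoeff = P.leadingCoeff := by simp only [κ]; field_simp
  by_contra hne
  have hR : P - Polynomial.C κ * Q ≠ 0 := sub_ne_zero.mpr hne
  have hle : (P - Polynomial.C κ * Q).natDegree ≤ Q.natDegree := by
    refine (Polynomial.natDegree_sub_le _ _).trans (max_le hdeg.le ?_)
    exact Polynomial.natDegree_C_mul_le _ _
  have hd2 := natDegree_eq_of_prop p (P - Polynomial.C κ * Q) Q hR hQ (by omega) (by
    simp only [Polynomial.derivative_sub, Polynomial.derivative_mul, Polynomial.derivative_C]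
    linear_combination h)
  have h5 : (P - Polynomial.C κ * Q).leadingCoeff = 0 := by
    rw [Polynomial.leadingCoeff, hd2, Polynomial.coeff_sub, Polynomial.coeff_C_mul]
    have : P.coeff Q.natDegree = P.leadingCoeff := by rw [Polynomial.leadingCoeff, hdeg]
    rw [this, ← hκ]
    exact sub_self _
  exact hR (by simpa using h5)

lemma pderiv_dd (i : Fin 3) (b : K) (F : MvPolynomial (Fin 3) K) :
    MvPolynomial.pderiv i (dd b F) = dd b (MvPolynomial.pderiv i F) := by
  simp only [dd, map_add, map_sub, MvPolynomial.pderiv_C_mul, pderiv_comm i]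

lemma irr_pos {f : MvPolynomial (Fin 3) K} (hf : Irreducible f) : 0 < f.totalDegree := by
  by_contra h0
  have h1 : f.totalDegree = 0 := by omega
  rw [MvPolynomial.totalDegree_eq_zero_iff_eq_C] at h1
  apply hf.not_isUnit
  rw [h1]
  apply IsUnit.map
  rw [isUnit_iff_ne_zero]
  intro h2
  rw [h2] at h1
  exact hf.ne_zero (by simpa using h1)

lemma not_dvd_pderiv {f : MvPolynomial (Fin 3) K} (hf : Irreducible f) (i : Fin 3)
    (h : MvPolynomial.pderiv i f ≠ 0) : ¬ f ∣ MvPolynomial.pderiv i f := by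
  intro hd
  have h1 := MvPolynomial.totalDegree_le_of_dvd_of_isDomain hd h
  have h2 := pderiv_totalDegree i f
  have h3 := irr_pos hf
  omega

/-- values of the derivatives at a crossing -/
lemma cross_vals {u w : K × K × K} {f : MvPolynomial (Fin 3) K} (hb : u.2.1 ≠ w.2.1) (h : om u w = 0)
    (hu : ev u f = 0) (hw : ev w f = 0) :
    (ev w (MvPolynomial.pderiv 1 f)).eval (tau u w)
      = (w.2.1 + u.2.1) * (ev w (MvPolynomial.pderiv 2 f)).eval (tau u w) ∧
    (ev w (MvPolynomial.pderiv 0 f)).eval (tau u w)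
      = w.2.1 * u.2.1 * (ev w (MvPolynomial.pderiv 2 f)).eval (tau u w) := by
  have h1 : (ev w (dd w.2.1 f)).eval (tau u w) = 0 := by rw [← ev_dd, hw]; simp
  have h2 : (ev w (dd u.2.1 f)).eval (tau u w) = 0 := by
    rw [← eval_tau u w hb h, ← ev_dd, hu]; simp
  simp only [dd, map_add, map_sub, map_mul, ev_C, Polynomial.eval_add, Polynomial.eval_sub,
    Polynomial.eval_mul, Polynomial.eval_C] at h1 h2
  have hne : u.2.1 - w.2.1 ≠ 0 := sub_ne_zero.mpr hb
  constructor
  · apply mul_left_cancel₀ hne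
    linear_combination h1 - h2
  · apply mul_left_cancel₀ hne
    linear_combination u.2.1 * h1 - w.2.1 * h2

/-- configuration hypotheses -/
structure Cfg (U W : Finset (K × K × K)) (L : ℕ) [DecidableEq K] : Prop where
  h1 : ∀ u ∈ U, ∀ u' ∈ U, om u u' = 0 → u = u'
  h2 : #(U.image (fun u => u.2.1)) ≤ L
  h3 : ∀ w ∈ W, ∀ b, #{u ∈ U | u.2.1 = b ∧ om u w = 0} ≤ L
  h4 : ∀ u ∈ U, ∀ w ∈ W, u.2.1 ≠ w.2.1

variable [DecidableEq K]

lemma Cfg.mono {U W U' W' : Finset (K × K × K)} {L : ℕ} (h : Cfg U W L) (hU : U' ⊆ U) (hW : W' ⊆ W) :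
    Cfg U' W' L where
  h1 u hu u' hu' := h.h1 u (hU hu) u' (hU hu')
  h2 := (card_le_card (image_subset_image hU)).trans h.h2
  h3 w hw b := (card_le_card (filter_subset_filter _ hU)).trans (h.h3 w (hW hw) b)
  h4 u hu w hw := h.h4 u (hU hu) w (hW hw)

lemma count_roots {U W : Finset (K × K × K)} {L : ℕ} (h : Cfg U W L) {w : K × K × K} (hw : w ∈ W)
    (S : Finset (K × K × K)) (hS : ∀ u ∈ S, u ∈ U ∧ om u w = 0) (P : Polynomial K) (hP : P ≠ 0)
    (hz : ∀ u ∈ S, P.eval (tau u w) = 0) : #S ≤ P.natDegree := by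
  classical
  refine le_trans ?_ (P.card_roots')
  refine le_trans ?_ (Multiset.toFinset_card_le _)
  refine card_le_card_of_injOn (fun u => tau u w) ?_ ?_
  · intro u hu
    simp only [mem_coe, Multiset.mem_toFinset]
    rw [Polynomial.mem_roots hP]
    exact hz u hu
  · intro u hu u' hu' ht
    obtain ⟨a, b⟩ := hS u hu
    obtain ⟨a', b'⟩ := hS u' hu'
    exact h.h1 u a u' a' (tau_inj u u' w (h.h4 u a w hw) b (h.h4 u' a' w hw) b' ht)

end single

section single2
variable {K : Type*} [Field K]

open MvPolynomial

/-- coefficients of the quartic `dd b (dd b f)` in `b` -/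
noncomputable def c0 (f : MvPolynomial (Fin 3) K) : MvPolynomial (Fin 3) K := pderiv 0 (pderiv 0 f)
/-- linear coefficient -/
noncomputable def c1 (f : MvPolynomial (Fin 3) K) : MvPolynomial (Fin 3) K :=
  - (pderiv 0 (pderiv 1 f) + pderiv 0 (pderiv 1 f))
/-- quadratic coefficient -/
noncomputable def c2 (f : MvPolynomial (Fin 3) K) : MvPolynomial (Fin 3) K :=
  pderiv 1 (pderiv 1 f) + (pderiv 0 (pderiv 2 f) + pderiv 0 (pderiv 2 f))
/-- cubic coefficient -/
noncomputable def c3 (f : MvPolynomial (Fin 3) K) : MvPolynomial (Fin 3) K :=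
  - (pderiv 1 (pderiv 2 f) + pderiv 1 (pderiv 2 f))
/-- quartic coefficient -/
noncomputable def c4 (f : MvPolynomial (Fin 3) K) : MvPolynomial (Fin 3) K := pderiv 2 (pderiv 2 f)
/-- quotient coefficient -/
noncomputable def s2 (f : MvPolynomial (Fin 3) K) : MvPolynomial (Fin 3) K :=
  pderiv 2 f * pderiv 2 f * c4 f
/-- quotient coefficient -/
noncomputable def s1 (f : MvPolynomial (Fin 3) K) : MvPolynomial (Fin 3) K :=
  pderiv 2 f * pderiv 2 f * c3 f + pderiv 2 f * pderiv 1 f * c4 f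
/-- quotient coefficient -/
noncomputable def s0 (f : MvPolynomial (Fin 3) K) : MvPolynomial (Fin 3) K :=
  pderiv 2 f * pderiv 2 f * c2 f + pderiv 1 f * pderiv 2 f * c3 f + pderiv 1 f * pderiv 1 f * c4 f
    - pderiv 2 f * pderiv 0 f * c4 f
/-- remainder coefficient -/
noncomputable def r1 (f : MvPolynomial (Fin 3) K) : MvPolynomial (Fin 3) K :=
  pderiv 2 f * pderiv 2 f * c1 f * pderiv 2 f + s0 f * pderiv 1 f - s1 f * pderiv 0 f
/-- remainder coefficient -/
noncomputable def r0 (f : MvPolynomial (Fin 3) K) : MvPolynomial (Fin 3) K :=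
  pderiv 2 f * pderiv 2 f * c0 f * pderiv 2 f - s0 f * pderiv 0 f
/-- quotient -/
noncomputable def sb (f : MvPolynomial (Fin 3) K) (b : K) : MvPolynomial (Fin 3) K :=
  s2 f * C b ^ 2 + s1 f * C b + s0 f

lemma main_id (f : MvPolynomial (Fin 3) K) (b : K) :
    pderiv 2 f ^ 3 * dd b (dd b f) = dd b f * sb f b + (r1 f * C b + r0 f) := by
  simp only [dd, sb, r1, r0, s0, s1, s2, c0, c1, c2, c3, c4, map_add, map_sub, pderiv_C_mul,
    pderiv_comm 1 0, pderiv_comm 2 0, pderiv_comm 2 1]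
  simp only [C_pow]
  ring

lemma main_id' (f : MvPolynomial (Fin 3) K) (b : K) :
    pderiv 2 f ^ 3 * (2 * (C (2 * b) * dd b (pderiv 2 f) - dd b (pderiv 1 f)))
    = (C (2 * b) * pderiv 2 f - pderiv 1 f) * sb f b + dd b f * (s2 f * C (2 * b) + s1 f) + r1 f := by
  simp only [dd, sb, r1, r0, s0, s1, s2, c0, c1, c2, c3, c4, map_add, map_sub, pderiv_C_mul, C_pow,
    pderiv_comm 1 0, pderiv_comm 2 0, pderiv_comm 2 1, C_mul]
  have : (C (2 : K) : MvPolynomial (Fin 3) K) = 2 := map_ofNat C 2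
  rw [this]
  ring

lemma td_mul {P Q : MvPolynomial (Fin 3) K} {a b c : ℕ} (hP : P.totalDegree ≤ a) (hQ : Q.totalDegree ≤ b)
    (h : a + b ≤ c) :
    (P * Q).totalDegree ≤ c := (totalDegree_mul _ _).trans (by omega)
lemma td_add {P Q : MvPolynomial (Fin 3) K} {a : ℕ} (hP : P.totalDegree ≤ a) (hQ : Q.totalDegree ≤ a) :
    (P + Q).totalDegree ≤ a := (totalDegree_add _ _).trans (max_le hP hQ)
lemma td_sub {P Q : MvPolynomial (Fin 3) K} {a : ℕ} (hP : P.totalDegree ≤ a) (hQ : Q.totalDegree ≤ a) :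
    (P - Q).totalDegree ≤ a := (totalDegree_sub _ _).trans (max_le hP hQ)

lemma r_deg (f : MvPolynomial (Fin 3) K) :
    (r0 f).totalDegree ≤ 4 * f.totalDegree ∧ (r1 f).totalDegree ≤ 4 * f.totalDegree := by
  set n := f.totalDegree
  have hp : ∀ i, (pderiv i f).totalDegree ≤ n := fun i => (pderiv_totalDegree i f).trans (by omega)
  have hpp : ∀ i j, (pderiv i (pderiv j f)).totalDegree ≤ n := fun i j =>
    (pderiv_totalDegree i _).trans ((Nat.sub_le _ _).trans (hp j))
  have h0 : (c0 f).totalDegree ≤ n := hpp _ _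
  have h1 : (c1 f).totalDegree ≤ n := by
    rw [c1, totalDegree_neg]; exact td_add (hpp _ _) (hpp _ _)
  have h2 : (c2 f).totalDegree ≤ n := td_add (hpp _ _) (td_add (hpp _ _) (hpp _ _))
  have h3 : (c3 f).totalDegree ≤ n := by
    rw [c3, totalDegree_neg]; exact td_add (hpp _ _) (hpp _ _)
  have h4 : (c4 f).totalDegree ≤ n := hpp _ _
  have tr : ∀ i j (c : MvPolynomial (Fin 3) K), c.totalDegree ≤ n →
      (pderiv i f * pderiv j f * c).totalDegree ≤ 3 * n := fun i j c hc =>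
    td_mul (td_mul (hp i) (hp j) le_rfl) hc (by omega)
  have hs0 : (s0 f).totalDegree ≤ 3 * n :=
    td_sub (td_add (td_add (tr _ _ _ h2) (tr _ _ _ h3)) (tr _ _ _ h4)) (tr _ _ _ h4)
  have hs1 : (s1 f).totalDegree ≤ 3 * n := td_add (tr _ _ _ h3) (tr _ _ _ h4)
  constructor
  · exact td_sub (td_mul (tr _ _ _ h0) (hp _) (by omega)) (td_mul hs0 (hp _) (by omega))
  · exact td_sub (td_add (td_mul (tr _ _ _ h1) (hp _) (by omega)) (td_mul hs0 (hp _) (by omega)))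
      (td_mul hs1 (hp _) (by omega))

lemma cross_r {u w : K × K × K} {f : MvPolynomial (Fin 3) K} (hb : u.2.1 ≠ w.2.1) (h : om u w = 0)
    (hu : ev u f = 0) (hw : ev w f = 0) :
    (ev w (r0 f)).eval (tau u w) = 0 ∧ (ev w (r1 f)).eval (tau u w) = 0 := by
  have key : ∀ b, (ev w (dd b f)).eval (tau u w) = 0 → (ev w (dd b (dd b f))).eval (tau u w) = 0 →
      (ev w (r1 f)).eval (tau u w) * b + (ev w (r0 f)).eval (tau u w) = 0 := by
    intro b h1 h2
    have := congrArg (fun P => (ev w P).eval (tau u w)) (main_id f b)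
    simp only [map_mul, map_add, Polynomial.eval_mul, Polynomial.eval_add, h1, h2, mul_zero, zero_mul,
      ev_C, Polynomial.eval_C, zero_add] at this
    exact this.symm
  have hwd : ev w (dd w.2.1 f) = 0 := by rw [← ev_dd, hw]; simp
  have hwdd : ev w (dd w.2.1 (dd w.2.1 f)) = 0 := by rw [← ev_dd, hwd]; simp
  have hud : ev u (dd u.2.1 f) = 0 := by rw [← ev_dd, hu]; simp
  have hudd : ev u (dd u.2.1 (dd u.2.1 f)) = 0 := by rw [← ev_dd, hud]; simp
  have k1 := key w.2.1 (by rw [hwd]; simp) (by rw [hwdd]; simp)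
  have k2 := key u.2.1 (by rw [← eval_tau u w hb h, hud]; simp) (by rw [← eval_tau u w hb h, hudd]; simp)
  have hne : u.2.1 - w.2.1 ≠ 0 := sub_ne_zero.mpr hb
  have e1 : (ev w (r1 f)).eval (tau u w) = 0 := by
    apply mul_left_cancel₀ hne
    linear_combination k2 - k1
  refine ⟨?_, e1⟩
  rw [e1] at k1
  simpa using k1

/-- the ODE case: `f` divides both remainders -/
lemma ode_case (p : ℕ) [CharP K p] {f : MvPolynomial (Fin 3) K} (hp : 4 * f.totalDegree < p)
    (h0 : f ∣ r0 f) (h1 : f ∣ r1 f) (w : K × K × K) (hw : ev w f = 0) (hc : ev w (pderiv 2 f) ≠ 0)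
    (hg : ev w (pderiv 1 f) - Polynomial.C (2 * w.2.1) * ev w (pderiv 2 f) ≠ 0) :
    ∃ l k : K, ev w (pderiv 2 f) = (Polynomial.C l * Polynomial.X + Polynomial.C k) *
      (ev w (pderiv 1 f) - Polynomial.C (2 * w.2.1) * ev w (pderiv 2 f)) := by
  set b := w.2.1 with hb
  set fc := ev w (pderiv 2 f) with hfc
  set fk := ev w (pderiv 1 f) with hfk
  have hn : ∀ i, (ev w (pderiv i f)).natDegree + 1 ≤ f.totalDegree ∨ ev w (pderiv i f) = 0 := by
    intro i
    have a1 := ev_natDegree w (pderiv i f)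
    have a2 := pderiv_totalDegree i f
    by_cases hz : f.totalDegree = 0
    · right
      rw [totalDegree_eq_zero_iff_eq_C] at hz
      rw [hz]; simp
    · left; omega
  have hcd : fc.natDegree + 1 ≤ f.totalDegree := (hn 2).resolve_right hc
  have hkd : fk.natDegree + 1 ≤ f.totalDegree := by
    rcases hn 1 with h | h
    · exact h
    · rw [hfk, h]; simp; omega
  have hwd : ev w (dd b f) = 0 := by rw [hb, ← ev_dd, hw]; simp
  have hwdd : ev w (dd b (dd b f)) = 0 := by rw [hb, ← ev_dd, ← hb, hwd]; simp
  have hd1 : ∀ i, ev w (dd b (pderiv i f)) = Polynomial.derivative (ev w (pderiv i f)) := by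
    intro i; rw [ev_dd]
  have hd2 : ∀ i, ev w (dd b (dd b (pderiv i f)))
      = Polynomial.derivative (Polynomial.derivative (ev w (pderiv i f))) := by
    intro i; rw [← hd1, ev_dd]
  obtain ⟨σ, hσ⟩ : f ∣ r1 f * C b + r0 f := dvd_add (Dvd.dvd.mul_right h1 _) h0
  have hid := main_id f b
  rw [hσ] at hid
  have hder : ∀ i, fc ^ 3 * Polynomial.derivative (Polynomial.derivative (ev w (pderiv i f)))
      = Polynomial.derivative (ev w (pderiv i f)) * ev w (sb f b) + ev w (pderiv i f) * ev w σ := by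
    intro i
    have a1 := congrArg (fun P => ev w (pderiv i P)) hid
    simp only [pderiv_mul, map_add, map_mul, hwd, hwdd, hw, map_pow] at a1
    rw [pderiv_dd, pderiv_dd, hd1, hd2] at a1
    rw [hfc]
    linear_combination a1
  have hid' := congrArg (ev w) (main_id' f b)
  have hr1 : ev w (r1 f) = 0 := by
    obtain ⟨t, ht⟩ := h1
    rw [ht, map_mul, hw, zero_mul]
  have h2 : ev w (2 : MvPolynomial (Fin 3) K) = 2 := map_ofNat _ 2
  simp only [map_mul, map_add, map_sub, hwd, hr1, hd1, map_pow, ev_C, h2] at hid'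
  rw [← hfc, ← hfk] at hid'
  have k1 := hder 1
  have k2 := hder 2
  rw [← hfc] at k2
  rw [← hfk] at k1
  set S := ev w (sb f b)
  set g := fk - Polynomial.C (2 * b) * fc with hgdef
  have hgd : g.natDegree + 1 ≤ f.totalDegree := by
    have := (Polynomial.natDegree_sub_le fk (Polynomial.C (2 * b) * fc))
    have h3 := Polynomial.natDegree_C_mul_le (2 * b) fc
    have : g.natDegree ≤ max fk.natDegree fc.natDegree := this.trans (max_le_max le_rfl h3)
    omega
  set D := Polynomial.derivative (R := K) with hD
  have hg' : D g = D fk - Polynomial.C (2 * b) * D fc := by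
    rw [hgdef, Polynomial.derivative_sub, Polynomial.derivative_C_mul]
  have hSg : S * g = 2 * fc ^ 3 * D g := by
    rw [hg', hgdef]
    simp only [Polynomial.C_mul] at hid' ⊢
    linear_combination hid'
  set Wr := fc * D fk - fk * D fc with hWr
  have hW' : D Wr = fc * D (D fk) - fk * D (D fc) := by
    rw [hWr, Polynomial.derivative_sub, Polynomial.derivative_mul, Polynomial.derivative_mul]
    ring
  have hode : g * D Wr = 2 * D g * Wr := by
    apply mul_left_cancel₀ (pow_ne_zero 3 hc)
    rw [hW']
    linear_combination (g * fc) * k1 - (g * fk) * k2 + Wr * hSg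
  have hWd : Wr.natDegree + 2 ≤ 2 * f.totalDegree := by
    have a1 : (fc * D fk).natDegree ≤ fc.natDegree + fk.natDegree :=
      Polynomial.natDegree_mul_le.trans (Nat.add_le_add_left ((Polynomial.natDegree_derivative_le _).trans (Nat.sub_le _ _)) _)
    have a2 : (fk * D fc).natDegree ≤ fk.natDegree + fc.natDegree :=
      Polynomial.natDegree_mul_le.trans (Nat.add_le_add_left ((Polynomial.natDegree_derivative_le _).trans (Nat.sub_le _ _)) _)
    have a3 := Polynomial.natDegree_sub_le (fc * D fk) (fk * D fc)
    rw [← hWr] at a3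
    omega
  have hg2 : (g ^ 2).natDegree ≤ 2 * g.natDegree := Polynomial.natDegree_pow_le
  obtain ⟨κ1, hκ1⟩ := proportional p Wr (g ^ 2) (pow_ne_zero 2 hg) (by omega) (by
    rw [← hD, Polynomial.derivative_pow]
    have hC2 : (Polynomial.C (2 : K)) = 2 := map_ofNat _ 2
    simp only [Nat.cast_ofNat, Nat.add_one_sub_one, pow_one, hC2]
    rw [← hD]
    linear_combination g * hode)
  have hPd : (fc + Polynomial.C κ1 * Polynomial.X * g).natDegree ≤ f.totalDegree := by
    refine (Polynomial.natDegree_add_le _ _).trans (max_le (by omega) ?_)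
    refine Polynomial.natDegree_mul_le.trans ?_
    have := (Polynomial.natDegree_C_mul_le κ1 Polynomial.X).trans Polynomial.natDegree_X_le
    omega
  obtain ⟨κ, hκ⟩ := proportional p (fc + Polynomial.C κ1 * Polynomial.X * g) g hg (by omega) (by
    simp only [Polynomial.derivative_add, Polynomial.derivative_mul, Polynomial.derivative_C, Polynomial.derivative_X]
    rw [← hD]
    have : Wr = fc * D g - g * D fc := by rw [hg', hWr, hgdef]; ring
    rw [this] at hκ1
    linear_combination -hκ1)
  refine ⟨-κ1, κ, ?_⟩
  simp only [Polynomial.C_neg]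
  linear_combination hκ

end single2

section general
variable {K : Type*} [Field K] [DecidableEq K]

open MvPolynomial

/-- lines of `U` in the zero set of `f` and meeting `w` -/
noncomputable def Zs (U : Finset (K × K × K)) (f : MvPolynomial (Fin 3) K) (w : K × K × K) :
    Finset (K × K × K) :=
  {u ∈ U | ev u f = 0 ∧ om u w = 0}

lemma mem_Zs {U : Finset (K × K × K)} {f : MvPolynomial (Fin 3) K} {w u : K × K × K} :
    u ∈ Zs U f w ↔ u ∈ U ∧ ev u f = 0 ∧ om u w = 0 := by
  simp [Zs]

/-- lines of `W` in the common zero set -/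
noncomputable def Ts (W : Finset (K × K × K)) (f G : MvPolynomial (Fin 3) K) : Finset (K × K × K) :=
  {w ∈ W | ev w f = 0 ∧ ev w G = 0}

lemma card_Ts (W : Finset (K × K × K)) (f G : MvPolynomial (Fin 3) K) (hf : Irreducible f) (hG : ¬ f ∣ G) :
    #(Ts W f G) ≤ f.totalDegree * G.totalDegree :=
  bezout f G hf hG _ (fun q hq => by simp only [Ts, mem_filter] at hq; exact hq.2)

/-- if `G` vanishes at all crossings and not on `w` -/
lemma count_poly {U W : Finset (K × K × K)} {L : ℕ} (h : Cfg U W L) {w : K × K × K} (hw : w ∈ W)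
    (S : Finset (K × K × K)) (hS : ∀ u ∈ S, u ∈ U ∧ om u w = 0) (G : MvPolynomial (Fin 3) K)
    (hG : ev w G ≠ 0) (hz : ∀ u ∈ S, (ev w G).eval (tau u w) = 0) : #S ≤ G.totalDegree :=
  (count_roots h hw S hS _ hG hz).trans (ev_natDegree _ _)

lemma single_pt (p : ℕ) [CharP K p] {U W : Finset (K × K × K)} {L : ℕ} (h : Cfg U W L)
    {f : MvPolynomial (Fin 3) K} (hp : 4 * f.totalDegree < p)
    (h0 : f ∣ r0 f) (h1 : f ∣ r1 f) (w : K × K × K) (hw : w ∈ W) (hwf : ev w f = 0)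
    (hc : ev w (pderiv 2 f) ≠ 0) (S : Finset (K × K × K)) (hS : S ⊆ Zs U f w)
    (hS2 : ∀ u ∈ S, (ev w (pderiv 2 f)).eval (tau u w) ≠ 0) : #S ≤ L := by
  have hgv : ∀ u ∈ S, (ev w (pderiv 1 f) - Polynomial.C (2 * w.2.1) * ev w (pderiv 2 f)).eval (tau u w)
      = (u.2.1 - w.2.1) * (ev w (pderiv 2 f)).eval (tau u w) := by
    intro u hu
    obtain ⟨huU, huf, huo⟩ := mem_Zs.mp (hS hu)
    have := (cross_vals (h.h4 u huU w hw) huo huf hwf).1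
    rw [Polynomial.eval_sub, Polynomial.eval_mul, Polynomial.eval_C, this]
    ring
  by_cases hg : ev w (pderiv 1 f) - Polynomial.C (2 * w.2.1) * ev w (pderiv 2 f) = 0
  · have : S = ∅ := by
      rw [eq_empty_iff_forall_notMem]
      intro u hu
      have h2 := hgv u hu
      rw [hg, Polynomial.eval_zero] at h2
      obtain ⟨huU, huf, huo⟩ := mem_Zs.mp (hS hu)
      exact mul_ne_zero (sub_ne_zero.mpr (h.h4 u huU w hw)) (hS2 u hu) h2.symm
    simp [this]
  · obtain ⟨l, k, hlk⟩ := ode_case p hp h0 h1 w hwf hc hg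
    have hone : ∀ u ∈ S, (l * tau u w + k) * (u.2.1 - w.2.1) = 1 := by
      intro u hu
      have h2 := hgv u hu
      have h3 := congrArg (Polynomial.eval (tau u w)) hlk
      rw [Polynomial.eval_mul, h2] at h3
      simp only [Polynomial.eval_add, Polynomial.eval_mul, Polynomial.eval_C, Polynomial.eval_X] at h3
      apply mul_right_cancel₀ (hS2 u hu)
      linear_combination -h3
    by_cases hl : l = 0
    · refine le_trans (card_le_card ?_) (h.h3 w hw (w.2.1 + k⁻¹))
      intro u hu
      obtain ⟨huU, huf, huo⟩ := mem_Zs.mp (hS hu)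
      rw [mem_filter]
      refine ⟨huU, ?_, huo⟩
      have h2 := hone u hu
      rw [hl, zero_mul, zero_add] at h2
      rw [← eq_inv_of_mul_eq_one_right h2]
      ring
    · refine le_trans ?_ h.h2
      refine card_le_card_of_injOn (fun u => u.2.1) ?_ ?_
      · intro u hu
        exact mem_coe.mpr (mem_image_of_mem _ (mem_Zs.mp (hS hu)).1)
      · intro u hu u' hu' hbb
        obtain ⟨huU, huf, huo⟩ := mem_Zs.mp (hS hu)
        obtain ⟨huU', huf', huo'⟩ := mem_Zs.mp (hS hu')
        have e1 := hone u hu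
        have e2 := hone u' hu'
        simp only at hbb
        rw [← hbb] at e2
        have hne := sub_ne_zero.mpr (h.h4 u huU w hw)
        have e3 := mul_right_cancel₀ hne (e1.trans e2.symm)
        have e4 := mul_left_cancel₀ hl (add_right_cancel e3)
        exact h.h1 u huU u' huU' (tau_inj u u' w (h.h4 u huU w hw) huo (h.h4 u' huU' w hw) huo' e4)

lemma single (p : ℕ) [CharP K p] {U W : Finset (K × K × K)} {L : ℕ} (h : Cfg U W L)
    {f : MvPolynomial (Fin 3) K} (hf : Irreducible f) (hp : 4 * f.totalDegree < p) :
    ∃ Bad ⊆ W, #Bad ≤ 5 * f.totalDegree ^ 2 ∧ ∀ w ∈ W, w ∉ Bad →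
      #(Zs U f w) ≤ 5 * f.totalDegree + (if ev w f = 0 then L else 0) := by
  set d := f.totalDegree with hd
  have hpos : 0 < d := irr_pos hf
  have hoff : ∀ w ∈ W, ev w f ≠ 0 → #(Zs U f w) ≤ d := by
    intro w hw hwf
    refine count_poly h hw _ (fun u hu => ?_) f hwf (fun u hu => ?_)
    · obtain ⟨a, b, c⟩ := mem_Zs.mp hu
      exact ⟨a, c⟩
    · obtain ⟨a, b, c⟩ := mem_Zs.mp hu
      rw [← eval_tau u w (h.h4 u a w hw) c, b, Polynomial.eval_zero]
  have hTsub : ∀ G, Ts W f G ⊆ W := fun G => filter_subset _ _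
  have hpd : ∀ i, (pderiv i f).totalDegree ≤ d := fun i => (pderiv_totalDegree i f).trans (by omega)
  by_cases hc : pderiv 2 f = 0
  · obtain ⟨i, hi⟩ : ∃ i, pderiv i f ≠ 0 := by
      by_contra hcon
      push Not at hcon
      have := pderiv_all_zero p f (by omega) hcon
      omega
    refine ⟨Ts W f (pderiv i f), hTsub _, ?_, ?_⟩
    · refine (card_Ts W f _ hf (not_dvd_pderiv hf i hi)).trans ?_
      have := Nat.mul_le_mul_left d (hpd i)
      nlinarith
    · intro w hw hwB
      by_cases hwf : ev w f = 0
      · have hwi : ev w (pderiv i f) ≠ 0 := by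
          intro h'
          exact hwB (mem_filter.mpr ⟨hw, hwf, h'⟩)
        have : #(Zs U f w) ≤ (pderiv i f).totalDegree := by
          refine count_poly h hw _ (fun u hu => ?_) _ hwi (fun u hu => ?_)
          · obtain ⟨a, b, c⟩ := mem_Zs.mp hu
            exact ⟨a, c⟩
          · obtain ⟨a, b, c⟩ := mem_Zs.mp hu
            obtain ⟨e1, e2⟩ := cross_vals (h.h4 u a w hw) c b hwf
            rw [hc] at e1 e2
            simp only [map_zero, Polynomial.eval_zero, mul_zero] at e1 e2
            fin_cases i
            · exact e2
            · exact e1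
            · exact absurd hc hi
        have := hpd i
        omega
      · have := hoff w hw hwf
        omega
  · have hcT := card_Ts W f _ hf (not_dvd_pderiv hf 2 hc)
    have hcT' : #(Ts W f (pderiv 2 f)) ≤ d ^ 2 := by
      refine hcT.trans ?_
      have := Nat.mul_le_mul_left d (hpd 2)
      nlinarith
    -- splitting a crossing set according to vanishing of the last partial derivative
    have hsplit : ∀ w ∈ W, ev w f = 0 → ev w (pderiv 2 f) ≠ 0 → ∀ M,
        #((Zs U f w).filter (fun u => ¬ (ev w (pderiv 2 f)).eval (tau u w) = 0)) ≤ M → #(Zs U f w) ≤ d + M := by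
      intro w hw hwf hwc M hM
      rw [← card_filter_add_card_filter_not (s := Zs U f w) (fun u => (ev w (pderiv 2 f)).eval (tau u w) = 0)]
      refine Nat.add_le_add ?_ hM
      refine le_trans ?_ (hpd 2)
      refine count_poly h hw _ (fun u hu => ?_) _ hwc (fun u hu => (mem_filter.mp hu).2)
      obtain ⟨a, b, c⟩ := mem_Zs.mp (mem_filter.mp hu).1
      exact ⟨a, c⟩
    by_cases hdiv : f ∣ r0 f ∧ f ∣ r1 f
    · refine ⟨Ts W f (pderiv 2 f), hTsub _, by nlinarith, ?_⟩
      intro w hw hwB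
      by_cases hwf : ev w f = 0
      · have hwi : ev w (pderiv 2 f) ≠ 0 := by
          intro h'
          exact hwB (mem_filter.mpr ⟨hw, hwf, h'⟩)
        rw [if_pos hwf]
        refine (hsplit w hw hwf hwi L ?_).trans (by omega)
        exact single_pt p h hp hdiv.1 hdiv.2 w hw hwf hwi _ (filter_subset _ _)
          (fun u hu => (mem_filter.mp hu).2)
      · have := hoff w hw hwf
        omega
    · obtain ⟨r, hr, hrd, hrz⟩ : ∃ r, ¬ f ∣ r ∧ r.totalDegree ≤ 4 * d ∧
          ∀ u w : K × K × K, u.2.1 ≠ w.2.1 → om u w = 0 → ev u f = 0 → ev w f = 0 →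
            (ev w r).eval (tau u w) = 0 := by
        by_cases h0 : f ∣ r0 f
        · exact ⟨r1 f, fun h1 => hdiv ⟨h0, h1⟩, (r_deg f).2, fun u w a b c e => (cross_r a b c e).2⟩
        · exact ⟨r0 f, h0, (r_deg f).1, fun u w a b c e => (cross_r a b c e).1⟩
      have hrT := card_Ts W f r hf hr
      refine ⟨Ts W f r, hTsub _, ?_, ?_⟩
      · have := Nat.mul_le_mul_left d hrd
        nlinarith
      intro w hw hwB
      by_cases hwf : ev w f = 0
      · have hwi : ev w r ≠ 0 := by
          intro h'
          exact hwB (mem_filter.mpr ⟨hw, hwf, h'⟩)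
        have : #(Zs U f w) ≤ r.totalDegree := by
          refine count_poly h hw _ (fun u hu => ?_) _ hwi (fun u hu => ?_)
          · obtain ⟨a, b, c⟩ := mem_Zs.mp hu
            exact ⟨a, c⟩
          · obtain ⟨a, b, c⟩ := mem_Zs.mp hu
            exact hrz u w (h.h4 u a w hw) c b hwf
        omega
      · have := hoff w hw hwf
        omega

lemma general (p : ℕ) [CharP K p] {U W : Finset (K × K × K)} {L : ℕ} (h : Cfg U W L)
    (F : MvPolynomial (Fin 3) K) : F ≠ 0 → 4 * F.totalDegree < p →
    ∃ Bad ⊆ W, #Bad ≤ 5 * F.totalDegree ^ 2 ∧ ∀ w ∈ W, w ∉ Bad →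
      #(Zs U F w) ≤ 5 * F.totalDegree + (if ev w F = 0 then L else 0) := by
  induction F using WfDvdMonoid.induction_on_irreducible with
  | zero => exact fun h => absurd rfl h
  | unit u hu =>
    intro _ _
    refine ⟨∅, by simp, by simp, fun w _ _ => ?_⟩
    have : Zs U u w = ∅ := by
      rw [eq_empty_iff_forall_notMem]
      intro x hx
      exact (hu.map (ev x)).ne_zero (mem_Zs.mp hx).2.1
    simp [this]
  | mul a i ha hi ih =>
    intro _ hp
    have hi0 := hi.ne_zero
    rw [totalDegree_mul_of_isDomain hi0 ha] at hp ⊢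
    obtain ⟨B1, hB1, hB1c, hB1w⟩ := single p h hi (by omega)
    obtain ⟨B2, hB2, hB2c, hB2w⟩ := ih ha (by omega)
    by_cases hdiv : i ∣ a
    · have hz : ∀ q, ev q (i * a) = 0 ↔ ev q a = 0 := by
        intro q
        rw [map_mul, mul_eq_zero, or_iff_right_iff_imp]
        intro h'
        obtain ⟨t, ht⟩ := hdiv
        rw [ht, map_mul, h', zero_mul]
      refine ⟨B2, hB2, hB2c.trans ?_, fun w hw hwB => ?_⟩
      · gcongr; omega
      · have h1 : Zs U (i * a) w = Zs U a w := by
          ext u; simp only [mem_Zs, hz]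
        have h2 := hB2w w hw hwB
        simp only [hz, h1]
        omega
    · have hT := card_Ts W i a hi hdiv
      refine ⟨B1 ∪ B2 ∪ Ts W i a, ?_, ?_, fun w hw hwB => ?_⟩
      · exact union_subset (union_subset hB1 hB2) (filter_subset _ _)
      · refine (card_union_le _ _).trans ?_
        have := card_union_le B1 B2
        nlinarith
      · simp only [mem_union, not_or] at hwB
        have h1 := hB1w w hw hwB.1.1
        have h2 := hB2w w hw hwB.1.2
        have h3 : ¬ (ev w i = 0 ∧ ev w a = 0) := fun h' => hwB.2 (mem_filter.mpr ⟨hw, h'⟩)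
        have h4 : Zs U (i * a) w ⊆ Zs U i w ∪ Zs U a w := by
          intro u hu
          rw [mem_union, mem_Zs, mem_Zs]
          obtain ⟨x, y, z⟩ := mem_Zs.mp hu
          rw [map_mul, mul_eq_zero] at y
          exact y.elim (fun y => Or.inl ⟨x, y, z⟩) (fun y => Or.inr ⟨x, y, z⟩)
        have h5 := (card_le_card h4).trans (card_union_le _ _)
        have h6 : ev w (i * a) = 0 ↔ ev w i = 0 ∨ ev w a = 0 := by rw [map_mul, mul_eq_zero]
        simp only [h6]
        by_cases e1 : ev w i = 0 <;> by_cases e2 : ev w a = 0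
        · exact absurd ⟨e1, e2⟩ h3
        all_goals simp only [e1, e2, if_true, if_false, or_true, true_or, or_self] at h1 h2 ⊢; omega

lemma exists_F (U : Finset (K × K × K)) (s : ℕ) (hs : 0 < s) (hU : #U ≤ s ^ 2) :
    ∃ F : MvPolynomial (Fin 3) K, F ≠ 0 ∧ F.totalDegree ≤ 3 * s ∧ ∀ u ∈ U, ev u F = 0 := by
  let V := restrictTotalDegree (Fin 3) K (3 * s)
  let Φ : V →ₗ[K] (U × Fin (3 * s + 1) → K) := LinearMap.pi fun ui =>
    Polynomial.lcoeff K (ui.2 : ℕ) ∘ₗ (ev (ui.1 : K × K × K)).toLinearMap ∘ₗ V.subtype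
  have hlt : Module.finrank K (U × Fin (3 * s + 1) → K) < Module.finrank K V := by
    rw [finrank_rtd, Module.finrank_fintype_fun_eq_card]
    simp only [Fintype.card_prod, Fintype.card_coe, Fintype.card_fin]
    have h1 := choose3 (3 * s)
    push_cast at h1
    have h2 : (#U : ℤ) ≤ s ^ 2 := by exact_mod_cast hU
    zify
    have h3 : (0 : ℤ) < s := by exact_mod_cast hs
    have h4 : (#U : ℤ) * (3 * s + 1) ≤ s ^ 2 * (3 * s + 1) := by gcongr
    nlinarith
  obtain ⟨F, hF, hF0⟩ := Submodule.exists_mem_ne_zero_of_ne_bot (LinearMap.ker_ne_bot_of_finrank_lt hlt (f := Φ))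
  refine ⟨F, fun h' => hF0 (Subtype.ext h'), (mem_restrictTotalDegree _ _ _).mp F.2, fun u hu => ?_⟩
  rw [LinearMap.mem_ker] at hF
  ext j
  by_cases hj : j < 3 * s + 1
  · have := congrFun hF (⟨u, hu⟩, ⟨j, hj⟩)
    simpa [Φ] using this
  · rw [Polynomial.coeff_zero]
    apply Polynomial.coeff_eq_zero_of_natDegree_lt
    have h1 := ev_natDegree u (F : MvPolynomial (Fin 3) K)
    have h2 := (mem_restrictTotalDegree _ _ _).mp F.2
    omega

/-- key lemma -/
lemma key (p : ℕ) [CharP K p] {U W : Finset (K × K × K)} {L : ℕ} (h : Cfg U W L)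
    (s : ℕ) (hs : 0 < s) (hU : #U ≤ s ^ 2) (hp : 12 * s < p) :
    ∃ Bad ⊆ W, #Bad ≤ 45 * s ^ 2 ∧ ∀ w ∈ W, w ∉ Bad → #{u ∈ U | om u w = 0} ≤ 15 * s + L := by
  obtain ⟨F, hF, hd, hFU⟩ := exists_F U s hs hU
  obtain ⟨Bad, hB, hBc, hBw⟩ := general p h F hF (by omega)
  refine ⟨Bad, hB, ?_, fun w hw hwB => ?_⟩
  · have : F.totalDegree ^ 2 ≤ (3 * s) ^ 2 := by gcongr
    nlinarith
  · have h1 := hBw w hw hwB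
    have h2 : Zs U F w = {u ∈ U | om u w = 0} := by
      ext u
      rw [mem_Zs, mem_filter]
      exact ⟨fun h => ⟨h.1, h.2.2⟩, fun h => ⟨h.1, hFU u h.1, h.2⟩⟩
    rw [h2] at h1
    split_ifs at h1 <;> omega

end general

section recursion
variable {K : Type*} [Field K] [DecidableEq K]

/-- number of crossings -/
def In (U W : Finset (K × K × K)) : ℕ := ∑ w ∈ W, #{u ∈ U | om u w = 0}

lemma In_trivial (U W : Finset (K × K × K)) : In U W ≤ #U * #W := by
  unfold In
  refine (sum_le_card_nsmul W _ #U (fun w _ => card_filter_le _ _)).trans ?_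
  simp [mul_comm]

lemma In_sdiff (U U' W : Finset (K × K × K)) (h : U' ⊆ U) : In U W = In U' W + In (U \ U') W := by
  unfold In
  rw [← sum_add_distrib]
  refine sum_congr rfl fun w _ => ?_
  rw [← card_union_of_disjoint]
  · rw [← filter_union, union_sdiff_of_subset h]
  · exact disjoint_filter_filter disjoint_sdiff

lemma In_split (W : Finset (K × K × K)) (m : ℕ) (M : ℝ) (hM : 0 ≤ M) (k : ℕ) :
    ∀ U : Finset (K × K × K), (∀ U' ⊆ U, #U' ≤ m → (In U' W : ℝ) ≤ M) → #U ≤ k * m →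
      (In U W : ℝ) ≤ k * M := by
  induction k with
  | zero =>
    intro U _ hU
    have : U = ∅ := by rw [← card_eq_zero]; omega
    simp [this, In]
  | succ k ih =>
    intro U h hU
    obtain ⟨U', hU', hc⟩ := exists_subset_card_eq (s := U) (n := min m #U) (min_le_right _ _)
    rw [In_sdiff U U' W hU']
    have h1 := h U' hU' (by omega)
    have h2 := ih (U \ U') (fun V hV => h V (hV.trans sdiff_subset)) (by
      rw [card_sdiff_of_subset hU', hc]
      have : (k + 1) * m = k * m + m := by ring
      omega)
    push_cast
    linarith

lemma In_step (p : ℕ) [CharP K p] {U W : Finset (K × K × K)} {L : ℕ} (h : Cfg U W L)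
    (s : ℕ) (hs : 0 < s) (hU : #U ≤ s ^ 2) (hp : 12 * s < p) :
    ∃ Bad ⊆ W, #Bad ≤ 45 * s ^ 2 ∧ In U W ≤ #W * (15 * s + L) + In U Bad := by
  obtain ⟨Bad, hB, hBc, hBw⟩ := key p h s hs hU hp
  refine ⟨Bad, hB, hBc, ?_⟩
  unfold In
  rw [← sum_sdiff hB]
  refine Nat.add_le_add_right ?_ _
  refine (sum_le_card_nsmul (W \ Bad) _ (15 * s + L) (fun w hw => ?_)).trans ?_
  · rw [mem_sdiff] at hw
    exact hBw w hw.1 hw.2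
  · rw [smul_eq_mul]
    exact Nat.mul_le_mul_right _ (card_le_card sdiff_subset)

lemma In_rec (p : ℕ) [CharP K p] (L : ℕ) (l : ℝ) (hl : 0 ≤ l) (hL : (L : ℝ) ≤ l ^ 4)
    (r : ℝ) (hr : r = 392) (κ : ℕ) (hκ : (κ : ℝ) = 14 * r ^ 2) (j : ℕ) :
    ∀ (y : ℝ), 0 ≤ y → y ≤ r ^ j → 24 * y ^ 2 < p → ∀ U W : Finset (K × K × K), Cfg U W L →
      (#U : ℝ) ≤ y ^ 4 → (#W : ℝ) ≤ y ^ 4 → (In U W : ℝ) ≤ 2 * κ ^ 2 * (y ^ 6 + l ^ 3 * y ^ 5) := by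
  have hκ1 : (30 : ℝ) ≤ κ := by rw [hκ, hr]; norm_num
  have htriv : ∀ (y : ℝ), 0 ≤ y → (y ^ 2 ≤ κ ∨ y ≤ l) → ∀ U W : Finset (K × K × K),
      (#U : ℝ) ≤ y ^ 4 → (#W : ℝ) ≤ y ^ 4 → (In U W : ℝ) ≤ 2 * κ ^ 2 * (y ^ 6 + l ^ 3 * y ^ 5) := by
    intro y hy hor U W hU hW
    have h1 : (In U W : ℝ) ≤ #U * #W := by exact_mod_cast In_trivial U W
    have h2 : (#U : ℝ) * #W ≤ y ^ 4 * y ^ 4 := by gcongr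
    have hk2 : (κ : ℝ) ≤ 2 * κ ^ 2 := by nlinarith
    have hk3 : (1 : ℝ) ≤ 2 * κ ^ 2 := by nlinarith
    have hA : 0 ≤ y ^ 6 := by positivity
    have hB : 0 ≤ l ^ 3 * y ^ 5 := by positivity
    rcases hor with h | h
    · calc (In U W : ℝ) ≤ y ^ 2 * y ^ 6 := by linarith [h1, h2, (by ring : y ^ 4 * y ^ 4 = y ^ 2 * y ^ 6)]
        _ ≤ κ * y ^ 6 := by gcongr
        _ ≤ 2 * κ ^ 2 * y ^ 6 := by gcongr
        _ ≤ _ := by gcongr; linarith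
    · have h3 : y ^ 3 ≤ l ^ 3 := by gcongr
      calc (In U W : ℝ) ≤ y ^ 3 * y ^ 5 := by linarith [h1, h2, (by ring : y ^ 4 * y ^ 4 = y ^ 3 * y ^ 5)]
        _ ≤ l ^ 3 * y ^ 5 := by gcongr
        _ ≤ 2 * κ ^ 2 * (l ^ 3 * y ^ 5) := by nlinarith
        _ ≤ _ := by gcongr; linarith
  induction j with
  | zero =>
    intro y hy hy1 _ U W _ hU hW
    refine htriv y hy (Or.inl ?_) U W hU hW
    rw [pow_zero] at hy1
    nlinarith
  | succ j ih =>
    intro y hy hyr hp U W hcfg hU hW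
    by_cases hor : y ^ 2 ≤ κ ∨ y ≤ l
    · exact htriv y hy hor U W hU hW
    push Not at hor
    obtain ⟨hyκ, hyl⟩ := hor
    have hr0 : 0 < r := by rw [hr]; norm_num
    have hκ0 : (0 : ℝ) < κ := by linarith
    set s := ⌈y ^ 2 / κ⌉₊ with hs
    have hs1 : y ^ 2 / κ ≤ s := Nat.le_ceil _
    have hs2 : (s : ℝ) ≤ 2 * (y ^ 2 / κ) := by
      have h1 := Nat.ceil_lt_add_one (a := y ^ 2 / κ) (by positivity)
      have h2 : 1 ≤ y ^ 2 / κ := by rw [le_div_iff₀ hκ0]; linarith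
      linarith
    have hs0 : 0 < s := by
      rw [hs, Nat.ceil_pos]
      have : 1 ≤ y ^ 2 / κ := by rw [le_div_iff₀ hκ0]; linarith
      linarith
    have hsp : 12 * s < p := by
      have h1 : y ^ 2 / κ ≤ y ^ 2 := div_le_self (by positivity) (by linarith)
      have : (12 * s : ℝ) < p := by linarith
      exact_mod_cast this
    have hss : (s : ℝ) ^ 2 ≤ 4 * y ^ 4 / κ ^ 2 := by
      calc (s : ℝ) ^ 2 ≤ (2 * (y ^ 2 / κ)) ^ 2 := by gcongr
        _ = _ := by field_simp; ring
    have hz : 45 * (4 * y ^ 4 / κ ^ 2) ≤ (y / r) ^ 4 := by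
      rw [hκ, div_pow]
      have : 45 * (4 * y ^ 4 / (14 * r ^ 2) ^ 2) = (180 / 196) * (y ^ 4 / r ^ 4) := by
        field_simp; ring
      rw [this]
      have : 0 ≤ y ^ 4 / r ^ 4 := by positivity
      linarith
    have hrec0 : 0 ≤ y / r := by positivity
    set M : ℝ := y ^ 4 * (30 * (y ^ 2 / κ) + l ^ 4) + 2 * κ ^ 2 * ((y / r) ^ 6 + l ^ 3 * (y / r) ^ 5) with hM
    have hM0 : 0 ≤ M := by positivity
    have hpart : ∀ U' ⊆ U, #U' ≤ s ^ 2 → (In U' W : ℝ) ≤ M := by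
      intro U' hU' hc
      obtain ⟨Bad, hB, hBc, hI⟩ := In_step p (hcfg.mono hU' subset_rfl) s hs0 hc hsp
      have hI' : (In U' W : ℝ) ≤ #W * (15 * s + L) + In U' Bad := by exact_mod_cast hI
      have hBc' : (#Bad : ℝ) ≤ 45 * s ^ 2 := by exact_mod_cast hBc
      have hc' : (#U' : ℝ) ≤ s ^ 2 := by exact_mod_cast hc
      have h1 := ih (y / r) hrec0 (by
          rw [div_le_iff₀ hr0, ← pow_succ]; exact hyr) (by
          have : y / r ≤ y := div_le_self hy (by rw [hr]; norm_num)
          have : (y / r) ^ 2 ≤ y ^ 2 := by gcongr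
          linarith) U' Bad (hcfg.mono hU' hB) (by
          have : 0 ≤ (s : ℝ) ^ 2 := by positivity
          linarith) (by linarith)
      have h2 : (#W : ℝ) * (15 * s + L) ≤ y ^ 4 * (30 * (y ^ 2 / κ) + l ^ 4) := by
        have : (15 * s + L : ℝ) ≤ 30 * (y ^ 2 / κ) + l ^ 4 := by linarith
        gcongr
      linarith
    have hfin := In_split W (s ^ 2) M hM0 (κ ^ 2) U hpart (by
      have : (#U : ℝ) ≤ κ ^ 2 * s ^ 2 := by
        calc (#U : ℝ) ≤ y ^ 4 := hU
          _ = κ ^ 2 * (y ^ 2 / κ) ^ 2 := by field_simp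
          _ ≤ _ := by gcongr
      exact_mod_cast this)
    refine hfin.trans ?_
    push_cast
    rw [hM]
    have e1 : (κ : ℝ) ^ 2 * (y ^ 4 * (30 * (y ^ 2 / κ) + l ^ 4)) ≤ κ ^ 2 * (y ^ 6 + l ^ 3 * y ^ 5) := by
      have a1 : (κ : ℝ) ^ 2 * (y ^ 4 * (30 * (y ^ 2 / κ) + l ^ 4)) = 30 * κ * y ^ 6 + κ ^ 2 * (l ^ 3 * y ^ 4 * l) := by
        field_simp
      have a2 : l ^ 3 * y ^ 4 * l ≤ l ^ 3 * y ^ 4 * y := by gcongr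
      have a3 : 30 * (κ : ℝ) * y ^ 6 ≤ κ * κ * y ^ 6 := by gcongr
      have a4 : (κ : ℝ) ^ 2 * (l ^ 3 * y ^ 4 * l) ≤ κ ^ 2 * (l ^ 3 * y ^ 4 * y) := by gcongr
      rw [a1]
      linarith [(by ring : (κ : ℝ) ^ 2 * (y ^ 6 + l ^ 3 * y ^ 5) = κ * κ * y ^ 6 + κ ^ 2 * (l ^ 3 * y ^ 4 * y))]
    have e2 : (κ : ℝ) ^ 2 * ((y / r) ^ 6 + l ^ 3 * (y / r) ^ 5) ≤ (1 / 2) * (y ^ 6 + l ^ 3 * y ^ 5) := by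
      rw [hκ, hr, div_pow, div_pow]
      have hA : 0 ≤ y ^ 6 := by positivity
      have hB : 0 ≤ l ^ 3 * y ^ 5 := by positivity
      norm_num
      linarith
    have e3 : (2 * (κ : ℝ) ^ 2) * (κ ^ 2 * ((y / r) ^ 6 + l ^ 3 * (y / r) ^ 5))
        ≤ (2 * κ ^ 2) * ((1 / 2) * (y ^ 6 + l ^ 3 * y ^ 5)) := by gcongr
    linarith

lemma In_bound : ∃ C : ℝ, 0 < C ∧ ∀ (K : Type) [Field K] [DecidableEq K] (p : ℕ) [CharP K p] (L : ℕ)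
    (l y : ℝ) (U W : Finset (K × K × K)), 0 ≤ l → (L : ℝ) ≤ l ^ 4 → 0 ≤ y → 24 * y ^ 2 < p → Cfg U W L →
      (#U : ℝ) ≤ y ^ 4 → (#W : ℝ) ≤ y ^ 4 → (In U W : ℝ) ≤ C * (y ^ 6 + l ^ 3 * y ^ 5) := by
  obtain ⟨r, hr⟩ : ∃ r : ℝ, r = 392 := ⟨_, rfl⟩
  obtain ⟨κ, hκ⟩ : ∃ κ : ℕ, (κ : ℝ) = 14 * r ^ 2 := ⟨14 * 392 ^ 2, by rw [hr]; norm_num⟩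
  refine ⟨2 * κ ^ 2, ?_, ?_⟩
  · rw [hκ, hr]; norm_num
  · intro K _ _ p _ L l y U W hl hL hy hp hcfg hU hW
    obtain ⟨j, hj⟩ := pow_unbounded_of_one_lt y (show (1 : ℝ) < r by rw [hr]; norm_num)
    exact In_rec p L l hl hL r hr κ hκ j y hy hj.le hp U W hcfg hU hW

end recursion

section final

lemma exists_field (p : ℕ) [Fact p.Prime] : ∃ (K : Type) (_ : Field K) (_ : CharP K p) (i : ZMod p →+* K)
    (s t : K), ∀ a b c : ZMod p, i a + s * i b + t * i c = 0 → a = 0 ∧ b = 0 ∧ c = 0 := by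
  let P := Polynomial (ZMod p)
  let K := FractionRing P
  have hinj : Function.Injective (algebraMap P K) := IsFractionRing.injective P K
  have hch : CharP K p := charP_of_injective_algebraMap hinj p
  refine ⟨K, inferInstance, hch, (algebraMap P K).comp Polynomial.C, algebraMap P K Polynomial.X,
    algebraMap P K (Polynomial.X ^ 2), ?_⟩
  intro a b c h
  have h1 : algebraMap P K (Polynomial.C a + Polynomial.X * Polynomial.C b + Polynomial.X ^ 2 * Polynomial.C c)
      = algebraMap P K 0 := by
    rw [map_zero, ← h]
    simp only [map_add, map_mul, RingHom.comp_apply]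
  have h2 : (Polynomial.C a + Polynomial.X * Polynomial.C b + Polynomial.X ^ 2 * Polynomial.C c
      : Polynomial (ZMod p)) = 0 := hinj h1
  clear h1 h hinj hch
  have k0 := congrArg (Polynomial.coeff · 0) h2
  have k1 := congrArg (Polynomial.coeff · 1) h2
  have k2 := congrArg (Polynomial.coeff · 2) h2
  simp [Polynomial.coeff_X, Polynomial.coeff_X_pow, Polynomial.coeff_C] at k0 k1 k2
  exact ⟨k0, k1, k2⟩

lemma poly_form {F : Type*} [Field F] (g : MvPolynomial (Fin 2) F) (hd : g.totalDegree = 2)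
    (hc : MvPolynomial.coeff (Finsupp.single 0 1 + Finsupp.single 1 1) g ≠ 0) :
    ∃ (β : F) (φ ψ : F → F), β ≠ 0 ∧ ∀ a b, MvPolynomial.eval ![a, b] g = β * a * b + φ a + ψ b := by
  classical
  set e : Fin 2 →₀ ℕ := Finsupp.single 0 1 + Finsupp.single 1 1 with he
  refine ⟨g.coeff e, fun a => ∑ n ∈ g.support, if n 1 = 0 then g.coeff n * a ^ (n 0) else 0,
    fun b => ∑ n ∈ g.support, if n 0 = 0 ∧ n 1 ≠ 0 then g.coeff n * b ^ (n 1) else 0, hc, ?_⟩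
  intro a b
  rw [MvPolynomial.eval_eq']
  have h1 : g.coeff e * a * b = ∑ n ∈ g.support, if n = e then g.coeff e * a * b else 0 := by
    rw [Finset.sum_ite_eq', if_pos (MvPolynomial.mem_support_iff.mpr hc)]
  rw [h1, ← sum_add_distrib, ← sum_add_distrib]
  refine sum_congr rfl fun n hn => ?_
  have h2 := MvPolynomial.le_totalDegree hn
  rw [hd, Finsupp.sum_fintype _ _ (by simp), Fin.sum_univ_two] at h2
  rw [Fin.prod_univ_two]
  simp only [Matrix.cons_val_zero, Matrix.cons_val_one]
  have e0 : e 0 = 1 := by simp [he]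
  have e1 : e 1 = 1 := by simp [he]
  by_cases h3 : n 1 = 0
  · have hne : n ≠ e := by rintro rfl; omega
    simp [h3, hne]
  · by_cases h4 : n 0 = 0
    · have hne : n ≠ e := by rintro rfl; omega
      simp [h3, h4, hne]
    · have h5 : n = e := by
        ext i
        fin_cases i
        · simp only [Fin.zero_eta]; omega
        · simp only [Fin.mk_one]; omega
      rw [h5]
      simp [e0, e1, mul_assoc]

lemma energy_cs {α β : Type*} [DecidableEq β] (D : Finset α) (f : α → β) :
    #D ^ 2 ≤ #(D.image f) * #{q ∈ D ×ˢ D | f q.1 = f q.2} := by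
  have h1 : #D = ∑ b ∈ D.image f, #{a ∈ D | f a = b} := card_eq_sum_card_image f D
  have h2 : #{q ∈ D ×ˢ D | f q.1 = f q.2} = ∑ b ∈ D.image f, #{a ∈ D | f a = b} ^ 2 := by
    rw [card_filter, sum_product]
    have := Finset.sum_comp (s := D) (fun b => #{a ∈ D | b = f a}) f
    simp only [card_filter] at this
    rw [this]
    refine sum_congr rfl fun b _ => ?_
    rw [← card_filter, ← card_filter, smul_eq_mul, sq]
    simp only [eq_comm]
  rw [h2]
  calc #D ^ 2 = (∑ b ∈ D.image f, #{a ∈ D | f a = b}) ^ 2 := by rw [← h1]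
    _ ≤ _ := sq_sum_le_card_mul_sum_sq

lemma energy_le (p : ℕ) [Fact p.Prime] (β : ZMod p) (hβ : β ≠ 0) (φ ψ : ZMod p → ZMod p)
    (A X : Finset (ZMod p)) {K : Type} [Field K] [DecidableEq K] (i : ZMod p →+* K) (s t : K)
    (hst : ∀ a b c : ZMod p, i a + s * i b + t * i c = 0 → a = 0 ∧ b = 0 ∧ c = 0) :
    ∃ U W : Finset (K × K × K), #U ≤ #A ^ 2 * #X ∧ #W ≤ #A ^ 2 * #X ∧ Cfg U W #A ∧
      #{q ∈ ((A ×ˢ A) ×ˢ X) ×ˢ ((A ×ˢ A) ×ˢ X) | (β * q.1.1.1 * q.1.1.2 + φ q.1.1.1 + ψ q.1.1.2) + q.1.2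
        = (β * q.2.1.1 * q.2.1.2 + φ q.2.1.1 + ψ q.2.1.2) + q.2.2} ≤ In U W := by
  have hi : Function.Injective i := i.injective
  set D := (A ×ˢ A) ×ˢ X with hD
  have hDc : #D = #A ^ 2 * #X := by rw [hD, card_product, card_product, sq]
  let uf : (ZMod p × ZMod p) × ZMod p → K × K × K := fun q =>
    (i (β * q.1.1) + s, i q.1.2 + t, i (q.2 + φ q.1.1 - ψ q.1.2))
  let wf : (ZMod p × ZMod p) × ZMod p → K × K × K := fun q =>
    (i (β * q.1.1), i q.1.2, i (q.2 + φ q.1.1 - ψ q.1.2) + s * i q.1.2 - t * i (β * q.1.1))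
  have huf : Function.Injective uf := by
    rintro ⟨⟨a, b⟩, x⟩ ⟨⟨a', b'⟩, x'⟩ h
    simp only [uf, Prod.mk.injEq] at h
    obtain ⟨h1, h2, h3⟩ := h
    have h1' := mul_left_cancel₀ hβ (hi (add_right_cancel h1))
    have h2' := hi (add_right_cancel h2)
    subst h1' h2'
    have h3' := hi h3
    have : x = x' := by linear_combination h3'
    rw [this]
  have hwf : Function.Injective wf := by
    rintro ⟨⟨a, b⟩, x⟩ ⟨⟨a', b'⟩, x'⟩ h
    simp only [wf, Prod.mk.injEq] at h
    obtain ⟨h1, h2, h3⟩ := h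
    have h1' := mul_left_cancel₀ hβ (hi h1)
    have h2' := hi h2
    subst h1' h2'
    have h3' := hi (add_right_cancel (sub_left_injective h3))
    have : x = x' := by linear_combination h3'
    rw [this]
  refine ⟨D.image uf, D.image wf, card_image_le.trans hDc.le, card_image_le.trans hDc.le, ?_, ?_⟩
  · constructor
    · intro u hu u' hu' ho
      obtain ⟨⟨⟨a, b⟩, x⟩, _, rfl⟩ := mem_image.mp hu
      obtain ⟨⟨⟨a', b'⟩, x'⟩, _, rfl⟩ := mem_image.mp hu'
      simp only [uf, om] at ho
      obtain ⟨k0, k1, k2⟩ := hst ((x + φ a - ψ b) - (x' + φ a' - ψ b') + β * a * b' - b * (β * a')) (b' - b)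
        (β * a - β * a') (by
          simp only [map_add, map_sub, map_mul] at ho ⊢
          linear_combination ho)
      have hb : b' = b := sub_eq_zero.mp k1
      have ha : a = a' := mul_left_cancel₀ hβ (sub_eq_zero.mp k2)
      subst hb ha
      have hx : x = x' := by linear_combination k0
      rw [hx]
    · refine (card_le_card (t := A.image (fun b => i b + t)) ?_).trans card_image_le
      intro b hb
      obtain ⟨u, hu, rfl⟩ := mem_image.mp hb
      obtain ⟨⟨⟨a, b⟩, x⟩, hq, rfl⟩ := mem_image.mp hu
      simp only [hD, mem_product] at hq
      exact mem_image.mpr ⟨b, hq.1.2, rfl⟩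
    · intro w _ b
      refine le_trans ?_ (card_image_le (s := A) (f := fun a => i (β * a) + s))
      refine card_le_card_of_injOn (fun u => u.1) ?_ ?_
      · intro u hu
        obtain ⟨⟨⟨a, b⟩, x⟩, hq, rfl⟩ := mem_image.mp (mem_filter.mp hu).1
        simp only [hD, mem_product] at hq
        exact mem_coe.mpr (mem_image.mpr ⟨a, hq.1.1, rfl⟩)
      · intro u hu u' hu' h
        have k1 := (mem_filter.mp hu).2
        have k2 := (mem_filter.mp hu').2
        simp only at h
        have hb : u.2.1 = u'.2.1 := k1.1.trans k2.1.symm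
        have hx : u.2.2 = u'.2.2 := by
          have e1 := k1.2
          have e2 := k2.2
          unfold om at e1 e2
          rw [h, hb] at e1
          linear_combination e1 - e2
        exact Prod.ext h (Prod.ext hb hx)
    · intro u hu w hw h
      obtain ⟨⟨⟨a, b⟩, x⟩, _, rfl⟩ := mem_image.mp hu
      obtain ⟨⟨⟨a', b'⟩, x'⟩, _, rfl⟩ := mem_image.mp hw
      simp only [uf, wf] at h
      have := (hst (b - b') 0 1 (by
        simp only [map_sub, map_zero, map_one]
        linear_combination h)).2.2
      exact one_ne_zero this
  · have hIn : In (D.image uf) (D.image wf) = #{z ∈ (D.image wf) ×ˢ (D.image uf) | om z.2 z.1 = 0} := by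
      rw [card_filter, sum_product]
      simp only [← card_filter]
      rfl
    rw [hIn]
    refine card_le_card_of_injOn (fun q => (wf ((q.2.1.1, q.1.1.2), q.2.2), uf ((q.1.1.1, q.2.1.2), q.1.2))) ?_ ?_
    · rintro ⟨⟨⟨a, b⟩, x⟩, ⟨⟨a', b'⟩, x'⟩⟩ hq
      obtain ⟨hq1, hq2⟩ := mem_filter.mp hq
      simp only [hD, mem_product] at hq1
      simp only at hq2
      apply mem_coe.mpr
      rw [mem_filter, mem_product]
      refine ⟨⟨mem_image_of_mem _ ?_, mem_image_of_mem _ ?_⟩, ?_⟩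
      · simp only [hD, mem_product]
        exact ⟨⟨hq1.2.1.1, hq1.1.1.2⟩, hq1.2.2⟩
      · simp only [hD, mem_product]
        exact ⟨⟨hq1.1.1.1, hq1.2.1.2⟩, hq1.1.2⟩
      · have h2 := congrArg i hq2
        simp only [om, uf, wf]
        simp only [map_add, map_sub, map_mul] at h2 ⊢
        linear_combination h2
    · rintro ⟨⟨⟨a, b⟩, x⟩, ⟨⟨a', b'⟩, x'⟩⟩ _ ⟨⟨⟨c, d⟩, z⟩, ⟨⟨c', d'⟩, z'⟩⟩ _ h
      simp only [Prod.mk.injEq] at h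
      have k1 := hwf h.1
      have k2 := huf h.2
      simp only [Prod.mk.injEq] at k1 k2 ⊢
      exact ⟨⟨⟨k2.1.1, k1.1.2⟩, k2.2⟩, ⟨⟨k1.1.1, k2.1.2⟩, k1.2⟩⟩

/-- the set in question -/
def SS {F : Type*} [Field F] [DecidableEq F] (h : F → F → F) (A X : Finset F) : Finset F :=
  ((A ×ˢ A) ×ˢ X).image (fun q => h q.1.1 q.1.2 + q.2)

lemma arith_ly (a x : ℕ) (ha : 0 < a) (hax : a ≤ x) : ∃ l y : ℝ, 0 ≤ l ∧ 0 < y ∧ l ^ 4 = a ∧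
    y ^ 2 = a * √(x : ℝ) ∧ y ^ 4 = (a : ℝ) ^ 2 * x ∧ l ^ 3 ≤ y := by
  have h1 : (0 : ℝ) < a := by exact_mod_cast ha
  have hx : (0 : ℝ) < x := by exact_mod_cast (lt_of_lt_of_le ha hax)
  have h2 : (0 : ℝ) < √(x : ℝ) := Real.sqrt_pos.mpr hx
  have hN0 : 0 < a * √(x : ℝ) := mul_pos h1 h2
  have hy0 : 0 < √(a * √(x : ℝ)) := Real.sqrt_pos.mpr hN0
  have hy2 : √(a * √(x : ℝ)) ^ 2 = a * √(x : ℝ) := Real.sq_sqrt hN0.le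
  have hy4 : √(a * √(x : ℝ)) ^ 4 = (a : ℝ) ^ 2 * x := by
    rw [show √(a * √(x : ℝ)) ^ 4 = (√(a * √(x : ℝ)) ^ 2) ^ 2 by ring, hy2, mul_pow, Real.sq_sqrt hx.le]
  have hl4 : √(√(a : ℝ)) ^ 4 = a := by
    rw [show √(√(a : ℝ)) ^ 4 = (√(√(a : ℝ)) ^ 2) ^ 2 by ring, Real.sq_sqrt (Real.sqrt_nonneg _), Real.sq_sqrt h1.le]
  refine ⟨√(√(a : ℝ)), √(a * √(x : ℝ)), Real.sqrt_nonneg _, hy0, hl4, hy2, hy4, ?_⟩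
  apply le_of_pow_le_pow_left₀ (n := 4) (by norm_num) hy0.le
  rw [hy4, show (√(√(a : ℝ)) ^ 3) ^ 4 = (√(√(a : ℝ)) ^ 4) ^ 3 by ring, hl4]
  have : (a : ℝ) ≤ x := by exact_mod_cast hax
  calc (a : ℝ) ^ 3 = a ^ 2 * a := by ring
    _ ≤ _ := by gcongr

lemma arith_fin (C l y S I : ℝ) (hC : 0 < C) (hy0 : 0 < y) (hly : l ^ 3 ≤ y)
    (hS0 : 0 ≤ S) (hI : I ≤ C * (y ^ 6 + l ^ 3 * y ^ 5)) (hcs : (y ^ 4) ^ 2 ≤ S * I) :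
    y ^ 2 ≤ 2 * C * S := by
  have hI2 : I ≤ 2 * C * y ^ 6 := by
    have : l ^ 3 * y ^ 5 ≤ y * y ^ 5 := by gcongr
    have : C * (y ^ 6 + l ^ 3 * y ^ 5) ≤ C * (y ^ 6 + y * y ^ 5) := by gcongr
    linarith [(by ring : C * (y ^ 6 + y * y ^ 5) = 2 * C * y ^ 6)]
  have h5 : y ^ 6 * y ^ 2 ≤ y ^ 6 * (2 * C * S) := by
    calc y ^ 6 * y ^ 2 = (y ^ 4) ^ 2 := by ring
      _ ≤ S * I := hcs
      _ ≤ S * (2 * C * y ^ 6) := by gcongr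
      _ = _ := by ring
  exact le_of_mul_le_mul_left h5 (by positivity)

lemma small_case : ∃ C : ℝ, 0 < C ∧ ∀ (p : ℕ) [Fact p.Prime] (β : ZMod p) (φ ψ : ZMod p → ZMod p), β ≠ 0 →
    ∀ A X : Finset (ZMod p), #A ≤ #X → 24 * (#A * √(#X : ℝ)) < p →
      #A * √(#X : ℝ) ≤ C * #(SS (fun a b => β * a * b + φ a + ψ b) A X) := by
  obtain ⟨C, hC, hmain⟩ := In_bound
  refine ⟨2 * C, mul_pos two_pos hC, ?_⟩
  intro p _ β φ ψ hβ A X hAX hp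
  classical
  rcases Nat.eq_zero_or_pos #A with hA | hA
  · rw [hA, Nat.cast_zero, zero_mul]
    exact mul_nonneg (mul_pos two_pos hC).le (Nat.cast_nonneg _)
  obtain ⟨l, y, hl0, hy0, hl4, hy2, hy4, hly⟩ := arith_ly #A #X hA hAX
  obtain ⟨K, _, _, i, s, t, hst⟩ := exists_field p
  obtain ⟨U, W, hU, hW, hcfg, hE⟩ := energy_le p β hβ φ ψ A X i s t hst
  have hcs := energy_cs ((A ×ˢ A) ×ˢ X) (fun q => (β * q.1.1 * q.1.2 + φ q.1.1 + ψ q.1.2) + q.2)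
  have hI := hmain K p #A l y U W hl0 hl4.ge hy0.le (by rw [hy2]; exact hp) hcfg
    (by rw [hy4]; exact_mod_cast hU) (by rw [hy4]; exact_mod_cast hW)
  have hcs2 : #((A ×ˢ A) ×ˢ X) ^ 2 ≤ #(SS (fun a b => β * a * b + φ a + ψ b) A X) * In U W := by
    refine le_trans ?_ (Nat.mul_le_mul le_rfl hE)
    unfold SS
    convert hcs
  have hcs3 : ((#A : ℝ) ^ 2 * #X) ^ 2 ≤ #(SS (fun a b => β * a * b + φ a + ψ b) A X) * In U W := by
    rw [card_product, card_product, ← sq] at hcs2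
    exact_mod_cast hcs2
  rw [← hy4] at hcs3
  have h6 := arith_fin C l y _ _ hC hy0 hly (Nat.cast_nonneg _) hI hcs3
  rwa [hy2] at h6

lemma final_case : ∃ c : ℝ, 0 < c ∧ ∀ (p : ℕ) [Fact p.Prime] (β : ZMod p) (φ ψ : ZMod p → ZMod p), β ≠ 0 →
    ∀ A X : Finset (ZMod p), #A ≤ #X →
      c * min (#A * √(#X : ℝ)) p ≤ #(SS (fun a b => β * a * b + φ a + ψ b) A X) := by
  obtain ⟨C, hC, hmain⟩ := small_case
  refine ⟨min (1 / (50 * C)) (1 / 625), by positivity, ?_⟩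
  intro p hpp β φ ψ hβ A X hAX
  set S : ℝ := (#(SS (fun a b => β * a * b + φ a + ψ b) A X) : ℝ) with hS
  have hS0 : 0 ≤ S := by positivity
  set c := min (1 / (50 * C)) (1 / 625) with hc
  have hc0 : 0 < c := by positivity
  have hc1 : c * (50 * C) ≤ 1 := by
    rw [← le_div_iff₀ (by positivity)]; exact min_le_left _ _
  have hc2 : c * 625 ≤ 1 := by
    rw [← le_div_iff₀ (by norm_num)]; exact min_le_right _ _
  have hp0 : (0 : ℝ) < p := by exact_mod_cast hpp.out.pos
  have hfin : ∀ T : ℝ, 0 ≤ T → T ≤ 50 * C * S → c * T ≤ S := by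
    intro T _ hT
    calc c * T ≤ c * (50 * C * S) := by gcongr
      _ = c * (50 * C) * S := by ring
      _ ≤ 1 * S := by gcongr
      _ = S := one_mul _
  rcases Nat.eq_zero_or_pos #A with hA | hA
  · rw [hA]; simp; exact hS0
  have hX : 0 < #X := by omega
  have hA' : (0 : ℝ) < #A := by exact_mod_cast hA
  have hX' : (0 : ℝ) < √(#X : ℝ) := Real.sqrt_pos.mpr (by exact_mod_cast hX)
  by_cases hsm : 24 * (#A * √(#X : ℝ)) < p
  · refine hfin _ (by positivity) ?_
    refine (min_le_left _ _).trans ((hmain p β φ ψ hβ A X hAX hsm).trans ?_)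
    rw [← hS]
    nlinarith [mul_nonneg hC.le hS0]
  · push Not at hsm
    have hmin : c * min (#A * √(#X : ℝ)) p ≤ c * p := by
      gcongr; exact min_le_right _ _
    refine hmin.trans ?_
    set k := ⌊(p : ℝ) / (25 * √(#X : ℝ))⌋₊ with hk
    have hk1 : (k : ℝ) ≤ p / (25 * √(#X : ℝ)) := Nat.floor_le (by positivity)
    have hk2 : (p : ℝ) / (25 * √(#X : ℝ)) < k + 1 := Nat.lt_floor_add_one _
    rw [le_div_iff₀ (by positivity)] at hk1
    rw [div_lt_iff₀ (by positivity)] at hk2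
    rcases Nat.eq_zero_or_pos k with hk0 | hk0
    · rw [hk0] at hk2
      have hXp : #X ≤ p := by
        have := card_le_univ X
        rwa [ZMod.card] at this
      have h1 : √(#X : ℝ) ≤ √(p : ℝ) := Real.sqrt_le_sqrt (by exact_mod_cast hXp)
      have h2 : √(p : ℝ) ^ 2 = p := Real.sq_sqrt hp0.le
      have h3 : 0 < √(p : ℝ) := Real.sqrt_pos.mpr hp0
      have h4 : √(p : ℝ) < 25 := by
        by_contra hcon
        push Not at hcon
        norm_num at hk2
        nlinarith
      have h5 : (p : ℝ) ≤ 625 := by nlinarith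
      have h6 : (1 : ℝ) ≤ S := by
        rw [hS]
        have : 0 < #(SS (fun a b => β * a * b + φ a + ψ b) A X) := by
          rw [card_pos]
          apply Nonempty.image
          exact ((card_pos.mp hA).product (card_pos.mp hA)).product (card_pos.mp hX)
        exact_mod_cast this
      calc c * p ≤ c * 625 := by gcongr
        _ ≤ 1 := hc2
        _ ≤ S := h6
    · have hkA : k ≤ #A := by
        have h1 : (k : ℝ) * (25 * √(#X : ℝ)) ≤ 24 * (#A * √(#X : ℝ)) := hk1.trans hsm
        have h2 : (k * 25 : ℝ) * √(#X : ℝ) ≤ (24 * #A) * √(#X : ℝ) := by linarith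
        have h3 := le_of_mul_le_mul_right h2 hX'
        have : (k : ℝ) ≤ #A := by linarith
        exact_mod_cast this
      obtain ⟨A', hA'A, hA'c⟩ := exists_subset_card_eq hkA
      have hkr : (1 : ℝ) ≤ k := by exact_mod_cast hk0
      have h1 := hmain p β φ ψ hβ A' X (by omega) (by
        rw [hA'c]
        have : 0 < (k : ℝ) * √(#X : ℝ) := by positivity
        linarith)
      rw [hA'c] at h1
      have h2 : #(SS (fun a b => β * a * b + φ a + ψ b) A' X) ≤ #(SS (fun a b => β * a * b + φ a + ψ b) A X) := by
        apply card_le_card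
        apply image_subset_image
        exact product_subset_product (product_subset_product hA'A hA'A) subset_rfl
      have h3 : (#(SS (fun a b => β * a * b + φ a + ψ b) A' X) : ℝ) ≤ S := by rw [hS]; exact_mod_cast h2
      refine hfin _ hp0.le ?_
      have h4 : C * (#(SS (fun a b => β * a * b + φ a + ψ b) A' X) : ℝ) ≤ C * S := by gcongr
      have h5 : (√(#X : ℝ)) ≤ k * √(#X : ℝ) := by nlinarith
      linarith

end final

end QG

theorem stmt_9 :
    ∃ c : ℝ, 0 < c ∧ ∀ (p : ℕ), p.Prime → 2 < p →
      ∀ (g : MvPolynomial (Fin 2) (ZMod p)), g.totalDegree = 2 →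
        MvPolynomial.coeff (Finsupp.single 0 1 + Finsupp.single 1 1) g ≠ 0 →
      ∀ A X : Finset (ZMod p), A.card ≤ X.card →
      c * min ((A.card : ℝ) * (X.card : ℝ) ^ ((1 : ℝ) / 2)) (p : ℝ) ≤
        ((((A ×ˢ A) ×ˢ X).image
          (fun q => MvPolynomial.eval ![q.1.1, q.1.2] g + q.2)).card : ℝ) := by
  obtain ⟨c, hc, h⟩ := QG.final_case
  refine ⟨c, hc, ?_⟩
  intro p hp hp2 g hd hco A X hAX
  haveI := Fact.mk hp
  obtain ⟨β, φ, ψ, hβ, hg⟩ := QG.poly_form g hd hco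
  have h1 := h p β φ ψ hβ A X hAX
  unfold QG.SS at h1
  rw [Real.sqrt_eq_rpow] at h1
  simp only [hg]
  convert h1
end
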